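/- Let X be an absolutely TzS-closed semigroup and A ⊆ VE(X). Assume that for every countably infinite antichain B ⊆ A (in the order e ≤ f ⇔ ef = fe = e), with C := ⋂_{e∈B} H_e/e and h : C → ∏_{e∈B} H_e the homomorphism h(x) = (xe)_{e∈B}, one of the following holds: (1) for every e ∈ B the subsemigroup Ce = {xe : x ∈ C} of H_e is commutative; (2) the semigroup h[C] is polyfinite; (3) h[C] is countable; (4) the cardinality of h[C] is at most the continuum 𝔠 and for every e ∈ A the subsemigroup Ce of H_e is bounded. Then the set Z(X) ∩ √A is bounded in X, and every subsemigroup S of X with S ⊆ Z(X) ∩ √A is absolutely T₂S-closed. -/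

import Mathlib

universe u

open Set TopologicalSpace

/-- A topological space is zero-dimensional: it has a base of clopen sets. -/
def HasClopenBasis (Y : Type*) [TopologicalSpace Y] : Prop :=
  ∃ B : Set (Set Y), (∀ s ∈ B, IsClopen s) ∧ IsTopologicalBasis B

section TopClasses

variable (X : Type u) [Semigroup X]

/-- `X` is absolutely `T₁S`-closed: the image of every homomorphism to a `T₁`
topological semigroup is closed. -/
def AbsolutelyT1SClosed : Prop :=
  ∀ (Y : Type u) [Semigroup Y] [TopologicalSpace Y] [ContinuousMul Y] [T1Space Y]
    (h : X →ₙ* Y), IsClosed (Set.range h)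

/-- `X` is absolutely `T₂S`-closed. -/
def AbsolutelyT2SClosed : Prop :=
  ∀ (Y : Type u) [Semigroup Y] [TopologicalSpace Y] [ContinuousMul Y] [T2Space Y]
    (h : X →ₙ* Y), IsClosed (Set.range h)

/-- `X` is absolutely `TzS`-closed. -/
def AbsolutelyTzSClosed : Prop :=
  ∀ (Y : Type u) [Semigroup Y] [TopologicalSpace Y] [ContinuousMul Y] [T1Space Y],
    HasClopenBasis Y → ∀ (h : X →ₙ* Y), IsClosed (Set.range h)

/-- `X` is `T₁S`-closed: the image of every injective homomorphism to a `T₁`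
topological semigroup with discrete image is closed. -/
def T1SClosed : Prop :=
  ∀ (Y : Type u) [Semigroup Y] [TopologicalSpace Y] [ContinuousMul Y] [T1Space Y]
    (h : X →ₙ* Y), Function.Injective h → DiscreteTopology (Set.range h) →
      IsClosed (Set.range h)

/-- `X` is `T₂S`-closed. -/
def T2SClosed : Prop :=
  ∀ (Y : Type u) [Semigroup Y] [TopologicalSpace Y] [ContinuousMul Y] [T2Space Y]
    (h : X →ₙ* Y), Function.Injective h → DiscreteTopology (Set.range h) →
      IsClosed (Set.range h)

/-- `X` is `TzS`-closed. -/
def TzSClosed : Prop :=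
  ∀ (Y : Type u) [Semigroup Y] [TopologicalSpace Y] [ContinuousMul Y] [T1Space Y],
    HasClopenBasis Y → ∀ (h : X →ₙ* Y), Function.Injective h →
      DiscreteTopology (Set.range h) → IsClosed (Set.range h)

/-- `X` is injectively `T₂S`-closed. -/
def InjectivelyT2SClosed : Prop :=
  ∀ (Y : Type u) [Semigroup Y] [TopologicalSpace Y] [ContinuousMul Y] [T2Space Y]
    (h : X →ₙ* Y), Function.Injective h → IsClosed (Set.range h)

/-- `X` is projectively `T₁S`-closed: all congruence quotients are `T₁S`-closed. -/
def ProjectivelyT1SClosed : Prop := ∀ c : Con X, T1SClosed c.Quotient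

/-- `X` is projectively `TzS`-closed. -/
def ProjectivelyTzSClosed : Prop := ∀ c : Con X, TzSClosed c.Quotient

/-- `X` is projectively `T₁S`-discrete: every homomorphism into a `T₁`
topological semigroup has discrete image. -/
def ProjectivelyT1SDiscrete : Prop :=
  ∀ (Y : Type u) [Semigroup Y] [TopologicalSpace Y] [ContinuousMul Y] [T1Space Y]
    (h : X →ₙ* Y), DiscreteTopology (Set.range h)

/-- `X` is projectively `TzS`-discrete. -/
def ProjectivelyTzSDiscrete : Prop :=
  ∀ (Y : Type u) [Semigroup Y] [TopologicalSpace Y] [ContinuousMul Y] [T1Space Y],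
    HasClopenBasis Y → ∀ (h : X →ₙ* Y), DiscreteTopology (Set.range h)

end TopClasses

/-- `spow x n` is the power `x^(n+1)` in a semigroup; thus as `n` ranges over `ℕ`,
`spow x n` ranges over all powers `x^m`, `m ≥ 1`. -/
def spow {X : Type*} [Semigroup X] (x : X) : ℕ → X
  | 0 => x
  | n + 1 => spow x n * x

section AlgDefs

variable (X : Type*) [Semigroup X]

/-- the set `E(X)` of idempotents. -/
def idemSet : Set X := {x | x * x = x}

/-- `H_e`, the maximal subgroup containing the idempotent `e`. -/
def maxSubgroup (e : X) : Set X :=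
  {x | x * e = x ∧ e * x = x ∧ ∃ y, y * e = y ∧ e * y = y ∧ x * y = e ∧ y * x = e}

/-- The Clifford part `H(X) = ⋃_{e ∈ E(X)} H_e`. -/
def cliffordPart : Set X := ⋃ e ∈ idemSet X, maxSubgroup X e

/-- `H_e/e := {x : xe = ex ∈ H_e}`. -/
def HeCoideal (e : X) : Set X := {x | x * e = e * x ∧ x * e ∈ maxSubgroup X e}

/-- `I` is an ideal of the semigroup `X`. -/
def IsIdealSet (I : Set X) : Prop := ∀ x ∈ I, ∀ y : X, x * y ∈ I ∧ y * x ∈ I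

/-- The set `VE(X)` of viable idempotents: `e` is idempotent and `X ∖ (H_e/e)` is an ideal. -/
def viableIdems : Set X := {e | e ∈ idemSet X ∧ IsIdealSet X (Set.univ \ HeCoideal X e)}

/-- The center `Z(X)`. -/
def centerSet : Set X := {z | ∀ x, z * x = x * z}

/-- `√A = {x : xⁿ ∈ A for some n ≥ 1}`. -/
def sqrtSet (A : Set X) : Set X := {x | ∃ n : ℕ, spow x n ∈ A}

/-- A subset `B ⊆ X` is bounded: there is `n ≥ 1` with `xⁿ` idempotent for all `x ∈ B`. -/
def BoundedSet (B : Set X) : Prop := ∃ n : ℕ, ∀ x ∈ B, spow x n ∈ idemSet X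

/-- The semigroup `X` is bounded. -/
def BoundedSemigroup : Prop := ∃ n : ℕ, ∀ x : X, spow x n ∈ idemSet X

/-- `X` is chain-finite. -/
def ChainFinite : Prop :=
  ∀ I : Set X, I.Infinite → ∃ x ∈ I, ∃ y ∈ I, x * y ≠ x ∧ x * y ≠ y

/-- `G ⊆ X` is a subgroup of the semigroup `X`. -/
def IsSubgroupSet (G : Set X) : Prop :=
  (∀ x ∈ G, ∀ y ∈ G, x * y ∈ G) ∧
    ∃ e ∈ G, (∀ x ∈ G, x * e = x ∧ e * x = x) ∧ ∀ x ∈ G, ∃ y ∈ G, x * y = e ∧ y * x = e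

/-- `X` is group-finite: all its subgroups are finite. -/
def GroupFinite : Prop := ∀ G : Set X, IsSubgroupSet X G → G.Finite

/-- `X` is Clifford+finite: `X ∖ H(X)` is finite. -/
def CliffordPlusFinite : Prop := (Set.univ \ cliffordPart X).Finite

/-- `X` is `E`-commutative: idempotents commute. -/
def ECommutative : Prop := ∀ x ∈ idemSet X, ∀ y ∈ idemSet X, x * y = y * x

end AlgDefs

/-- The Rees congruence associated with an ideal `I` of `X`. -/
def ReesCon {X : Type*} [Semigroup X] (I : Set X) (hI : IsIdealSet X I) : Con X where
  r x y := x = y ∨ (x ∈ I ∧ y ∈ I)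
  iseqv :=
    { refl := fun _ => Or.inl rfl
      symm := by rintro x y (rfl | ⟨h1, h2⟩); exacts [Or.inl rfl, Or.inr ⟨h2, h1⟩]
      trans := by
        rintro x y z (rfl | ⟨h1, h2⟩) (rfl | ⟨h3, h4⟩)
        exacts [Or.inl rfl, Or.inr ⟨h3, h4⟩, Or.inr ⟨h1, h2⟩, Or.inr ⟨h1, h4⟩] }
  mul' := by
    rintro a b c d (rfl | ⟨h1, h2⟩) (rfl | ⟨h3, h4⟩)
    · exact Or.inl rfl
    · exact Or.inr ⟨(hI c h3 a).2, (hI d h4 a).2⟩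
    · exact Or.inr ⟨(hI a h1 c).1, (hI b h2 c).1⟩
    · exact Or.inr ⟨(hI a h1 c).1, (hI b h2 d).1⟩

/-- `X` is ideally `T₂S`-closed: all its Rees quotients are `T₂S`-closed. -/
def IdeallyT2SClosed (X : Type u) [Semigroup X] : Prop :=
  ∀ (I : Set X) (hI : IsIdealSet X I), T2SClosed (ReesCon I hI).Quotient

/-- `X` is ideally `TzS`-closed. -/
def IdeallyTzSClosed (X : Type u) [Semigroup X] : Prop :=
  ∀ (I : Set X) (hI : IsIdealSet X I), TzSClosed (ReesCon I hI).Quotient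

/-- A congruence is a semilattice congruence if its quotient is a commutative
semigroup of idempotents. -/
def IsSemilatticeCon {X : Type*} [Semigroup X] (c : Con X) : Prop :=
  (∀ a b : c.Quotient, a * b = b * a) ∧ ∀ a : c.Quotient, a * a = a

/-- The smallest semilattice congruence `⇕` on `X`, the intersection of all
semilattice congruences. -/
def slCon (X : Type*) [Semigroup X] : Con X := sInf {c | IsSemilatticeCon c}

theorem centerSet_mul_mem {X : Type*} [Semigroup X] {a b : X}
    (ha : a ∈ centerSet X) (hb : b ∈ centerSet X) : a * b ∈ centerSet X := fun t => by
  rw [mul_assoc, hb t, ← mul_assoc, ha t, mul_assoc]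

/-- The ideal center `IZ(X) = {z ∈ Z(X) : zX ⊆ Z(X)}`, as a subsemigroup of `X`. -/
def idealCenter (X : Type*) [Semigroup X] : Subsemigroup X where
  carrier := {z | z ∈ centerSet X ∧ ∀ x : X, z * x ∈ centerSet X}
  mul_mem' := by
    rintro a b ⟨ha, ha'⟩ ⟨hb, hb'⟩
    refine ⟨centerSet_mul_mem ha hb, fun x => ?_⟩
    have h : a * b * x = a * (b * x) := mul_assoc a b x
    rw [h]
    exact centerSet_mul_mem ha (hb' x)

/-- Evaluation of the semigroup polynomial with coefficients `a, l = [a₁, …, aₙ]`: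
`x ↦ a * x * a₁ * x * ⋯ * x * aₙ` (computed in `X¹ = WithOne X`). -/
def polyEval {X : Type*} [Semigroup X] (a : WithOne X) (l : List (WithOne X)) (x : X) :
    WithOne X :=
  l.foldl (fun acc b => acc * (x : WithOne X) * b) a

/-- `f : X → X¹` is a semigroup polynomial of degree `d ≥ 1`. -/
def IsSemigroupPolynomial {X : Type*} [Semigroup X] (f : X → WithOne X) (d : ℕ) : Prop :=
  1 ≤ d ∧ ∃ (a : WithOne X) (l : List (WithOne X)), l.length = d ∧ ∀ x, f x = polyEval a l x

/-- `X` is polybounded. -/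
def Polybounded (X : Type*) [Semigroup X] : Prop :=
  ∃ (k : ℕ) (f : Fin k → X → WithOne X) (d : Fin k → ℕ) (b : Fin k → X),
    (∀ i, IsSemigroupPolynomial (f i) (d i)) ∧ ∀ x : X, ∃ i, f i x = (b i : WithOne X)

/-- `X` is polyfinite. -/
def Polyfinite (X : Type*) [Semigroup X] : Prop :=
  ∃ (d : ℕ) (F : Set X), F.Finite ∧ ∀ x y : X,
    ∃ (f : X → WithOne X) (m : ℕ), m ≤ d ∧ IsSemigroupPolynomial f m ∧
      (∃ u ∈ F, f x = (u : WithOne X)) ∧ ∃ v ∈ F, f y = (v : WithOne X)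

/-- `X` is `B`-centrobounded over `B ⊆ E(X)`: there is `n ≥ 1` such that for every
`e ∈ B` and all `x, y ∈ ⋂_{a ∈ B} H_a/a`, if `w` is the inverse of `y*e` in the group
`H_e` and `(x*e)*w ∈ H_e ∩ Z(X)`, then `((x*e)*w)ⁿ` is an idempotent. -/
def Centrobounded {X : Type*} [Semigroup X] (B : Set X) : Prop :=
  ∃ n : ℕ, ∀ e ∈ B, ∀ x ∈ ⋂ a ∈ B, HeCoideal X a, ∀ y ∈ ⋂ a ∈ B, HeCoideal X a,
    ∀ w ∈ maxSubgroup X e, (y * e) * w = e → w * (y * e) = e →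
      (x * e) * w ∈ maxSubgroup X e → (x * e) * w ∈ centerSet X →
        spow ((x * e) * w) n ∈ idemSet X

/-- `B` is an antichain in the natural partial order `e ≤ f ⇔ ef = fe = e` on idempotents. -/
def IsIdemAntichain {X : Type*} [Semigroup X] (B : Set X) : Prop :=
  ∀ e ∈ B, ∀ f ∈ B, e ≠ f → ¬(e * f = e ∧ f * e = e) ∧ ¬(e * f = f ∧ f * e = f)

namespace AbsClosed

open Filter Topology

section Topology

theorem hasClopenBasis_of_nhds {Y : Type*} [TopologicalSpace Y]
    (h : ∀ y : Y, ∀ U ∈ 𝓝 y, ∃ V ⊆ U, IsClopen V ∧ y ∈ V) : HasClopenBasis Y := by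
  refine ⟨{V | IsClopen V}, fun s hs => hs, ?_⟩
  refine isTopologicalBasis_of_isOpen_of_nhds (fun u hu => hu.isOpen) fun a u ha hu => ?_
  obtain ⟨V, hVU, hV, haV⟩ := h a u (hu.mem_nhds ha)
  exact ⟨V, hV, haV, hVU⟩

theorem HasClopenBasis.exists_clopen {Y : Type*} [TopologicalSpace Y] (h : HasClopenBasis Y)
    {y : Y} {U : Set Y} (hU : U ∈ 𝓝 y) : ∃ V ⊆ U, IsClopen V ∧ y ∈ V := by
  obtain ⟨B, hB, hb⟩ := h
  obtain ⟨V, hV, hy, hVU⟩ := hb.mem_nhds_iff.1 hU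
  exact ⟨V, hVU, hB V hV, hy⟩

theorem HasClopenBasis.of_isInducing {Y Z : Type*} [TopologicalSpace Y] [TopologicalSpace Z]
    {f : Y → Z} (hf : IsInducing f) (hZ : HasClopenBasis Z) : HasClopenBasis Y := by
  refine hasClopenBasis_of_nhds fun y U hU => ?_
  rw [hf.nhds_eq_comap, mem_comap] at hU
  obtain ⟨W, hW, hWU⟩ := hU
  obtain ⟨V, hVW, hV, hy⟩ := HasClopenBasis.exists_clopen hZ hW
  exact ⟨f ⁻¹' V, (preimage_mono hVW).trans hWU, hV.preimage hf.continuous, hy⟩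

theorem hasClopenBasis_of_discrete {Y : Type*} [TopologicalSpace Y] [DiscreteTopology Y] :
    HasClopenBasis Y :=
  hasClopenBasis_of_nhds fun _ U hU => ⟨U, Subset.rfl, isClopen_discrete U, mem_of_mem_nhds hU⟩

theorem hasClopenBasis_pi {ι : Type*} {M : ι → Type*} [∀ i, TopologicalSpace (M i)]
    (h : ∀ i, HasClopenBasis (M i)) : HasClopenBasis (∀ i, M i) := by
  refine hasClopenBasis_of_nhds fun y U hU => ?_
  rw [nhds_pi, Filter.mem_pi] at hU
  obtain ⟨I, hI, t, ht, htU⟩ := hU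
  choose V hVt hV hy using fun i => HasClopenBasis.exists_clopen (h i) (ht i)
  refine ⟨⋂ i ∈ I, {x | x i ∈ V i}, fun x hx => htU fun i hi => hVt i ?_, ?_, ?_⟩
  · exact (mem_iInter₂.1 hx i hi : x i ∈ V i)
  · exact hI.isClopen_biInter fun i _ => (hV i).preimage (continuous_apply i)
  · exact mem_iInter₂.2 fun i _ => hy i

end Topology

/-- The image in a product of discrete semigroups is closed. -/
theorem exists_forall_eq_of_forall_finset {X : Type u} [Semigroup X] (hX : AbsolutelyTzSClosed X)
    {ι : Type u} {M : ι → Type u} [∀ i, Semigroup (M i)] (φ : ∀ i, X →ₙ* M i) (g : ∀ i, M i)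
    (h : ∀ F : Finset ι, ∃ x, ∀ i ∈ F, φ i x = g i) : ∃ x, ∀ i, φ i x = g i := by
  let _ : ∀ i, TopologicalSpace (M i) := fun i => ⊥
  have _ : ∀ i, DiscreteTopology (M i) := fun i => ⟨rfl⟩
  have _ : ∀ i, ContinuousMul (M i) := fun i => ⟨continuous_of_discreteTopology⟩
  let Φ : X →ₙ* (∀ i, M i) :=
    { toFun := fun x i => φ i x
      map_mul' := fun x y => funext fun i => map_mul (φ i) x y }
  have hcl : IsClosed (range Φ) :=
    hX (∀ i, M i) (hasClopenBasis_pi fun i => hasClopenBasis_of_discrete) Φ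
  have : g ∈ closure (range Φ) := by
    rw [mem_closure_iff_nhds]
    intro U hU
    rw [nhds_pi, Filter.mem_pi] at hU
    obtain ⟨I, hI, t, ht, htU⟩ := hU
    obtain ⟨x, hx⟩ := h hI.toFinset
    refine ⟨Φ x, htU fun i hi => ?_, mem_range_self x⟩
    have := hx i (hI.mem_toFinset.2 hi)
    change φ i x ∈ t i
    rw [this]
    exact mem_of_mem_nhds (ht i)
  obtain ⟨x, hx⟩ := hcl.closure_eq ▸ this
  exact ⟨x, fun i => congrFun hx i⟩

/-- A set whose membership is a homomorphism to the two-element semilattice. -/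
def IsPrimeSet {X : Type*} [Semigroup X] (K : Set X) : Prop :=
  ∀ x y, x * y ∈ K ↔ x ∈ K ∧ y ∈ K

open Classical in
/-- The characteristic homomorphism of a prime set. -/
noncomputable def primeHom {X : Type u} [Semigroup X] {K : Set X} (hK : IsPrimeSet K) :
    X →ₙ* ULift.{u} ℕ where
  toFun x := ⟨if x ∈ K then 1 else 0⟩
  map_mul' x y := by
    apply ULift.ext
    by_cases hx : x ∈ K <;> by_cases hy : y ∈ K <;> simp [hK x y, hx, hy]

theorem primeHom_eq_one {X : Type u} [Semigroup X] {K : Set X} (hK : IsPrimeSet K) (x : X) :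
    primeHom hK x = ⟨1⟩ ↔ x ∈ K := by
  by_cases hx : x ∈ K <;> simp [primeHom, hx]

theorem primeHom_eq_zero {X : Type u} [Semigroup X] {K : Set X} (hK : IsPrimeSet K) (x : X) :
    primeHom hK x = ⟨0⟩ ↔ x ∉ K := by
  by_cases hx : x ∈ K <;> simp [primeHom, hx]

theorem IsPrimeSet.not_strictMono {X : Type u} [Semigroup X] (hX : AbsolutelyTzSClosed X)
    {K : ℕ → Set X} (hK : ∀ n, IsPrimeSet (K n)) : ¬ StrictMono K := by
  intro hm
  have hU : IsPrimeSet (⋃ n, K n) := by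
    intro x y
    simp only [mem_iUnion]
    constructor
    · rintro ⟨n, hn⟩
      exact ⟨⟨n, ((hK n x y).1 hn).1⟩, ⟨n, ((hK n x y).1 hn).2⟩⟩
    · rintro ⟨⟨n, hn⟩, ⟨m, hm'⟩⟩
      exact ⟨max n m, (hK _ x y).2 ⟨hm.monotone (le_max_left n m) hn,
        hm.monotone (le_max_right n m) hm'⟩⟩
  obtain ⟨x, hx⟩ := exists_forall_eq_of_forall_finset hX (ι := ULift.{u} (Option ℕ))
    (M := fun _ => ULift.{u} ℕ)
    (fun i => match i.down with
      | none => primeHom hU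
      | some n => primeHom (hK n))
    (fun i => match i.down with
      | none => ⟨1⟩
      | some n => ⟨0⟩) (by
      intro F
      obtain ⟨N, hN⟩ : ∃ N, ∀ n : ℕ, ⟨some n⟩ ∈ F → n ≤ N := by
        obtain ⟨N, hN⟩ := (F.image fun i => i.down.getD 0).bddAbove
        exact ⟨N, fun n hn => hN (Finset.mem_coe.2 (Finset.mem_image.2 ⟨_, hn, rfl⟩))⟩
      obtain ⟨x, hx, hx'⟩ := exists_of_ssubset (hm (Nat.lt_succ_self N))
      refine ⟨x, ?_⟩
      rintro ⟨_ | n⟩ hi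
      · exact (primeHom_eq_one hU x).2 (mem_iUnion.2 ⟨_, hx⟩)
      · exact (primeHom_eq_zero (hK n) x).2 fun h => hx' (hm.monotone (hN n hi) h))
  obtain ⟨n, hn⟩ := mem_iUnion.1 ((primeHom_eq_one hU x).1 (hx ⟨none⟩))
  exact (primeHom_eq_zero (hK n) x).1 (hx ⟨some n⟩) hn

theorem IsPrimeSet.not_strictAnti {X : Type u} [Semigroup X] (hX : AbsolutelyTzSClosed X)
    {K : ℕ → Set X} (hK : ∀ n, IsPrimeSet (K n)) : ¬ StrictAnti K := by
  intro hm
  have hU : IsPrimeSet (⋂ n, K n) := by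
    intro x y
    simp only [mem_iInter, ← forall_and, hK _ x y]
  obtain ⟨x, hx⟩ := exists_forall_eq_of_forall_finset hX (ι := ULift.{u} (Option ℕ))
    (M := fun _ => ULift.{u} ℕ)
    (fun i => match i.down with
      | none => primeHom hU
      | some n => primeHom (hK n))
    (fun i => match i.down with
      | none => ⟨0⟩
      | some n => ⟨1⟩) (by
      intro F
      obtain ⟨N, hN⟩ : ∃ N, ∀ n : ℕ, ⟨some n⟩ ∈ F → n ≤ N := by
        obtain ⟨N, hN⟩ := (F.image fun i => i.down.getD 0).bddAbove
        exact ⟨N, fun n hn => hN (Finset.mem_coe.2 (Finset.mem_image.2 ⟨_, hn, rfl⟩))⟩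
      obtain ⟨x, hx, hx'⟩ := exists_of_ssubset (hm (Nat.lt_succ_self N))
      refine ⟨x, ?_⟩
      rintro ⟨_ | n⟩ hi
      · exact (primeHom_eq_zero hU x).2 fun h => hx' (mem_iInter.1 h _)
      · exact (primeHom_eq_one (hK n) x).2 (hm.antitone (hN n hi) hx))
  exact (primeHom_eq_zero hU x).1 (hx ⟨none⟩) (mem_iInter.2 fun n =>
    (primeHom_eq_one (hK n) x).1 (hx ⟨some n⟩))

end AbsClosed

namespace AbsClosed

open Filter Topology

/-- A topology in which the neighbourhood filter of `a` is `pure a ⊔ 𝓕 a` with `𝓕 a`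
concentrated on isolated points. -/
theorem not_neBot_inf_range {X : Type u} [Semigroup X] (hX : AbsolutelyTzSClosed X)
    {Y : Type u} [Semigroup Y] (𝓕 : Y → Filter Y)
    (hD : ∀ a, ∀ᶠ q in 𝓕 a, 𝓕 q = ⊥)
    (h1 : ∀ a b, ∀ᶠ q in 𝓕 b, q ≠ a)
    (hT : ∀ a, ∃ P ∈ 𝓕 a, ∀ b ≠ a, ∀ᶠ q in 𝓕 b, q ∉ P)
    (hMl : ∀ a b, Tendsto (fun q => a * q) (𝓕 b) (pure (a * b) ⊔ 𝓕 (a * b)))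
    (hMr : ∀ a b, Tendsto (fun q => q * b) (𝓕 a) (pure (a * b) ⊔ 𝓕 (a * b)))
    (hM : ∀ a b, Tendsto (fun p : Y × Y => p.1 * p.2) (𝓕 a ×ˢ 𝓕 b)
      (pure (a * b) ⊔ 𝓕 (a * b)))
    (h : X →ₙ* Y) (y : Y) (hy : y ∉ range h) : ¬ (𝓕 y ⊓ 𝓟 (range h)).NeBot := by
  intro hne
  let _ : TopologicalSpace Y := TopologicalSpace.mkOfNhds fun a => pure a ⊔ 𝓕 a
  have hn : ∀ a : Y, 𝓝 a = pure a ⊔ 𝓕 a := by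
    intro a
    refine TopologicalSpace.nhds_mkOfNhds _ _ (fun b => le_sup_left) fun b s hs => ?_
    rw [mem_sup, mem_pure] at hs
    rw [eventually_sup]
    refine ⟨mem_sup.2 hs, ?_⟩
    filter_upwards [hD b, hs.2] with q hq hqs
    rw [hq, sup_bot_eq]
    exact hqs
  have hopen : ∀ s : Set Y, IsOpen s ↔ ∀ a ∈ s, ∀ᶠ q in 𝓕 a, q ∈ s := by
    intro s
    rw [isOpen_iff_mem_nhds]
    refine forall₂_congr fun a ha => ?_
    rw [hn, mem_sup, mem_pure]
    exact ⟨fun h => h.2, fun h => ⟨ha, h⟩⟩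
  have _ : T1Space Y := by
    refine ⟨fun a => ⟨(hopen _).2 fun b _ => ?_⟩⟩
    exact h1 a b
  have _ : ContinuousMul Y := by
    refine ⟨continuous_iff_continuousAt.2 ?_⟩
    rintro ⟨a, b⟩
    rw [ContinuousAt, nhds_prod_eq, hn, hn, hn, sup_prod, prod_sup, prod_sup, tendsto_sup,
      tendsto_sup, tendsto_sup]
    refine ⟨⟨?_, ?_⟩, ?_, hM a b⟩
    · rw [prod_pure_pure, tendsto_pure_left]
      exact fun s hs => (mem_sup.1 hs).1
    · rw [pure_prod, tendsto_map'_iff]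
      exact hMl a b
    · rw [prod_pure, tendsto_map'_iff]
      exact hMr a b
  have hb : HasClopenBasis Y := by
    refine hasClopenBasis_of_nhds fun a U hU => ?_
    rw [hn, mem_sup, mem_pure] at hU
    obtain ⟨P, hP, hPb⟩ := hT a
    refine ⟨insert a (P ∩ {q | 𝓕 q = ⊥} ∩ U), insert_subset hU.1 inter_subset_right,
      ⟨⟨(hopen _).2 fun b hb => ?_⟩, (hopen _).2 ?_⟩, mem_insert _ _⟩
    · have hba : b ≠ a := fun h => hb (h ▸ mem_insert _ _)
      filter_upwards [hPb b hba, h1 a b] with q hq hqa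
      rintro (rfl | ⟨⟨hq', _⟩, _⟩)
      exacts [hqa rfl, hq hq']
    · rintro b (rfl | ⟨⟨_, hb⟩, _⟩)
      · filter_upwards [hP, hD b, hU.2] with q h1 h2 h3
        exact Or.inr ⟨⟨h1, h2⟩, h3⟩
      · rw [show 𝓕 b = ⊥ from hb]
        exact eventually_bot
  have hcl := hX Y hb h
  refine hy (hcl.closure_eq ▸ mem_closure_iff_clusterPt.2 ?_)
  rw [ClusterPt, hn]
  exact hne.mono (inf_le_inf_right _ le_sup_right)

end AbsClosed

namespace AbsClosed

open Filter Topology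

attribute [local instance] Ultrafilter.mul Ultrafilter.semigroup

theorem ultrafilter_pure_mul {Q : Type*} [Semigroup Q] (a : Q) (U : Ultrafilter Q) :
    (pure a : Ultrafilter Q) * U = U.map (a * ·) := by
  refine Ultrafilter.ext fun s => ?_
  exact Ultrafilter.eventually_mul (pure a) U (· ∈ s)

theorem ultrafilter_mul_pure {Q : Type*} [Semigroup Q] (a : Q) (U : Ultrafilter Q) :
    U * (pure a : Ultrafilter Q) = U.map (· * a) := by
  refine Ultrafilter.ext fun s => ?_
  exact Ultrafilter.eventually_mul U (pure a) (· ∈ s)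

theorem ultrafilter_mul_eq_pure {Q : Type*} [Semigroup Q] {U V : Ultrafilter Q} {s t : Set Q}
    (hs : s ∈ U) (ht : t ∈ V) {w : Q} (h : ∀ p ∈ s, ∀ q ∈ t, p * q = w) :
    U * V = pure w := by
  refine Ultrafilter.eq_of_le ?_
  refine fun r hr => (Ultrafilter.eventually_mul U V (· ∈ r)).2 ?_
  filter_upwards [hs] with p hp
  filter_upwards [ht] with q hq
  rw [h p hp q hq]
  exact hr

theorem hasClopenBasis_ultrafilter (Q : Type*) : HasClopenBasis (Ultrafilter Q) :=
  ⟨ultrafilterBasis Q, by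
    rintro _ ⟨s, rfl⟩
    exact ⟨ultrafilter_isClosed_basic s, ultrafilter_isOpen_basic s⟩, ultrafilterBasis_is_basis⟩

theorem continuous_ultrafilter_map {Q R : Type*} (f : Q → R) :
    Continuous fun U : Ultrafilter Q => U.map f := by
  refine ultrafilterBasis_is_basis.continuous_iff.2 ?_
  rintro _ ⟨s, rfl⟩
  exact ultrafilter_isOpen_basic (f ⁻¹' s)

theorem exists_free_ultrafilter {Q : Type*} {A : Set Q} (hA : A.Infinite) :
    ∃ F : Ultrafilter Q, A ∈ F ∧ ∀ s : Set Q, s.Finite → sᶜ ∈ F := by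
  have _ := hA.cofinite_inf_principal_neBot
  have h := Ultrafilter.of_le (cofinite ⊓ 𝓟 A)
  exact ⟨Ultrafilter.of (cofinite ⊓ 𝓟 A), h (mem_inf_of_right (mem_principal_self A)),
    fun s hs => h (mem_inf_of_left hs.compl_mem_cofinite)⟩

/-- A subsemigroup of the Stone–Čech compactification consisting of principal ultrafilters and
of ultrafilters whose products are principal. -/
theorem not_infinite_of_mul_eq {X : Type u} [Semigroup X] (hX : AbsolutelyTzSClosed X)
    {Q : Type u} [Semigroup Q] (φ : X →ₙ* Q) (hφ : Function.Surjective φ) {A : Set Q}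
    (hA : A.Infinite) (hc : ∀ a ∈ A, ∀ x, a * x = x * a) {z : Q}
    (hz : ∀ a ∈ A, ∀ b ∈ A, a * b = z) : False := by
  obtain ⟨F, hAF, hF⟩ := exists_free_ultrafilter hA
  let Good : Ultrafilter Q → Prop := fun U => U = F ∨ ∃ a : Q, U = pure a * F
  have pp : ∀ a b : Q, (pure a : Ultrafilter Q) * pure b = pure (a * b) := fun a b => by
    rw [ultrafilter_pure_mul, Ultrafilter.map_pure]
  have comm : ∀ c : Q, F * pure c = pure c * F := by
    intro c
    rw [ultrafilter_pure_mul, ultrafilter_mul_pure]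
    refine Ultrafilter.coe_injective (Filter.map_congr ?_)
    filter_upwards [hAF] with x hx using hc x hx c
  have gl : ∀ c U, Good U → Good (pure c * U) := by
    rintro c _ (rfl | ⟨a, rfl⟩)
    · exact Or.inr ⟨c, rfl⟩
    · exact Or.inr ⟨c * a, by rw [← mul_assoc, pp]⟩
  have gr : ∀ c U, Good U → Good (U * pure c) := by
    rintro c _ (rfl | ⟨a, rfl⟩)
    · exact Or.inr ⟨c, comm c⟩
    · exact Or.inr ⟨a * c, by rw [mul_assoc, comm, ← mul_assoc, pp]⟩
  have hf : ∀ U, Good U → ∃ s ∈ U, ∃ f : Q → Q, (∀ p ∈ s, ∃ x ∈ A, p = f x) ∧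
      (∀ x y, f x * y = f (x * y)) ∧ ∀ x ∈ A, ∀ y, x * f y = f (x * y) := by
    rintro _ (rfl | ⟨a, rfl⟩)
    · exact ⟨A, hAF, id, fun p hp => ⟨p, hp, rfl⟩, fun _ _ => rfl, fun _ _ _ => rfl⟩
    · refine ⟨(a * ·) '' A, ?_, (a * ·), ?_, fun x y => mul_assoc a x y, fun x hx y => ?_⟩
      · rw [ultrafilter_pure_mul]
        exact Filter.image_mem_map hAF
      · rintro _ ⟨x, hx, rfl⟩
        exact ⟨x, hx, rfl⟩
      · change x * (a * y) = a * (x * y)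
        rw [← mul_assoc, hc x hx a, mul_assoc]
  have gg : ∀ U V, Good U → Good V → ∃ s ∈ U, ∃ t ∈ V, ∃ w : Q, ∀ p ∈ s, ∀ q ∈ t, p * q = w := by
    intro U V hU hV
    obtain ⟨s, hs, f, h1, h2, _⟩ := hf U hU
    obtain ⟨t, ht, g, h1', _, h3'⟩ := hf V hV
    refine ⟨s, hs, t, ht, f (g z), fun p hp q hq => ?_⟩
    obtain ⟨x, hx, rfl⟩ := h1 p hp
    obtain ⟨y, hy, rfl⟩ := h1' q hq
    rw [h2, h3' x hx, hz x hx y hy]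
  let Y : Subsemigroup (Ultrafilter Q) :=
    { carrier := {U | (∃ q, U = pure q) ∨ Good U}
      mul_mem' := by
        rintro U V (⟨a, rfl⟩ | hU) (⟨b, rfl⟩ | hV)
        · exact Or.inl ⟨a * b, pp a b⟩
        · exact Or.inr (gl a V hV)
        · exact Or.inr (gr b U hU)
        · obtain ⟨s, hs, t, ht, w, hw⟩ := gg U V hU hV
          exact Or.inl ⟨w, ultrafilter_mul_eq_pure hs ht hw⟩ }
  have hpure : ∀ a : Q, ∀ᶠ U in 𝓝 (pure a : Ultrafilter Q), U = pure a := by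
    intro a
    filter_upwards [(ultrafilter_isOpen_basic {a}).mem_nhds (mem_singleton a)] with U hU
    exact Ultrafilter.eq_of_le fun r hr => mem_of_superset hU (singleton_subset_iff.2 hr)
  have _ : ContinuousMul Y := by
    refine ⟨continuous_induced_rng.2 (continuous_iff_continuousAt.2 ?_)⟩
    rintro ⟨⟨U, hU⟩, ⟨V, hV⟩⟩
    have e1 : Tendsto (fun p : Y × Y => (p.1 : Ultrafilter Q)) (𝓝 (⟨U, hU⟩, ⟨V, hV⟩)) (𝓝 U) :=
      (continuous_subtype_val.comp continuous_fst).continuousAt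
    have e2 : Tendsto (fun p : Y × Y => (p.2 : Ultrafilter Q)) (𝓝 (⟨U, hU⟩, ⟨V, hV⟩)) (𝓝 V) :=
      (continuous_subtype_val.comp continuous_snd).continuousAt
    change Tendsto (fun p : Y × Y => (p.1 : Ultrafilter Q) * (p.2 : Ultrafilter Q)) _ (𝓝 (U * V))
    rcases id hU with ⟨a, rfl⟩ | hU'
    · rw [ultrafilter_pure_mul]
      refine Tendsto.congr' ?_ (((continuous_ultrafilter_map (a * ·)).tendsto V).comp e2)
      filter_upwards [e1.eventually (hpure a)] with p hp
      rw [hp, ultrafilter_pure_mul]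
      rfl
    · rcases id hV with ⟨b, rfl⟩ | hV'
      · rw [ultrafilter_mul_pure]
        refine Tendsto.congr' ?_ (((continuous_ultrafilter_map (· * b)).tendsto U).comp e1)
        filter_upwards [e2.eventually (hpure b)] with p hp
        rw [hp, ultrafilter_mul_pure]
        rfl
      · obtain ⟨s, hs, t, ht, w, hw⟩ := gg U V hU' hV'
        rw [ultrafilter_mul_eq_pure hs ht hw]
        refine Tendsto.congr' ?_ tendsto_const_nhds
        filter_upwards [e1.eventually ((ultrafilter_isOpen_basic s).mem_nhds hs),
          e2.eventually ((ultrafilter_isOpen_basic t).mem_nhds ht)] with p hp hq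
        exact (ultrafilter_mul_eq_pure hp hq hw).symm
  let h : X →ₙ* Y :=
    { toFun := fun x => ⟨pure (φ x), Or.inl ⟨_, rfl⟩⟩
      map_mul' := fun x y => Subtype.ext (by
        change (pure (φ (x * y)) : Ultrafilter Q) = pure (φ x) * pure (φ y)
        rw [pp, map_mul]) }
  have hcl := hX Y
    (HasClopenBasis.of_isInducing IsInducing.subtypeVal (hasClopenBasis_ultrafilter Q)) h
  have hmem : (⟨F, Or.inr (Or.inl rfl)⟩ : Y) ∈ closure (range h) := by
    rw [mem_closure_iff_nhds]
    intro W hW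
    rw [nhds_induced, mem_comap] at hW
    obtain ⟨W', hW', hWW⟩ := hW
    obtain ⟨_, ⟨s, rfl⟩, hs, hsW⟩ := ultrafilterBasis_is_basis.mem_nhds_iff.1 hW'
    obtain ⟨q, hq⟩ := F.nonempty_of_mem hs
    obtain ⟨x, rfl⟩ := hφ q
    exact ⟨h x, hWW (hsW hq), mem_range_self x⟩
  obtain ⟨x, hx⟩ := hcl.closure_eq ▸ hmem
  have hx' : (pure (φ x) : Ultrafilter Q) = F := congrArg Subtype.val hx
  have := hF {φ x} (finite_singleton _)
  rw [← hx'] at this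
  exact this rfl

/-- An infinite central set with square in a disjoint ideal cannot exist. -/
theorem not_infinite_of_mul_mem_ideal {X : Type u} [Semigroup X] (hX : AbsolutelyTzSClosed X)
    {I : Set X} (hI : IsIdealSet X I) {A : Set X} (hA : A.Infinite) (hAc : A ⊆ centerSet X)
    (hAI : ∀ a ∈ A, a ∉ I) (hAA : ∀ a ∈ A, ∀ b ∈ A, a * b ∈ I) : False := by
  obtain ⟨a₀, ha₀⟩ := hA.nonempty
  let φ : X →ₙ* (ReesCon I hI).Quotient :=
    { toFun := fun x => (x : (ReesCon I hI).Quotient), map_mul' := fun _ _ => rfl }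
  have hφ : Function.Surjective φ := Quotient.mk''_surjective
  have inj : InjOn φ A := by
    intro x hx y _ hxy
    rcases (Con.eq (ReesCon I hI)).1 hxy with h | h
    exacts [h, absurd h.1 (hAI x hx)]
  refine not_infinite_of_mul_eq hX φ hφ (hA.image inj) (z := φ (a₀ * a₀)) ?_ ?_
  · rintro _ ⟨a, ha, rfl⟩ y
    obtain ⟨x, rfl⟩ := hφ y
    rw [← map_mul, hAc ha x, map_mul]
  · rintro _ ⟨a, ha, rfl⟩ _ ⟨b, hb, rfl⟩
    rw [← map_mul]
    exact (Con.eq (ReesCon I hI)).2 (Or.inr ⟨hAA a ha b hb, hAA a₀ ha₀ a₀ ha₀⟩)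

end AbsClosed

namespace AbsClosed

open Filter Topology

section Powers

variable {X : Type*} [Semigroup X]

theorem spow_mul_spow (x : X) (a b : ℕ) : spow x a * spow x b = spow x (a + b + 1) := by
  induction b with
  | zero => rfl
  | succ b ih => change spow x a * (spow x b * x) = spow x (a + b + 1) * x; rw [← mul_assoc, ih]

theorem spow_spow (x : X) (a b : ℕ) : spow (spow x a) b = spow x (a * b + a + b) := by
  induction b with
  | zero => simp [spow]
  | succ b ih =>
    change spow (spow x a) b * spow x a = _
    rw [ih, spow_mul_spow]
    congr 1
    ring

theorem spow_mem_center {x : X} (hx : x ∈ centerSet X) (n : ℕ) : spow x n ∈ centerSet X := by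
  induction n with
  | zero => exact hx
  | succ n ih => exact centerSet_mul_mem ih hx

theorem mul_spow {x : X} (hx : x ∈ centerSet X) (y : X) (n : ℕ) :
    spow (x * y) n = spow x n * spow y n := by
  induction n with
  | zero => rfl
  | succ n ih =>
    change spow (x * y) n * (x * y) = spow x n * x * (spow y n * y)
    rw [ih, mul_assoc, mul_assoc, ← mul_assoc _ x y, ← hx, mul_assoc x]

theorem map_spow {Y : Type*} [Semigroup Y] (f : X →ₙ* Y) (x : X) (n : ℕ) :
    f (spow x n) = spow (f x) n := by
  induction n with
  | zero => rfl
  | succ n ih => change f (spow x n * x) = spow (f x) n * f x; rw [map_mul, ih]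

theorem spow_idem {e : X} (he : e * e = e) (n : ℕ) : spow e n = e := by
  induction n with
  | zero => rfl
  | succ n ih => change spow e n * e = e; rw [ih, he]

theorem spow_mem_ideal {I : Set X} (hI : IsIdealSet X I) {x : X} {m n : ℕ} (hmn : m ≤ n)
    (h : spow x m ∈ I) : spow x n ∈ I := by
  induction n, hmn using Nat.le_induction with
  | base => exact h
  | succ n _ ih => exact (hI _ ih x).1

end Powers

section Ideals

variable {X : Type u} [Semigroup X]

theorem finite_of_mul_self_mem_ideal (hX : AbsolutelyTzSClosed X) {I : Set X} (hI : IsIdealSet X I) :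
    {x | x ∈ centerSet X ∧ x * x ∈ I ∧ x ∉ I}.Finite := by
  by_contra hinf
  rw [← Set.Infinite] at hinf
  obtain ⟨F, hTF, hF⟩ := exists_free_ultrafilter hinf
  set T := {x | x ∈ centerSet X ∧ x * x ∈ I ∧ x ∉ I} with hT
  have sq : ∀ x ∈ centerSet X, ∀ y, x * x ∈ I → ∀ s, x * y * (x * s) ∈ I := by
    intro x hx y hxx s
    rw [mul_assoc, ← mul_assoc y, ← hx y, mul_assoc, ← mul_assoc]
    exact (hI _ hxx _).1
  have step : ∀ x ∈ T, (∀ᶠ t in F, x * t ∈ I) ∨ ∃ c ∉ I, ∀ᶠ t in F, x * t = c := by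
    intro x hx
    have hfin : {a | a ∉ I ∧ ∃ t ∈ T, a = x * t}.Finite := by
      by_contra h
      refine not_infinite_of_mul_mem_ideal hX hI h ?_ (fun a ha => ha.1) ?_
      · rintro _ ⟨_, t, ht, rfl⟩
        exact centerSet_mul_mem hx.1 ht.1
      · rintro _ ⟨_, t, ht, rfl⟩ _ ⟨_, s, hs, rfl⟩
        exact sq x hx.1 t hx.2.1 s
    by_cases h : ∀ᶠ t in F, x * t ∈ I
    · exact Or.inl h
    · rw [← Ultrafilter.eventually_not] at h
      have : (⋃ c ∈ {a | a ∉ I ∧ ∃ t ∈ T, a = x * t}, {t | x * t = c}) ∈ F := by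
        filter_upwards [h, hTF] with t ht htT
        exact mem_biUnion (⟨ht, t, htT, rfl⟩ : x * t ∈ {a | a ∉ I ∧ ∃ t ∈ T, a = x * t}) rfl
      obtain ⟨c, hc, hcF⟩ := (Ultrafilter.finite_biUnion_mem_iff hfin).1 this
      exact Or.inr ⟨c, hc.1, hcF⟩
  have seq : ∀ (d : X → Prop), (∀ᶠ x in F, ∀ᶠ t in F, d (x * t)) →
      ∃ f : ℕ → X, (∀ n, f n ∈ T) ∧ Function.Injective f ∧ ∀ m n, m ≠ n → d (f m * f n) := by
    intro d hd
    have : Std.Symm fun x y : X => (x ∈ T → y ∈ T → x ≠ y ∧ d (x * y)) := by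
      refine ⟨fun x y h hy hx => ?_⟩
      obtain ⟨h1, h2⟩ := h hx hy
      exact ⟨h1.symm, by rw [hy.1 x]; exact h2⟩
    obtain ⟨f, hf, hf'⟩ := exists_seq_of_forall_finset_exists'
      (fun x => x ∈ T ∧ ∀ᶠ t in F, d (x * t)) (fun x y => x ∈ T → y ∈ T → x ≠ y ∧ d (x * y)) (by
        intro s hs
        have h2 : ∀ᶠ y in F, ∀ x ∈ s, d (x * y) :=
          (Filter.eventually_all_finset s).2 fun x hx => (hs x hx).2
        have h3 : ∀ᶠ y in F, y ∉ s := hF s s.finite_toSet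
        have h4 : ∀ᶠ y in F, y ∈ T := hTF
        obtain ⟨y, h⟩ := ((h2.and (h3.and (h4.and hd)))).exists
        exact ⟨y, h.2.2, fun x hx _ _ => ⟨fun e => h.2.1 (e ▸ hx), h.1 x hx⟩⟩)
    refine ⟨f, fun n => (hf n).1, fun m n hmn => ?_, fun m n hmn =>
      (hf' hmn (hf m).1 (hf n).1).2⟩
    by_contra hne
    exact (hf' hne (hf m).1 (hf n).1).1 hmn
  by_cases hcase : ∀ᶠ x in F, ∀ᶠ t in F, x * t ∈ I
  · obtain ⟨f, hf, finj, hfd⟩ := seq _ hcase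
    refine not_infinite_of_mul_mem_ideal hX hI (infinite_range_of_injective finj) ?_ ?_ ?_
    · rintro _ ⟨n, rfl⟩
      exact (hf n).1
    · rintro _ ⟨n, rfl⟩
      exact (hf n).2.2
    · rintro _ ⟨n, rfl⟩ _ ⟨m, rfl⟩
      rcases eq_or_ne n m with rfl | h
      exacts [(hf n).2.1, hfd n m h]
  · rw [← Ultrafilter.eventually_not] at hcase
    have hG : ∀ᶠ x in F, x ∈ T ∧ ∃ c ∉ I, ∀ᶠ t in F, x * t = c := by
      filter_upwards [hcase, hTF] with x hx hxT
      exact ⟨hxT, (step x hxT).resolve_left hx⟩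
    have hfin : {c | c ∉ I ∧ ∃ x ∈ T, ∀ᶠ t in F, x * t = c}.Finite := by
      by_contra h
      refine not_infinite_of_mul_mem_ideal hX hI h ?_ (fun a ha => ha.1) ?_
      · rintro c ⟨_, x, hx, hc⟩
        obtain ⟨t, rfl, ht⟩ := (hc.and hTF).exists
        exact centerSet_mul_mem hx.1 ht.1
      · rintro c ⟨_, x, hx, hc⟩ d ⟨_, y, hy, hd⟩
        obtain ⟨t, rfl, rfl, ht⟩ := (hc.and (hd.and hTF)).exists
        rw [hx.1 t, hy.1 t]
        exact sq t ht.1 x ht.2.1 y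
    have : (⋃ c ∈ {c | c ∉ I ∧ ∃ x ∈ T, ∀ᶠ t in F, x * t = c}, {x | ∀ᶠ t in F, x * t = c}) ∈ F := by
      filter_upwards [hG] with x hx
      obtain ⟨hxT, c, hc, hxc⟩ := hx
      exact mem_biUnion (⟨hc, x, hxT, hxc⟩ : c ∈ {c | c ∉ I ∧ ∃ x ∈ T, ∀ᶠ t in F, x * t = c}) hxc
    obtain ⟨c, hc, hcF⟩ := (Ultrafilter.finite_biUnion_mem_iff hfin).1 this
    obtain ⟨f, hf, finj, hfd⟩ := seq (· = c) hcF
    have hcI := hc.1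
    have hcZ : c ∈ centerSet X := hfd 0 1 (by simp) ▸ centerSet_mul_mem (hf 0).1 (hf 1).1
    have hI' : IsIdealSet X {y | y ∈ I ∨ y = c ∨ ∃ m, y = c * m} := by
      rintro _ (h | rfl | ⟨m, rfl⟩) y
      · exact ⟨Or.inl (hI _ h y).1, Or.inl (hI _ h y).2⟩
      · exact ⟨Or.inr (Or.inr ⟨y, rfl⟩), Or.inr (Or.inr ⟨y, (hcZ y).symm⟩)⟩
      · exact ⟨Or.inr (Or.inr ⟨m * y, mul_assoc _ _ _⟩),
          Or.inr (Or.inr ⟨y * m, by rw [← mul_assoc, ← hcZ y, mul_assoc]⟩)⟩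
    have hcc : ∀ n, c * f n ∈ I := by
      intro n
      rw [← hfd n (n + 1) (by simp), mul_assoc, (hf (n + 1)).1 (f n), ← mul_assoc]
      exact (hI _ (hf n).2.1 _).1
    refine not_infinite_of_mul_mem_ideal hX hI' (infinite_range_of_injective finj) ?_ ?_ ?_
    · rintro _ ⟨n, rfl⟩
      exact (hf n).1
    · rintro _ ⟨n, rfl⟩ (h | h | ⟨m, h⟩)
      · exact (hf n).2.2 h
      · apply hcI
        rw [← hfd n (n + 1) (by simp), h]
        exact hcc _
      · apply hcI
        rw [← hfd n (n + 1) (by simp), h, mul_assoc, ← (hf (n + 1)).1 m, ← mul_assoc]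
        exact (hI _ (hcc _) _).1
    · rintro _ ⟨n, rfl⟩ _ ⟨m, rfl⟩
      rcases eq_or_ne n m with rfl | h
      exacts [Or.inl (hf n).2.1, Or.inr (Or.inl (hfd n m h))]

/-- Central elements that are nilpotent modulo an ideal. -/
theorem finite_of_spow_mem_ideal (hX : AbsolutelyTzSClosed X) {I : Set X} (hI : IsIdealSet X I) :
    {x | x ∈ centerSet X ∧ (∃ n, spow x n ∈ I) ∧ x ∉ I}.Finite := by
  have key : ∀ k : ℕ, ∃ J : Set X, IsIdealSet X J ∧ ((centerSet X ∩ J) \ I).Finite ∧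
      ∀ x ∈ centerSet X, spow x (2 ^ k - 1) ∈ I → x ∈ J := by
    intro k
    induction k with
    | zero => exact ⟨I, hI, by simp [sdiff_eq, inter_assoc], fun x _ h => h⟩
    | succ k ih =>
      obtain ⟨J, hJ, hfin, hmem⟩ := ih
      refine ⟨{y | y ∈ J ∨ ∃ l ∈ centerSet X, l * l ∈ J ∧ (y = l ∨ ∃ m, y = l * m)}, ?_, ?_, ?_⟩
      · rintro _ (h | ⟨l, hl, hlJ, rfl | ⟨m, rfl⟩⟩) y
        · exact ⟨Or.inl (hJ _ h y).1, Or.inl (hJ _ h y).2⟩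
        · exact ⟨Or.inr ⟨_, hl, hlJ, Or.inr ⟨y, rfl⟩⟩,
            Or.inr ⟨_, hl, hlJ, Or.inr ⟨y, (hl y).symm⟩⟩⟩
        · exact ⟨Or.inr ⟨l, hl, hlJ, Or.inr ⟨m * y, mul_assoc _ _ _⟩⟩,
            Or.inr ⟨l, hl, hlJ, Or.inr ⟨y * m, by rw [← mul_assoc, ← hl y, mul_assoc]⟩⟩⟩
      · refine (hfin.union (finite_of_mul_self_mem_ideal hX hJ)).subset ?_
        rintro x ⟨⟨hxZ, hx⟩, hxI⟩
        by_cases hxJ : x ∈ J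
        · exact Or.inl ⟨⟨hxZ, hxJ⟩, hxI⟩
        · refine Or.inr ⟨hxZ, ?_, hxJ⟩
          rcases hx with h | ⟨l, hl, hlJ, rfl | ⟨m, rfl⟩⟩
          · exact absurd h hxJ
          · exact hlJ
          · rw [mul_assoc, ← mul_assoc m, ← hl m, mul_assoc, ← mul_assoc]
            exact (hJ _ hlJ _).1
      · intro x hx h
        refine Or.inr ⟨x, hx, hmem _ (centerSet_mul_mem hx hx) ?_, Or.inl rfl⟩
        have h2 : spow (x * x) (2 ^ k - 1) = spow x (2 ^ (k + 1) - 1) := by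
          have : x * x = spow x 1 := rfl
          rw [this, spow_spow]
          congr 1
          have := Nat.one_le_two_pow (n := k)
          rw [pow_succ]
          omega
        rw [h2]
        exact h
  have hT := finite_of_mul_self_mem_ideal hX hI
  set T := {x | x ∈ centerSet X ∧ x * x ∈ I ∧ x ∉ I} with hTdef
  obtain ⟨J, _, hfin, hmem⟩ := key (T.ncard + 2)
  refine hfin.subset ?_
  rintro x ⟨hxZ, ⟨n, hn⟩, hxI⟩
  refine ⟨⟨hxZ, hmem x hxZ ?_⟩, hxI⟩
  classical
  have hex : ∃ n, spow x n ∈ I := ⟨n, hn⟩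
  obtain ⟨m, hm, hlt⟩ : ∃ m, spow x m ∈ I ∧ ∀ j < m, spow x j ∉ I :=
    ⟨Nat.find hex, Nat.find_spec hex, fun j hj => Nat.find_min hex hj⟩
  have hcard : m ≤ 2 * T.ncard + 2 := by
    by_contra hcon
    push Not at hcon
    have hinj : InjOn (spow x) (Set.Ico (m / 2) m) := by
      have aux : ∀ i j, i < j → j < m → spow x i ≠ spow x j := by
        intro i j hij hj h
        have h1 : spow x i * spow x (m - j - 1) = spow x j * spow x (m - j - 1) := by rw [h]
        rw [spow_mul_spow, spow_mul_spow, show j + (m - j - 1) + 1 = m by omega] at h1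
        exact hlt _ (by omega) (h1 ▸ hm)
      intro i hi j hj h
      rcases lt_trichotomy i j with h' | h' | h'
      · exact absurd h (aux i j h' hj.2)
      · exact h'
      · exact absurd h.symm (aux j i h' hi.2)
    have hsub : spow x '' (Set.Ico (m / 2) m) ⊆ T := by
      rintro _ ⟨j, hj, rfl⟩
      refine ⟨spow_mem_center hxZ j, ?_, hlt j hj.2⟩
      rw [spow_mul_spow]
      refine spow_mem_ideal hI ?_ hm
      have := hj.1
      omega
    have h1 := Set.ncard_le_ncard hsub hT
    rw [hinj.ncard_image, ← Finset.coe_Ico, Set.ncard_coe_finset, Nat.card_Ico] at h1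
    omega
  refine spow_mem_ideal hI (le_trans hcard ?_) hm
  have : T.ncard + 2 ≤ 2 ^ (T.ncard + 1) := Nat.lt_two_pow_self
  rw [pow_succ]
  omega

end Ideals

end AbsClosed

namespace AbsClosed

open Filter Topology

/-- Central viable idempotents. -/
def CIdem (X : Type u) [Semigroup X] : Type u :=
  {e : X // e ∈ viableIdems X ∧ e ∈ centerSet X}

namespace CIdem

variable {X : Type u} [Semigroup X]

/-- The underlying idempotent. -/
def val (e : CIdem X) : X := Subtype.val e

theorem ext {e f : CIdem X} (h : e.val = f.val) : e = f := Subtype.ext h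

theorem mul_self (e : CIdem X) : e.val * e.val = e.val := e.2.1.1

theorem comm (e : CIdem X) (x : X) : e.val * x = x * e.val := e.2.2 x

theorem mul_mul (e : CIdem X) (x y : X) : x * y * e.val = x * e.val * (y * e.val) := by
  rw [mul_assoc, mul_assoc, ← mul_assoc e.val, e.comm y, mul_assoc, e.mul_self]

/-- The maximal subgroup at a central viable idempotent. -/
def HG (e : CIdem X) : Type u := {x : X // x ∈ maxSubgroup X e.val}

theorem self_mem (e : CIdem X) : e.val ∈ maxSubgroup X e.val :=
  ⟨e.mul_self, e.mul_self, e.val, e.mul_self, e.mul_self, e.mul_self, e.mul_self⟩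

theorem mul_mem (e : CIdem X) {x y : X} (hx : x ∈ maxSubgroup X e.val)
    (hy : y ∈ maxSubgroup X e.val) : x * y ∈ maxSubgroup X e.val := by
  obtain ⟨x1, x2, x', x3, x4, x5, x6⟩ := hx
  obtain ⟨y1, y2, y', y3, y4, y5, y6⟩ := hy
  refine ⟨by rw [mul_assoc, y1], by rw [← mul_assoc, x2], y' * x', by rw [mul_assoc, x3],
    by rw [← mul_assoc, y4], ?_, ?_⟩
  · rw [mul_assoc, ← mul_assoc y, y5, x4, x5]
  · rw [mul_assoc, ← mul_assoc x', x6, y2, y6]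

theorem exists_inv (e : CIdem X) {x : X} (hx : x ∈ maxSubgroup X e.val) :
    ∃ y ∈ maxSubgroup X e.val, y * x = e.val := by
  obtain ⟨x1, x2, x', x3, x4, x5, x6⟩ := hx
  exact ⟨x', ⟨x3, x4, x, x1, x2, x6, x5⟩, x6⟩

noncomputable instance (e : CIdem X) : Group (HG e) :=
  letI : Mul (HG e) := ⟨fun x y => ⟨x.1 * y.1, e.mul_mem x.2 y.2⟩⟩
  letI : One (HG e) := ⟨⟨e.val, e.self_mem⟩⟩
  letI : Inv (HG e) := ⟨fun x => ⟨(e.exists_inv x.2).choose, (e.exists_inv x.2).choose_spec.1⟩⟩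
  Group.ofLeftAxioms (fun x y z => Subtype.ext (mul_assoc x.1 y.1 z.1))
    (fun x => Subtype.ext x.2.2.1) (fun x => Subtype.ext (e.exists_inv x.2).choose_spec.2)

/-- The inclusion of the maximal subgroup. -/
def incl (e : CIdem X) : HG e →ₙ* X where
  toFun x := x.1
  map_mul' _ _ := rfl

theorem incl_injective (e : CIdem X) : Function.Injective e.incl := Subtype.val_injective

theorem incl_one (e : CIdem X) : e.incl 1 = e.val := rfl

theorem range_incl (e : CIdem X) : range e.incl = maxSubgroup X e.val := Subtype.range_val

/-- The set `H_e / e`. -/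
def co (e : CIdem X) : Set X := HeCoideal X e.val

theorem mem_co (e : CIdem X) {x : X} : x ∈ e.co ↔ x * e.val ∈ maxSubgroup X e.val :=
  ⟨fun h => h.2, fun h => ⟨(e.comm x).symm, h⟩⟩

theorem isPrimeSet_co (e : CIdem X) : IsPrimeSet e.co := by
  intro x y
  constructor
  · intro h
    by_contra hcon
    rw [not_and_or] at hcon
    rcases hcon with hx | hy
    · exact (e.2.1.2 x ⟨mem_univ _, hx⟩ y).1.2 h
    · exact (e.2.1.2 y ⟨mem_univ _, hy⟩ x).2.2 h
  · rintro ⟨hx, hy⟩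
    rw [mem_co] at *
    rw [e.mul_mul]
    exact e.mul_mem hx hy

/-- The element `x e` of the maximal subgroup. -/
def toHG (e : CIdem X) (x : X) (h : x ∈ e.co) : HG e := ⟨x * e.val, e.mem_co.1 h⟩

open Classical in
/-- The homomorphism `x ↦ x e` on `H_e / e`, extended by zero. -/
noncomputable def proj (e : CIdem X) : X →ₙ* WithZero (HG e) where
  toFun x := if h : x ∈ e.co then (e.toHG x h : WithZero (HG e)) else 0
  map_mul' x y := by
    by_cases hx : x ∈ e.co <;> by_cases hy : y ∈ e.co
    · rw [dif_pos ((e.isPrimeSet_co x y).2 ⟨hx, hy⟩), dif_pos hx, dif_pos hy, ← WithZero.coe_mul]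
      exact congrArg _ (Subtype.ext (e.mul_mul x y))
    · rw [dif_neg fun h => hy ((e.isPrimeSet_co x y).1 h).2, dif_neg hy, mul_zero]
    · rw [dif_neg fun h => hx ((e.isPrimeSet_co x y).1 h).1, dif_neg hx, zero_mul]
    · rw [dif_neg fun h => hx ((e.isPrimeSet_co x y).1 h).1, dif_neg hx, zero_mul]

theorem proj_of_mem (e : CIdem X) {x : X} (h : x ∈ e.co) : e.proj x = e.toHG x h := dif_pos h

theorem proj_of_notMem (e : CIdem X) {x : X} (h : x ∉ e.co) : e.proj x = 0 := dif_neg h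

theorem proj_eq_coe (e : CIdem X) (x : X) (g : HG e) :
    e.proj x = g ↔ x * e.val = e.incl g := by
  by_cases h : x ∈ e.co
  · rw [proj_of_mem e h, WithZero.coe_inj]
    exact Subtype.ext_iff
  · rw [proj_of_notMem e h]
    refine iff_of_false WithZero.zero_ne_coe fun h' => h (e.mem_co.2 ?_)
    rw [h']
    exact g.2

theorem proj_eq_zero (e : CIdem X) (x : X) : e.proj x = 0 ↔ x ∉ e.co := by
  by_cases h : x ∈ e.co
  · refine iff_of_false (fun h' => ?_) (not_not.2 h)
    rw [proj_of_mem e h] at h'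
    exact WithZero.coe_ne_zero h'
  · exact iff_of_true (e.proj_of_notMem h) h

theorem proj_incl (e : CIdem X) (g : HG e) : e.proj (e.incl g) = g :=
  (e.proj_eq_coe _ _).2 g.2.1

theorem co_subset {e f : CIdem X} (h : e.val * f.val = e.val) : f.co ⊆ e.co := by
  intro x hx
  rw [mem_co] at *
  obtain ⟨_, _, y, y1, y2, y3, y4⟩ := hx
  have hfe : f.val * e.val = e.val := by rw [f.comm, h]
  refine ⟨by rw [mul_assoc, e.mul_self], by rw [← mul_assoc, e.comm, mul_assoc, e.mul_self],
    y * e.val, by rw [mul_assoc, e.mul_self], by rw [← mul_assoc, e.comm, mul_assoc, e.mul_self],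
    ?_, ?_⟩
  · have : x * e.val * (y * e.val) = x * f.val * y * e.val := by
      rw [← e.mul_mul, mul_assoc x f.val, y2]
    rw [this, y3, hfe]
  · have : y * e.val * (x * e.val) = y * (x * f.val) * e.val := by
      rw [← e.mul_mul, mul_assoc, mul_assoc y, mul_assoc x f.val, hfe]
    rw [this, y4, hfe]

theorem eq_of_mem_co {e f : CIdem X} (h : e.val * f.val = e.val) (he : e.val ∈ f.co) : e = f := by
  rw [mem_co, h] at he
  obtain ⟨_, h2, y, _, _, h5, _⟩ := he
  apply ext
  have : e.val * (e.val * y) = f.val := by rw [← mul_assoc, e.mul_self, h5]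
  rw [h5, h] at this
  exact this

theorem val_mem_co (e : CIdem X) : e.val ∈ e.co := by
  rw [mem_co, e.mul_self]
  exact e.self_mem

instance : PartialOrder (CIdem X) where
  le e f := e.val * f.val = e.val
  le_refl e := e.mul_self
  le_trans e f g (h1 : e.val * f.val = e.val) (h2 : f.val * g.val = f.val) := by
    rw [← h1, mul_assoc, h2]
  le_antisymm e f (h1 : e.val * f.val = e.val) (h2 : f.val * e.val = f.val) := by
    apply ext
    rw [← h1, e.comm, h2]

theorem le_def {e f : CIdem X} : e ≤ f ↔ e.val * f.val = e.val := Iff.rfl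

theorem co_ssubset {e f : CIdem X} (h : e < f) : f.co ⊂ e.co :=
  ⟨co_subset h.le, fun hs => h.ne (eq_of_mem_co h.le (hs e.val_mem_co))⟩

theorem not_strictMono (hX : AbsolutelyTzSClosed X) (e : ℕ → CIdem X) : ¬ StrictMono e :=
  fun h => IsPrimeSet.not_strictAnti hX (fun n => (e n).isPrimeSet_co)
    fun _ _ hmn => co_ssubset (h hmn)

theorem not_strictAnti (hX : AbsolutelyTzSClosed X) (e : ℕ → CIdem X) : ¬ StrictAnti e :=
  fun h => IsPrimeSet.not_strictMono hX (fun n => (e n).isPrimeSet_co)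
    fun _ _ hmn => co_ssubset (h hmn)

theorem wellFoundedLT (hX : AbsolutelyTzSClosed X) : WellFoundedLT (CIdem X) :=
  ⟨RelEmbedding.wellFounded_iff_isEmpty.2
    ⟨fun f => not_strictAnti hX f fun _ _ h => f.map_rel_iff.2 h⟩⟩

theorem wellFoundedGT (hX : AbsolutelyTzSClosed X) : WellFoundedGT (CIdem X) :=
  ⟨RelEmbedding.wellFounded_iff_isEmpty.2
    ⟨fun f => not_strictMono hX f fun _ _ h => f.map_rel_iff.2 h⟩⟩

/-- Every sequence has a subsequence which is constant or an injective antichain. -/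
theorem exists_subseq (hX : AbsolutelyTzSClosed X) (e : ℕ → CIdem X) :
    ∃ g : ℕ ↪o ℕ, (∀ n, e (g n) = e (g 0)) ∨
      ∀ m n, m ≠ n → ¬ e (g m) ≤ e (g n) := by
  have gen : ∀ r : CIdem X → CIdem X → Prop, (∀ a b c, r a b → r b c → r a c) →
      (∀ g : ℕ → CIdem X, ¬ ∀ m n, m < n → r (g m) (g n)) → ∀ e : ℕ → CIdem X,
      ∃ g : ℕ ↪o ℕ, ∀ m n, m < n → ¬ r (e (g m)) (e (g n)) := by
    intro r htr hr e
    have : IsTrans (CIdem X) r := ⟨htr⟩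
    obtain ⟨g, hg | hg⟩ := exists_increasing_or_nonincreasing_subseq r e
    · exact absurd hg (hr _)
    · exact ⟨g, hg⟩
  obtain ⟨g1, h1⟩ := gen (· < ·) (fun _ _ _ => lt_trans)
    (fun g h => not_strictMono hX g fun _ _ => h _ _) e
  obtain ⟨g2, h2⟩ := gen (fun a b => b < a) (fun _ _ _ h h' => lt_trans h' h)
    (fun g h => not_strictAnti hX g fun _ _ => h _ _) (e ∘ g1)
  have : IsTrans (CIdem X) (· = ·) := ⟨fun _ _ _ => Eq.trans⟩
  obtain ⟨g3, h3 | h3⟩ := exists_increasing_or_nonincreasing_subseq (· = ·) (e ∘ g1 ∘ g2)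
  · refine ⟨(g3.trans g2).trans g1, Or.inl fun n => ?_⟩
    rcases Nat.eq_zero_or_pos n with rfl | hn
    · rfl
    · exact (h3 0 n hn).symm
  · refine ⟨(g3.trans g2).trans g1, Or.inr fun m n hmn hle => ?_⟩
    rcases lt_or_gt_of_ne hmn with h | h
    · exact h1 _ _ (g2.strictMono (g3.strictMono h)) (lt_of_le_of_ne hle (h3 m n h))
    · exact h2 _ _ (g3.strictMono h) (lt_of_le_of_ne hle fun h' => h3 n m h h'.symm)

end CIdem

end AbsClosed

namespace AbsClosed

open Filter Topology

theorem spow_mul_of_mul_eq {X : Type*} [Semigroup X] {x e : X} (h : x * e = x) (n : ℕ) :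
    spow x n * e = spow x n := by
  cases n with
  | zero => exact h
  | succ n => change spow x n * x * e = spow x n * x; rw [mul_assoc, h]

theorem CIdem.mem_maxSubgroup_of_spow {X : Type u} [Semigroup X] (e : CIdem X) {x : X} {n : ℕ}
    (hn : spow x n = e.val) (h : x * e.val = x) : x ∈ maxSubgroup X e.val := by
  refine ⟨h, by rw [e.comm, h], spow x (2 * n), spow_mul_of_mul_eq h _,
    by rw [e.comm]; exact spow_mul_of_mul_eq h _, ?_, ?_⟩
  · change spow x 0 * _ = _
    rw [spow_mul_spow, show 0 + 2 * n + 1 = n + n + 1 by ring, ← spow_mul_spow, hn, e.mul_self]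
  · change _ * spow x 0 = _
    rw [spow_mul_spow, show 2 * n + 0 + 1 = n + n + 1 by ring, ← spow_mul_spow, hn, e.mul_self]

/-- Almost all central elements with a power in `CIdem X` lie in subgroups. -/
theorem finite_non_clifford {X : Type u} [Semigroup X] (hX : AbsolutelyTzSClosed X) :
    {x | x ∈ centerSet X ∧ ∃ e : CIdem X, (∃ n, spow x n = e.val) ∧ x * e.val ≠ x}.Finite := by
  by_contra hinf
  rw [← Set.Infinite] at hinf
  set T := {x | x ∈ centerSet X ∧ ∃ e : CIdem X, (∃ n, spow x n = e.val) ∧ x * e.val ≠ x}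
  let x : ℕ ↪ T := hinf.natEmbedding
  choose hc e hn hne using fun i => (x i).2
  choose n hn using hn
  obtain ⟨g, hg⟩ := CIdem.exists_subseq hX e
  have hI : IsIdealSet X {y | ∃ i, y * (e (g i)).val = y} := by
    rintro y ⟨i, hi⟩ t
    exact ⟨⟨i, by rw [mul_assoc, ← CIdem.comm, ← mul_assoc, hi]⟩, ⟨i, by rw [mul_assoc, hi]⟩⟩
  refine infinite_range_of_injective (f := fun i => (x (g i) : X))
    ((Subtype.val_injective.comp x.injective).comp g.injective) ?_
  refine (finite_of_spow_mem_ideal hX hI).subset ?_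
  rintro _ ⟨i, rfl⟩
  refine ⟨hc _, ⟨n (g i), i, by rw [hn, CIdem.mul_self]⟩, ?_⟩
  rintro ⟨j, hj⟩
  have hle : e (g i) ≤ e (g j) := by
    rw [CIdem.le_def, ← hn (g i)]
    exact spow_mul_of_mul_eq hj _
  have hij : e (g i) = e (g j) := by
    rcases hg with h | h
    · rw [h i, h j]
    · by_contra hne
      exact h i j (fun h => hne (by rw [h])) hle
  rw [← hij] at hj
  exact hne _ hj

/-- Homomorphisms to a topological semigroup with an isolated zero adjoined. -/
theorem isClosed_preimage_range_withZero {X : Type u} [Semigroup X] (hX : AbsolutelyTzSClosed X)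
    {Y : Type u} [Semigroup Y] [TopologicalSpace Y] [ContinuousMul Y] [T1Space Y]
    (hY : HasClopenBasis Y) (h : X →ₙ* WithZero Y) :
    IsClosed {y : Y | (y : WithZero Y) ∈ range h} := by
  let _ : TopologicalSpace (WithZero Y) :=
    TopologicalSpace.coinduced (fun y : Y => (y : WithZero Y)) inferInstance
  have hopen : ∀ s : Set (WithZero Y), IsOpen s ↔ IsOpen {y : Y | (y : WithZero Y) ∈ s} :=
    fun s => isOpen_coinduced
  have emb : IsOpenEmbedding (fun y : Y => (y : WithZero Y)) := by
    refine IsOpenEmbedding.of_continuous_injective_isOpenMap continuous_coinduced_rng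
      (fun _ _ h => WithZero.coe_inj.1 h) fun U hU => ?_
    rw [hopen]
    convert hU using 1
    ext y
    simp
  have h0 : 𝓝 (0 : WithZero Y) = pure 0 := by
    refine (isOpen_singleton_iff_nhds_eq_pure _).1 ((hopen _).2 ?_)
    convert isOpen_empty
    ext y
    simp
  have hcl : ∀ s : Set (WithZero Y), IsClosed s ↔ IsClosed {y : Y | (y : WithZero Y) ∈ s} := by
    intro s
    rw [← isOpen_compl_iff, hopen, ← isOpen_compl_iff]
    rfl
  have _ : T1Space (WithZero Y) := by
    refine ⟨fun a => (hcl _).2 ?_⟩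
    refine Set.Subsingleton.isClosed ?_
    intro y hy z hz
    exact WithZero.coe_inj.1 ((hy : (y : WithZero Y) = a).trans (hz : (z : WithZero Y) = a).symm)
  have _ : ContinuousMul (WithZero Y) := by
    refine ⟨continuous_iff_continuousAt.2 ?_⟩
    rintro ⟨a, b⟩
    rw [ContinuousAt, nhds_prod_eq]
    induction a with
    | zero =>
      rw [h0, pure_prod, tendsto_map'_iff, zero_mul, h0]
      refine tendsto_pure.2 (Eventually.of_forall fun q => zero_mul q)
    | coe a =>
      induction b with
      | zero =>
        rw [h0, prod_pure, tendsto_map'_iff, mul_zero, h0]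
        refine tendsto_pure.2 (Eventually.of_forall fun q => mul_zero q)
      | coe b =>
        rw [← emb.map_nhds_eq, ← emb.map_nhds_eq, prod_map_map_eq, tendsto_map'_iff,
          ← WithZero.coe_mul, ← nhds_prod_eq]
        exact (continuous_coinduced_rng.comp (continuous_mul (M := Y))).tendsto (a, b)
  have hb : HasClopenBasis (WithZero Y) := by
    refine hasClopenBasis_of_nhds fun a U hU => ?_
    induction a with
    | zero =>
      refine ⟨{0}, singleton_subset_iff.2 (mem_of_mem_nhds hU),
        ⟨isClosed_singleton, (isOpen_singleton_iff_nhds_eq_pure _).2 h0⟩, rfl⟩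
    | coe a =>
      rw [← emb.map_nhds_eq] at hU
      obtain ⟨V, hVU, hV, haV⟩ := HasClopenBasis.exists_clopen hY hU
      have : {y : Y | (y : WithZero Y) ∈ (fun y : Y => (y : WithZero Y)) '' V} = V := by
        ext y
        simp
      refine ⟨(fun y : Y => (y : WithZero Y)) '' V, image_subset_iff.2 hVU,
        ⟨(hcl _).2 ?_, (hopen _).2 ?_⟩, mem_image_of_mem _ haV⟩
      · rw [this]; exact hV.isClosed
      · rw [this]; exact hV.isOpen
  exact (hcl _).1 (hX (WithZero Y) hb h)

end AbsClosed

namespace AbsClosed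

open Filter Topology

theorem countable_submonoid_closure {M : Type*} [Monoid M] {s : Set M} (hs : s.Countable) :
    (Submonoid.closure s : Set M).Countable := by
  have := hs.to_subtype
  have : Countable (FreeMonoid s) := inferInstanceAs (Countable (List s))
  rw [Submonoid.closure_eq_mrange, MonoidHom.coe_mrange]
  exact countable_range _

theorem countable_subgroup_closure {G : Type*} [Group G] {s : Set G} (hs : s.Countable) :
    (Subgroup.closure s : Set G).Countable := by
  rw [← Subgroup.coe_toSubmonoid, Subgroup.closure_toSubmonoid]
  refine countable_submonoid_closure (hs.union ?_)
  rw [← Set.image_inv_eq_inv]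
  exact hs.image _

theorem hasClopenBasis_of_countable {Y : Type*} [TopologicalSpace Y] [CompletelyRegularSpace Y]
    [Countable Y] : HasClopenBasis Y := by
  refine hasClopenBasis_of_nhds fun y U hU => ?_
  obtain ⟨V, hVU, hV, hy⟩ := mem_nhds_iff.1 hU
  obtain ⟨f, hf, hf0, hf1⟩ := CompletelyRegularSpace.completely_regular y Vᶜ hV.isClosed_compl
    (not_not.2 hy)
  have hfc : Continuous fun x => (f x : ℝ) := continuous_subtype_val.comp hf
  obtain ⟨r, hr, hrf⟩ : ∃ r ∈ Set.Ioo (0 : ℝ) 1, r ∉ range fun x => (f x : ℝ) := by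
    by_contra hcon
    push Not at hcon
    exact (Cardinal.Real.Ioo_countable_iff.not.2 (by norm_num : ¬ (1 : ℝ) ≤ 0))
      ((countable_range _).mono hcon)
  refine ⟨{x | (f x : ℝ) < r}, fun x hx => hVU ?_, ⟨?_, isOpen_lt hfc continuous_const⟩, ?_⟩
  · by_contra hxV
    have := hf1 hxV
    have h1 : (f x : ℝ) < r := hx
    rw [this] at h1
    exact absurd h1 (not_lt.2 hr.2.le)
  · convert isClosed_le hfc (continuous_const (y := r)) using 1
    ext x
    exact ⟨fun h => le_of_lt (a := (f x : ℝ)) h,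
      fun h => lt_of_le_of_ne (a := (f x : ℝ)) h fun h' => hrf ⟨x, h'⟩⟩
  · change (f y : ℝ) < r
    rw [hf0]
    exact hr.1

/-- A countable compact group is finite. -/
theorem finite_of_countable_compact {K : Type*} [Group K] [TopologicalSpace K]
    [IsTopologicalGroup K] [T2Space K] [CompactSpace K] [Countable K] : Finite K := by
  obtain ⟨a, x, hx⟩ := nonempty_interior_of_iUnion_of_closed (X := K)
    (f := fun a : K => ({a} : Set K))
    (fun _ => isClosed_singleton) (iUnion_of_singleton K)
  have ha : IsOpen {a} := by
    have h1 : interior {a} = {a} := by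
      refine Subset.antisymm interior_subset ?_
      have : x = a := (interior_subset hx : x ∈ ({a} : Set K))
      exact singleton_subset_iff.2 (this ▸ hx)
    rw [← h1]
    exact isOpen_interior
  have : DiscreteTopology K := by
    refine discreteTopology_of_isOpen_singleton_one ?_
    convert (Homeomorph.mulLeft a⁻¹).isOpenMap _ ha using 1
    simp
  exact finite_of_compact_of_discrete

/-- The universal compactification of an infinite countable abelian group contains new points
in the closure of any generating submonoid. -/
theorem exists_group_completion {Z : Type u} [CommGroup Z] [Countable Z] [Infinite Z]
    (s : Set Z) (hs : Subgroup.closure s = ⊤) :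
    ∃ (H : Type u) (_ : CommGroup H) (_ : TopologicalSpace H) (_ : IsTopologicalGroup H)
      (_ : T2Space H) (ι : Z →* H) (y : H), HasClopenBasis H ∧ y ∉ range ι ∧
      y ∈ closure (ι '' (Submonoid.closure s : Set Z)) := by
  let L := Multiplicative (AddCircle (1 : ℝ))
  let j : AddCircle (1 : ℚ) →+ AddCircle (1 : ℝ) :=
    QuotientAddGroup.map _ _ (Rat.castHom ℝ).toAddMonoidHom (by
      intro x hx
      obtain ⟨n, rfl⟩ := AddSubgroup.mem_zmultiples_iff.1 hx
      exact AddSubgroup.mem_zmultiples_iff.2 ⟨n, by simp⟩)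
  have hj : Function.Injective j := by
    rw [injective_iff_map_eq_zero]
    intro x
    induction x using QuotientAddGroup.induction_on with
    | H x =>
      intro hx
      have hx' : (((x : ℚ) : ℝ) : AddCircle (1 : ℝ)) = 0 := hx
      rw [AddCircle.coe_eq_zero_iff] at hx'
      obtain ⟨n, hn⟩ := hx'
      refine (AddCircle.coe_eq_zero_iff (1 : ℚ)).2 ⟨n, ?_⟩
      have : ((n : ℚ) : ℝ) = (x : ℝ) := by simpa using hn
      have := Rat.cast_injective this
      simpa using this
  let K := CharacterModule (Additive Z) → L
  let ι : Z →* K :=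
    { toFun := fun z χ => Multiplicative.ofAdd (j (χ (Additive.ofMul z)))
      map_one' := funext fun χ => by simp [K]
      map_mul' := fun a b => funext fun χ => by simp [K] }
  have hι : Function.Injective ι := by
    rw [injective_iff_map_eq_one]
    intro z hz
    by_contra hz1
    obtain ⟨χ, hχ⟩ := CharacterModule.exists_character_apply_ne_zero_of_ne_zero
      (a := Additive.ofMul z) (fun h => hz1 (by simpa using h))
    have h1 : Multiplicative.ofAdd (j (χ (Additive.ofMul z))) = 1 := congrFun hz χ
    have h2 : j (χ (Additive.ofMul z)) = 0 := by simpa using h1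
    exact hχ (hj (by rw [h2, map_zero]))
  have _ : CompactSpace K := Pi.compactSpace
  let C : Subgroup K := ι.range.topologicalClosure
  have hC : (C : Set K) = closure (ι '' (Submonoid.closure s : Set Z)) := by
    have h1 : ι '' (Submonoid.closure s : Set Z) = (Submonoid.closure (ι '' s) : Set K) := by
      rw [← MonoidHom.map_mclosure, Submonoid.coe_map]
    rw [h1, closure_submonoidClosure_eq_closure_subgroupClosure, ← MonoidHom.map_closure, hs,
      ← MonoidHom.range_eq_map, Subgroup.topologicalClosure_coe]
  obtain ⟨y, hyC, hyι⟩ : ∃ y ∈ C, y ∉ range ι := by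
    by_contra hcon
    push Not at hcon
    have _ : CompactSpace C := isCompact_iff_compactSpace.1 (isClosed_closure.isCompact)
    have _ : Countable C := ((countable_range ι).mono hcon).to_subtype
    have hfin : Finite C := finite_of_countable_compact
    have : Set.Finite (range ι) := (Set.toFinite (C : Set K)).subset (subset_closure)
    exact infinite_range_of_injective hι this
  let H : Subgroup K := Subgroup.closure (insert y (range ι))
  have _ : Countable H := (countable_subgroup_closure ((countable_range ι).insert y)).to_subtype
  have hιH : ∀ z, ι z ∈ H := fun z => Subgroup.subset_closure (Or.inr ⟨z, rfl⟩)
  refine ⟨H, inferInstance, inferInstance, inferInstance, inferInstance, ι.codRestrict H hιH,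
    ⟨y, Subgroup.subset_closure (Or.inl rfl)⟩, hasClopenBasis_of_countable, ?_, ?_⟩
  · rintro ⟨z, hz⟩
    exact hyι ⟨z, congrArg Subtype.val hz⟩
  · rw [closure_subtype, image_image]
    change y ∈ closure (ι '' _)
    rw [← hC]
    exact hyC

/-- Central amalgamation of a group with a topological group. -/
theorem false_of_completion {X : Type u} [Semigroup X] (hX : AbsolutelyTzSClosed X)
    {G Z H : Type u} [Group G] [CommGroup Z] [CommGroup H] [TopologicalSpace H]
    [IsTopologicalGroup H] [T2Space H] (hH : HasClopenBasis H) (φ : X →ₙ* WithZero G)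
    (j : Z →* G) (hj : Function.Injective j) (hjc : ∀ z g, j z * g = g * j z)
    (ι : Z →* H) {y : H} (hy : y ∉ range ι) {M : Set Z} (hyM : y ∈ closure (ι '' M))
    (hM : ∀ z ∈ M, (j z : WithZero G) ∈ range φ) : False := by
  let _ : TopologicalSpace G := ⊥
  have _ : DiscreteTopology G := ⟨rfl⟩
  have _ : IsTopologicalGroup G := {}
  let N : Subgroup (G × H) :=
    { carrier := {p | ∃ z, p = (j z, (ι z)⁻¹)}
      one_mem' := ⟨1, by simp only [map_one, inv_one]; rfl⟩
      mul_mem' := by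
        rintro _ _ ⟨a, rfl⟩ ⟨b, rfl⟩
        exact ⟨a * b, by simp [mul_comm]⟩
      inv_mem' := by
        rintro _ ⟨a, rfl⟩
        exact ⟨a⁻¹, by simp⟩ }
  have hN : ∀ p : G × H, p ∈ N ↔ ∃ z, p = (j z, (ι z)⁻¹) := fun p => Iff.rfl
  have _ : N.Normal := by
    refine ⟨fun n hn g => ?_⟩
    obtain ⟨z, rfl⟩ := (hN n).1 hn
    refine (hN _).2 ⟨z, Prod.ext ?_ ?_⟩
    · simp [← hjc]
    · simp
  have slice : ∀ S : Set (G × H), (∀ g, IsClosed {h | (g, h) ∈ S}) → IsClosed S := by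
    intro S hS
    rw [← isOpen_compl_iff, isOpen_iff_mem_nhds]
    rintro ⟨g, h⟩ hgh
    rw [nhds_prod_eq, nhds_discrete, pure_prod, mem_map]
    exact (hS g).isOpen_compl.mem_nhds hgh
  have sl : ∀ (g g' : G) (V : Set H), IsClosed V →
      IsClosed {h | ∃ v ∈ V, ∃ z, (g', h) = (g * j z, v * (ι z)⁻¹)} := by
    intro g g' V hV
    by_cases hz : ∃ z, g' = g * j z
    · obtain ⟨z, rfl⟩ := hz
      convert hV.preimage (continuous_mul_const (ι z)) using 1
      ext h
      constructor
      · rintro ⟨v, hv, z', h'⟩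
        obtain ⟨h1, h2⟩ := Prod.ext_iff.1 h'
        have : z = z' := hj (mul_left_cancel h1)
        subst this
        change h * ι z ∈ V
        rw [show h = _ from h2]
        simpa using hv
      · intro h'
        exact ⟨h * ι z, h', z, by simp⟩
    · convert isClosed_empty
      ext h
      refine iff_of_false ?_ (notMem_empty _)
      rintro ⟨v, _, z, h'⟩
      exact hz ⟨z, (Prod.ext_iff.1 h').1⟩
  have hpre : ∀ (g : G) (V : Set H),
      QuotientGroup.mk (s := N) ⁻¹' (QuotientGroup.mk '' ({g} ×ˢ V)) =
      {p | ∃ v ∈ V, ∃ z, p = (g * j z, v * (ι z)⁻¹)} := by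
    intro g V
    ext p
    constructor
    · rintro ⟨⟨g', v⟩, ⟨hg, hv⟩, h⟩
      obtain rfl : g' = g := hg
      obtain ⟨z, hz⟩ := (hN _).1 (QuotientGroup.eq.1 h)
      refine ⟨v, hv, z, ?_⟩
      rw [inv_mul_eq_iff_eq_mul] at hz
      exact hz
    · rintro ⟨v, hv, z, rfl⟩
      refine ⟨(g, v), ⟨rfl, hv⟩, QuotientGroup.eq.2 ?_⟩
      exact ⟨z, by rw [inv_mul_eq_iff_eq_mul]; rfl⟩
  have hclosed : ∀ (g : G) (V : Set H), IsClosed V →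
      IsClosed (QuotientGroup.mk (s := N) '' ({g} ×ˢ V)) := by
    intro g V hV
    rw [← (QuotientGroup.isQuotientMap_mk N).isClosed_preimage, hpre]
    exact slice _ fun g' => sl g g' V hV
  have _ : T1Space ((G × H) ⧸ N) := by
    refine ⟨fun a => ?_⟩
    obtain ⟨⟨g, h⟩, rfl⟩ := QuotientGroup.mk_surjective a
    convert hclosed g {h} isClosed_singleton
    simp
  have hb : HasClopenBasis ((G × H) ⧸ N) := by
    refine hasClopenBasis_of_nhds fun a U hU => ?_
    obtain ⟨⟨g, h⟩, rfl⟩ := QuotientGroup.mk_surjective a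
    have h1 : QuotientGroup.mk (s := N) ⁻¹' U ∈ 𝓝 (g, h) :=
      (QuotientGroup.isQuotientMap_mk N).continuous.continuousAt hU
    rw [nhds_prod_eq, nhds_discrete, pure_prod, mem_map] at h1
    obtain ⟨V, hVU, hV, hhV⟩ := HasClopenBasis.exists_clopen hH h1
    refine ⟨QuotientGroup.mk '' ({g} ×ˢ V), ?_, ⟨hclosed g V hV.isClosed,
      QuotientGroup.isOpenMap_coe _ ((isOpen_discrete _).prod hV.isOpen)⟩,
      mem_image_of_mem _ ⟨rfl, hhV⟩⟩
    rintro _ ⟨⟨g', v⟩, ⟨hg, hv⟩, rfl⟩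
    obtain rfl : g' = g := hg
    exact hVU hv
  let q : G →* (G × H) ⧸ N := (QuotientGroup.mk' N).comp (MonoidHom.inl G H)
  let h : X →ₙ* WithZero ((G × H) ⧸ N) :=
    ((WithZero.map' q : WithZero G →*₀ WithZero ((G × H) ⧸ N)) :
      WithZero G →ₙ* WithZero ((G × H) ⧸ N)).comp φ
  have hcl := isClosed_preimage_range_withZero hX hb h
  have hmem : (QuotientGroup.mk (s := N) (1, y)) ∈
      closure {y : (G × H) ⧸ N | (y : WithZero ((G × H) ⧸ N)) ∈ range h} := by
    have hc : Continuous fun t : H => QuotientGroup.mk (s := N) ((1 : G), t) :=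
      (QuotientGroup.isQuotientMap_mk N).continuous.comp (continuous_const.prodMk continuous_id)
    refine map_mem_closure (f := fun t : H => QuotientGroup.mk (s := N) ((1 : G), t)) hc hyM ?_
    rintro _ ⟨z, hz, rfl⟩
    obtain ⟨x, hx⟩ := hM z hz
    refine ⟨x, ?_⟩
    change WithZero.map' q (φ x) = _
    rw [hx, WithZero.map'_coe, WithZero.coe_inj]
    refine QuotientGroup.eq.2 ((hN _).2 ⟨z⁻¹, ?_⟩)
    simp
  obtain ⟨x, hx⟩ := hcl.closure_eq ▸ hmem
  have hx' : WithZero.map' q (φ x) = ((QuotientGroup.mk (s := N) (1, y) : (G × H) ⧸ N) :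
    WithZero ((G × H) ⧸ N)) := hx
  rcases hφ : φ x with _ | g
  · change φ x = 0 at hφ
    rw [hφ, map_zero] at hx'
    exact WithZero.zero_ne_coe hx'
  · change φ x = (g : WithZero G) at hφ
    rw [hφ, WithZero.map'_coe, WithZero.coe_inj] at hx'
    obtain ⟨z, hz⟩ := (hN _).1 (QuotientGroup.eq.1 hx')
    have h2 := (Prod.ext_iff.1 hz).2
    refine hy ⟨z⁻¹, ?_⟩
    rw [map_inv, ← show _ = (ι z)⁻¹ from h2]
    simp

/-- An infinite central semigroup in a group quotient contradicts closedness. -/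
theorem not_infinite_central {X : Type u} [Semigroup X] (hX : AbsolutelyTzSClosed X)
    {G : Type u} [Group G] (φ : X →ₙ* WithZero G) {R : Set G} (hR : R.Infinite)
    (hRc : ∀ r ∈ R, ∀ g, r * g = g * r) (hRm : ∀ r ∈ R, ∀ r' ∈ R, r * r' ∈ R)
    (hRφ : ∀ r ∈ R, (r : WithZero G) ∈ range φ) : False := by
  have key : ∃ R₁ : Set G, R₁ ⊆ R ∧ R₁.Infinite ∧ R₁.Countable := by
    refine ⟨range fun n => (hR.natEmbedding R n : G), ?_, ?_, countable_range _⟩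
    · rintro _ ⟨n, rfl⟩
      exact (hR.natEmbedding R n).2
    · exact infinite_range_of_injective (Subtype.val_injective.comp (hR.natEmbedding R).injective)
  obtain ⟨R₁, hR₁, hinf, hcount⟩ := key
  let Z := Subgroup.closure R₁
  have hZc : ∀ z ∈ Z, ∀ g, z * g = g * z := by
    intro z hz g
    have : Z ≤ Subgroup.center G := by
      rw [Subgroup.closure_le]
      intro r hr
      exact Subgroup.mem_center_iff.2 fun g => (hRc r (hR₁ hr) g).symm
    exact (Subgroup.mem_center_iff.1 (this hz) g).symm
  let _ : CommGroup Z := { (inferInstance : Group Z) with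
    mul_comm := fun a b => Subtype.ext (hZc a a.2 b) }
  have _ : Countable Z := (countable_subgroup_closure hcount).to_subtype
  have _ : Infinite Z := (hinf.mono Subgroup.subset_closure).to_subtype
  obtain ⟨H, _, _, _, _, ι, y, hb, hy, hyM⟩ := exists_group_completion (Z := Z)
    (Subtype.val ⁻¹' R₁) (Subgroup.closure_closure_coe_preimage)
  have hsub : ∀ z ∈ Submonoid.closure (Subtype.val ⁻¹' R₁ : Set Z), z = 1 ∨ (z : G) ∈ R := by
    intro z hz
    induction hz using Submonoid.closure_induction with
    | mem x hx => exact Or.inr (hR₁ hx)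
    | one => exact Or.inl rfl
    | mul x y _ _ hx hy =>
      rcases hx with rfl | hx
      · rw [one_mul]; exact hy
      · rcases hy with rfl | hy
        · rw [mul_one]; exact Or.inr hx
        · exact Or.inr (hRm _ hx _ hy)
  have hyM' : y ∈ closure (ι '' {z : Z | (z : G) ∈ R}) := by
    have hss : ι '' (Submonoid.closure (Subtype.val ⁻¹' R₁ : Set Z) : Set Z) ⊆
        insert (ι 1) (ι '' {z : Z | (z : G) ∈ R}) := by
      rintro _ ⟨z, hz, rfl⟩
      rcases hsub z hz with rfl | h
      · exact Or.inl rfl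
      · exact Or.inr ⟨z, h, rfl⟩
    have := closure_mono hss hyM
    rw [insert_eq, closure_union, closure_singleton] at this
    exact this.resolve_left fun h => hy ⟨1, h.symm⟩
  exact false_of_completion hX hb φ Z.subtype Subtype.val_injective
    (fun z g => hZc z z.2 g) ι hy hyM' fun z hz => hRφ _ hz

/-- The center meets each maximal subgroup of a central viable idempotent in a finite set. -/
theorem CIdem.finite_center {X : Type u} [Semigroup X] (hX : AbsolutelyTzSClosed X)
    (e : CIdem X) : (centerSet X ∩ maxSubgroup X e.val).Finite := by
  by_contra hinf
  refine not_infinite_central hX e.proj (R := {g : HG e | e.incl g ∈ centerSet X}) ?_ ?_ ?_ ?_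
  · refine Set.Infinite.of_image e.incl ?_
    refine Set.Infinite.mono ?_ hinf
    rintro x ⟨hx, hxe⟩
    exact ⟨⟨x, hxe⟩, hx, rfl⟩
  · intro r hr g
    exact e.incl_injective (hr (e.incl g))
  · intro r hr r' hr'
    exact centerSet_mul_mem hr hr'
  · intro r _
    exact ⟨_, e.proj_incl r⟩

end AbsClosed

namespace AbsClosed

open Filter Topology

theorem tendsto_spow {Y α : Type*} [Semigroup Y] [TopologicalSpace Y] [ContinuousMul Y]
    {l : Filter α} {f : α → Y} {y : Y} (h : Tendsto f l (𝓝 y)) (n : ℕ) :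
    Tendsto (fun a => spow (f a) n) l (𝓝 (spow y n)) := by
  induction n with
  | zero => exact h
  | succ n ih => exact ih.mul h

/-- Elements with a power in a set of viable idempotents, inside the center. -/
theorem exists_cidem {X : Type u} [Semigroup X] {A : Set X} (hA : A ⊆ viableIdems X) {x : X}
    (hx : x ∈ centerSet X ∩ sqrtSet X A) : ∃ e : CIdem X, e.val ∈ A ∧ ∃ n, spow x n = e.val := by
  obtain ⟨hxZ, n, hn⟩ := hx
  exact ⟨⟨spow x n, hA hn, spow_mem_center hxZ n⟩, hn, n, rfl⟩

theorem spow_eq_of_idem {X : Type*} [Semigroup X] {x e : X} {m n : ℕ} (he : e * e = e)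
    (hm : spow x m = e) (hn : spow x n * spow x n = spow x n) : spow x n = e := by
  have h1 : spow (spow x m) n = spow (spow x n) m := by
    rw [spow_spow, spow_spow]
    congr 1
    ring
  rw [hm, spow_idem he, spow_idem hn] at h1
  exact h1.symm

theorem absolutelyT2SClosed_of_bounded {X : Type u} [Semigroup X] (hX : AbsolutelyTzSClosed X)
    {A : Set X} (hA : A ⊆ viableIdems X) (hb : BoundedSet X (centerSet X ∩ sqrtSet X A))
    {S : Subsemigroup X} (hS : (S : Set X) ⊆ centerSet X ∩ sqrtSet X A) :
    AbsolutelyT2SClosed S := by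
  intro Y _ _ _ _ h
  refine isClosed_of_closure_subset fun y hy => ?_
  have hne : (comap h (𝓝 y)).NeBot := comap_neBot fun t ht => by
    obtain ⟨_, ht', x, rfl⟩ := mem_closure_iff_nhds.1 hy t ht
    exact ⟨x, ht'⟩
  obtain ⟨𝒰, h𝒰⟩ : ∃ 𝒰 : Ultrafilter S, Tendsto h 𝒰 (𝓝 y) :=
    ⟨Ultrafilter.of _, tendsto_iff_comap.2 (Ultrafilter.of_le _)⟩
  by_cases hprinc : ∃ T : Set S, T.Finite ∧ T ∈ 𝒰
  · obtain ⟨T, hT, hTU⟩ := hprinc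
    have : y ∈ h '' T := by
      refine (hT.image h).isClosed.mem_of_tendsto h𝒰 ?_
      filter_upwards [hTU] with s hs using mem_image_of_mem _ hs
    exact image_subset_range _ _ this
  push Not at hprinc
  obtain ⟨N, hN⟩ := hb
  have coe_spow : ∀ (s : S) n, ((spow s n : S) : X) = spow (s : X) n :=
    fun s n => map_spow (MulMemClass.subtype S : S →ₙ* X) s n
  have idem_mem : ∀ p : S, p * p = p → ∃ e : CIdem X, e.val = p := by
    intro p hp
    obtain ⟨e, _, n, hn⟩ := exists_cidem hA (hS p.2)
    refine ⟨e, ?_⟩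
    rw [← hn]
    exact spow_idem (congrArg Subtype.val hp) n
  have hE : ∀ s : S, spow s N * spow s N = spow s N := fun s => Subtype.ext (by
    change (spow s N : S).1 * (spow s N : S).1 = (spow s N : S).1
    rw [coe_spow]
    exact hN s (hS s.2))
  choose c hc using fun s : S => idem_mem (spow s N) (hE s)
  have hcl : ∀ᶠ s in (𝒰 : Filter S), s * spow s N = s := by
    by_contra hcon
    rw [← Ultrafilter.eventually_not] at hcon
    refine hprinc _ ?_ hcon
    refine Set.Finite.of_finite_image ((finite_non_clifford hX).subset ?_)
      Subtype.val_injective.injOn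
    rintro _ ⟨s, hs, rfl⟩
    refine ⟨(hS s.2).1, c s, ⟨N, by rw [hc, coe_spow]⟩, fun h => hs (Subtype.ext ?_)⟩
    rw [hc] at h
    exact h
  set f := spow y N with hf
  have tE : Tendsto (fun s => h (spow s N)) 𝒰 (𝓝 f) := by
    simp only [map_spow]
    exact tendsto_spow h𝒰 N
  have hff : f * f = f := by
    refine tendsto_nhds_unique (tE.mul tE) (tE.congr fun s => ?_)
    rw [← map_mul, hE]
  have hyf : y * f = y := by
    refine tendsto_nhds_unique (h𝒰.mul tE) (h𝒰.congr' ?_)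
    filter_upwards [hcl] with s hs
    rw [← map_mul, hs]
  have sub : ∀ (U : Set Y), IsOpen U → f ∈ U → ∀ B : Set (CIdem X),
      (∀ᶠ s in (𝒰 : Filter S), ∀ b ∈ B, b ≤ c s) → ∃ r : S, ∃ e : CIdem X, e.val = r ∧ h r ∈ U ∧
        (∀ᶠ s in (𝒰 : Filter S), e ≤ c s) ∧ ∀ b ∈ B, b ≤ e := by
    intro U hU hfU B hB
    have := CIdem.wellFoundedLT hX
    obtain ⟨e, ⟨p, hep, hpU, hpB⟩, hmin⟩ := WellFounded.has_min (wellFounded_lt (α := CIdem X))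
      {e | ∃ p : S, e.val = p ∧ h p * f ∈ U ∧ ∀ b ∈ B, b ≤ e} (by
        have h1 : ∀ᶠ s in (𝒰 : Filter S), h (spow s N) * f ∈ U :=
          (tE.mul_const f).eventually (hU.mem_nhds (by rwa [hff]))
        obtain ⟨s, hs1, hs2⟩ := (h1.and hB).exists
        exact ⟨c s, spow s N, hc s, hs1, hs2⟩)
    have hle : ∀ᶠ s in (𝒰 : Filter S), e ≤ c s := by
      have h1 : ∀ᶠ s in (𝒰 : Filter S), h (p * spow s N) * f ∈ U := by
        have : Tendsto (fun s => h (p * spow s N) * f) 𝒰 (𝓝 (h p * f * f)) := by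
          simp only [map_mul]
          exact (tE.const_mul (h p)).mul_const f
        refine this.eventually (hU.mem_nhds ?_)
        rwa [mul_assoc, hff]
      filter_upwards [h1, hB] with s hs1 hs2
      have hpp : p * p = p := Subtype.ext (by
        change (p : X) * p = p
        rw [← hep, e.mul_self])
      have hcomm : spow s N * p = p * spow s N := Subtype.ext ((hS p.2).1 _).symm
      have hq : p * spow s N * (p * spow s N) = p * spow s N := by
        rw [mul_assoc, ← mul_assoc (spow s N), hcomm, mul_assoc, hE, ← mul_assoc, hpp]
      obtain ⟨q, hq⟩ := idem_mem _ hq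
      have hqv : q.val = e.val * (c s).val := by rw [hq, hep, hc]; rfl
      have hqe : q ≤ e := by
        rw [CIdem.le_def, hqv, mul_assoc, (c s).comm, ← mul_assoc, e.mul_self]
      have hqm := hmin q ⟨p * spow s N, hq, hs1, fun b hb => by
        rw [CIdem.le_def, hqv, ← mul_assoc, hpB b hb, hs2 b hb]⟩
      have hqe' : q = e := by
        by_contra hne
        exact hqm (lt_of_le_of_ne hqe hne)
      rw [CIdem.le_def, ← hqv, hqe']
    refine ⟨p, e, hep, ?_, hle, hpB⟩
    have h2 : h p * f = h p := by
      refine tendsto_nhds_unique (tE.const_mul (h p)) (tendsto_const_nhds.congr' ?_)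
      filter_upwards [hle] with s hs
      rw [← map_mul]
      congr 1
      apply Subtype.ext
      change (p : X) = p * (spow s N : S)
      rw [← hc, ← hep]
      exact (CIdem.le_def.1 hs).symm
    rwa [h2] at hpU
  have hex : ∃ r : S, ∃ e : CIdem X, e.val = r ∧ h r = f ∧ ∀ᶠ s in (𝒰 : Filter S), e ≤ c s := by
    have := CIdem.wellFoundedGT hX
    obtain ⟨e, ⟨r, her, hle⟩, hmax⟩ := WellFounded.has_min (wellFounded_gt (α := CIdem X))
      {e | ∃ r : S, e.val = r ∧ ∀ᶠ s in (𝒰 : Filter S), e ≤ c s} (by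
        obtain ⟨r, e, her, _, hle, _⟩ := sub univ isOpen_univ (mem_univ _) ∅ (by simp)
        exact ⟨e, r, her, hle⟩)
    refine ⟨r, e, her, ?_, hle⟩
    by_contra hne
    obtain ⟨r', e', her', hr', hle', hbe⟩ := sub {h r}ᶜ isOpen_compl_singleton
      (fun h' => hne h'.symm) {e} (by simpa using hle)
    refine hmax e' ⟨r', her', hle'⟩ (lt_of_le_of_ne (hbe e rfl) ?_)
    rintro rfl
    exact hr' (congrArg h (Subtype.ext (her'.symm.trans her)))
  obtain ⟨r, e, her, hrf, hle⟩ := hex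
  have hfin : {t : S | (t : X) ∈ centerSet X ∩ maxSubgroup X e.val}.Finite :=
    (CIdem.finite_center hX e).preimage Subtype.val_injective.injOn
  refine image_subset_range h _ ((hfin.image h).isClosed.mem_of_tendsto
    (f := fun s => h (s * r)) (b := (𝒰 : Filter S)) ?_ ?_)
  · simp only [map_mul, hrf]
    have := h𝒰.mul_const f
    rwa [hyf] at this
  · filter_upwards [hle] with s hs
    refine mem_image_of_mem _ ⟨(hS (s * r).2).1, e.mem_maxSubgroup_of_spow (n := N) ?_ ?_⟩
    · change spow ((s : X) * r) N = e.val
      rw [mul_spow (hS s.2).1, ← coe_spow, ← hc, ← her, spow_idem e.mul_self, ← e.comm]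
      exact hs
    · change (s : X) * r * e.val = s * r
      rw [← her, mul_assoc, e.mul_self]

end AbsClosed

namespace AbsClosed

open Filter Topology

attribute [local instance] Ultrafilter.mul Ultrafilter.semigroup

section Germs

variable {G : ℕ → Type u} [∀ i, Group (G i)]

theorem mul_pi_single (q : ∀ i, WithZero (G i)) (i : ℕ) (g : WithZero (G i)) :
    q * Pi.single i g = Pi.single i (q i * g) := by
  funext j
  by_cases h : j = i
  · subst h
    simp
  · simp [h]

theorem pi_single_mul (q : ∀ i, WithZero (G i)) (i : ℕ) (g : WithZero (G i)) :
    Pi.single i g * q = Pi.single i (g * q i) := by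
  funext j
  by_cases h : j = i
  · subst h
    simp
  · simp [h]

/-- The elements of the product which have finite support or belong to `R`. -/
def finOrMem (R : Submonoid (∀ i, G i)) : Subsemigroup (∀ i, WithZero (G i)) where
  carrier := {q | {i | q i ≠ 0}.Finite ∨ ∃ c ∈ R, ∀ i, q i = c i}
  mul_mem' := by
    rintro a b (ha | ⟨c, hc, ha⟩) hb
    · exact Or.inl (ha.subset fun i hi => left_ne_zero_of_mul hi)
    · rcases hb with hb | ⟨d, hd, hb⟩
      · exact Or.inl (hb.subset fun i hi => right_ne_zero_of_mul hi)
      · refine Or.inr ⟨c * d, R.mul_mem hc hd, fun i => ?_⟩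
        rw [Pi.mul_apply, ha, hb, Pi.mul_apply, WithZero.coe_mul]

theorem pi_single_mem_finOrMem (R : Submonoid (∀ i, G i)) (i : ℕ) (g : WithZero (G i)) :
    Pi.single i g ∈ finOrMem R := by
  refine Or.inl ((finite_singleton i).subset fun j hj => ?_)
  by_contra h
  exact hj (Pi.single_eq_of_ne (M := fun i => WithZero (G i)) h g)

/-- The element `g` in the `i`-th coordinate. -/
def finOrMem.single (R : Submonoid (∀ i, G i)) (i : ℕ) (g : WithZero (G i)) : finOrMem R :=
  ⟨Pi.single i g, pi_single_mem_finOrMem R i g⟩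

theorem finOrMem.single_zero (R : Submonoid (∀ i, G i)) (i j : ℕ) :
    finOrMem.single R i 0 = finOrMem.single R j 0 :=
  Subtype.ext ((Pi.single_zero i).trans (Pi.single_zero j).symm)

theorem finOrMem.mul_single {R : Submonoid (∀ i, G i)} (q : finOrMem R) (i : ℕ)
    (g : WithZero (G i)) : q * finOrMem.single R i g = finOrMem.single R i (q.1 i * g) :=
  Subtype.ext (mul_pi_single _ _ _)

theorem finOrMem.single_mul {R : Submonoid (∀ i, G i)} (q : finOrMem R) (i : ℕ)
    (g : WithZero (G i)) : finOrMem.single R i g * q = finOrMem.single R i (g * q.1 i) :=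
  Subtype.ext (pi_single_mul _ _ _)

theorem finOrMem.eq_of_single_eq {R : Submonoid (∀ i, G i)} {i j : ℕ} {g : G i} {k : WithZero (G j)}
    (h : finOrMem.single R i g = finOrMem.single R j k) : i = j := by
  by_contra hij
  have : (Pi.single i (g : WithZero (G i)) : ∀ i, WithZero (G i)) i =
    (Pi.single j k : ∀ i, WithZero (G i)) i := congrFun (congrArg Subtype.val h) i
  rw [Pi.single_eq_same, Pi.single_eq_of_ne hij] at this
  exact WithZero.coe_ne_zero this

theorem finOrMem.single_injective {R : Submonoid (∀ i, G i)} {i : ℕ} {g k : WithZero (G i)}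
    (h : finOrMem.single R i g = finOrMem.single R i k) : g = k := by
  have : (Pi.single i g : ∀ i, WithZero (G i)) i =
    (Pi.single i k : ∀ i, WithZero (G i)) i := congrFun (congrArg Subtype.val h) i
  rwa [Pi.single_eq_same, Pi.single_eq_same] at this

/-- A semigroup extension of `finOrMem R` by the germs at infinity of the sequences
`c i * ζ i`, `c ∈ R`. -/
theorem exists_germ_extension (R : Submonoid (∀ i, G i)) (ζ : ∀ i, G i)
    (hζ : ∀ i g, ζ i * g = g * ζ i) :
    ∃ (Y : Type u) (_ : Semigroup Y) (pt : finOrMem R →ₙ* Y) (om : R → Y),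
      Function.Injective pt ∧ (∀ q c, pt q ≠ om c) ∧ (∀ y, y ∈ range pt ∨ y ∈ range om) ∧
      (∀ c c', om c ≠ om c' → ∀ᶠ i in (hyperfilter ℕ : Filter ℕ), c.1 i ≠ c'.1 i) ∧
      (∀ c c', om c = om c' → ∀ᶠ i in (hyperfilter ℕ : Filter ℕ), c.1 i = c'.1 i) ∧
      (∀ (q : finOrMem R) (c : R), (∀ i, q.1 i = c.1 i) →
        ∀ c', pt q * om c' = om (c * c') ∧ om c' * pt q = om (c' * c)) ∧
      (∀ q : finOrMem R, {i | q.1 i ≠ 0}.Finite → ∀ c, pt q * om c = pt (finOrMem.single R 0 0) ∧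
        om c * pt q = pt (finOrMem.single R 0 0)) ∧
      ∀ c c', om c * om c' = pt (finOrMem.single R 0 0) := by
  let s : R → ∀ _ : ℕ, ∀ i, WithZero (G i) := fun c i => Pi.single i ((c.1 i * ζ i : G i))
  let om : R → Ultrafilter (∀ i, WithZero (G i)) := fun c => (hyperfilter ℕ).map (s c)
  have hom : ∀ c c', (∀ᶠ i in (hyperfilter ℕ : Filter ℕ), c.1 i = c'.1 i) → om c = om c' := by
    intro c c' h
    refine Ultrafilter.coe_injective (Filter.map_congr ?_)
    filter_upwards [h] with i hi
    simp only [s, hi]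
  have z0 : ∀ {U V : Ultrafilter (∀ i, WithZero (G i))}
      {S T : Set (∀ i, WithZero (G i))}, S ∈ U → T ∈ V → (∀ p ∈ S, ∀ q ∈ T, p * q = 0) →
      U * V = pure 0 := fun hs ht h => ultrafilter_mul_eq_pure hs ht h
  have fin_ev : ∀ q : ∀ i, WithZero (G i), {i | q i ≠ 0}.Finite →
      ∀ᶠ i in (hyperfilter ℕ : Filter ℕ), q i = 0 := by
    intro q hq
    refine hyperfilter_le_cofinite ?_
    filter_upwards [hq.compl_mem_cofinite] with i hi
    exact not_not.1 hi
  have r1 : ∀ q : ∀ i, WithZero (G i), {i | q i ≠ 0}.Finite → ∀ c,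
      pure q * om c = pure 0 ∧ om c * pure q = pure 0 := by
    intro q hq c
    have h1 : {i | q i = 0} ∈ hyperfilter ℕ := fin_ev q hq
    have h2 : s c '' {i | q i = 0} ∈ om c := image_mem_map h1
    have h3 : {q} ∈ (pure q : Ultrafilter (∀ i, WithZero (G i))) := mem_singleton q
    constructor
    · refine z0 h3 h2 ?_
      rintro _ rfl _ ⟨i, hi, rfl⟩
      rw [mul_pi_single, hi, zero_mul, Pi.single_zero]
    · refine z0 h2 h3 ?_
      rintro _ ⟨i, hi, rfl⟩ _ rfl
      rw [pi_single_mul, hi, mul_zero, Pi.single_zero]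
  have r2 : ∀ (q : ∀ i, WithZero (G i)) (c : R), (∀ i, q i = c.1 i) → ∀ c',
      pure q * om c' = om (c * c') ∧ om c' * pure q = om (c' * c) := by
    intro q c hq c'
    constructor
    · rw [ultrafilter_pure_mul]
      refine Ultrafilter.coe_injective ?_
      rw [Ultrafilter.coe_map, Ultrafilter.coe_map, Ultrafilter.coe_map, Filter.map_map]
      refine Filter.map_congr (Eventually.of_forall fun i => ?_)
      change q * Pi.single i _ = Pi.single i _
      rw [mul_pi_single, hq, ← WithZero.coe_mul, ← mul_assoc]
      rfl
    · rw [ultrafilter_mul_pure]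
      refine Ultrafilter.coe_injective ?_
      rw [Ultrafilter.coe_map, Ultrafilter.coe_map, Ultrafilter.coe_map, Filter.map_map]
      refine Filter.map_congr (Eventually.of_forall fun i => ?_)
      change Pi.single i _ * q = Pi.single i _
      rw [pi_single_mul, hq, ← WithZero.coe_mul, mul_assoc, hζ, ← mul_assoc]
      rfl
  have r3 : ∀ c c', om c * om c' = pure 0 := by
    intro c c'
    refine Ultrafilter.eq_of_le fun r hr => (Ultrafilter.eventually_mul _ _ (· ∈ r)).2 ?_
    have hr : (0 : ∀ i, WithZero (G i)) ∈ r := hr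
    change ∀ᶠ i in (hyperfilter ℕ : Filter ℕ), ∀ᶠ j in (hyperfilter ℕ : Filter ℕ),
      s c i * s c' j ∈ r
    refine Eventually.of_forall fun i => ?_
    refine hyperfilter_le_cofinite ?_
    filter_upwards [(finite_singleton i).compl_mem_cofinite] with j hj
    have : s c i * s c' j = 0 := by
      have h0 : s c i j = 0 := Pi.single_eq_of_ne (M := fun i => WithZero (G i)) hj _
      change s c i * Pi.single j _ = 0
      rw [mul_pi_single, h0, zero_mul, Pi.single_zero]
    rw [this]
    exact hr
  have zmem : (0 : ∀ i, WithZero (G i)) ∈ finOrMem R :=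
    Or.inl (by simp)
  have hz : (finOrMem.single R 0 0).1 = 0 := Pi.single_zero 0
  have sinj : ∀ {c c' : R} {i j : ℕ}, s c i = s c' j → i = j := by
    intro c c' i j h
    by_contra hij
    have := congrFun h i
    simp only [s] at this
    rw [Pi.single_eq_same, Pi.single_eq_of_ne hij] at this
    exact WithZero.coe_ne_zero this
  let Y : Subsemigroup (Ultrafilter (∀ i, WithZero (G i))) :=
    { carrier := {U | (∃ q ∈ finOrMem R, U = pure q) ∨ ∃ c, U = om c}
      mul_mem' := by
        rintro _ _ (⟨q, hq, rfl⟩ | ⟨c, rfl⟩) (⟨q', hq', rfl⟩ | ⟨c', rfl⟩)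
        · refine Or.inl ⟨q * q', mul_mem hq hq', ?_⟩
          rw [ultrafilter_pure_mul, Ultrafilter.map_pure]
        · rcases hq with hq | ⟨c, hc, hq⟩
          · exact Or.inl ⟨0, zmem, (r1 q hq c').1⟩
          · exact Or.inr ⟨_, (r2 q ⟨c, hc⟩ hq c').1⟩
        · rcases hq' with hq | ⟨c', hc, hq⟩
          · exact Or.inl ⟨0, zmem, (r1 q' hq c).2⟩
          · exact Or.inr ⟨_, (r2 q' ⟨c', hc⟩ hq c).2⟩
        · exact Or.inl ⟨0, zmem, r3 c c'⟩ }
  have som : ∀ c c', om c = om c' → ∀ᶠ i in (hyperfilter ℕ : Filter ℕ), c.1 i = c'.1 i := by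
    intro c c' h
    by_contra hcon
    rw [← Ultrafilter.eventually_not] at hcon
    have h1 : s c '' {i | ¬ c.1 i = c'.1 i} ∈ om c := image_mem_map hcon
    have h2 : s c' '' {i | ¬ c.1 i = c'.1 i} ∈ om c := by
      rw [h]
      exact image_mem_map hcon
    obtain ⟨_, ⟨i, hi, rfl⟩, j, _, hij⟩ := (om c).nonempty_of_mem (inter_mem h1 h2)
    obtain rfl : j = i := sinj hij
    exact hi (mul_right_cancel (WithZero.coe_inj.1 (Pi.single_injective j hij))).symm
  refine ⟨Y, inferInstance, ⟨fun q => ⟨pure q.1, Or.inl ⟨q.1, q.2, rfl⟩⟩, fun q q' => ?_⟩,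
    fun c => ⟨om c, Or.inr ⟨c, rfl⟩⟩, ?_, ?_, ?_, ?_, ?_, ?_, ?_, ?_⟩
  · refine Subtype.ext ?_
    change pure (q.1 * q'.1) = pure q.1 * pure q'.1
    rw [ultrafilter_pure_mul, Ultrafilter.map_pure]
  · intro q q' h
    exact Subtype.ext (Ultrafilter.pure_injective (congrArg Subtype.val h))
  · intro q c h
    have h1 : {q.1} ∈ om c := by
      have hq : (pure q.1 : Ultrafilter _) = om c := congrArg Subtype.val h
      rw [← hq]
      exact mem_singleton q.1
    obtain ⟨i, hi⟩ := (hyperfilter ℕ).nonempty_of_mem h1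
    refine (hyperfilter ℕ).empty_notMem ?_
    filter_upwards [h1, hyperfilter_le_cofinite (finite_singleton i).compl_mem_cofinite]
      with j hj hij
    exact hij (sinj (hj.trans hi.symm))
  · rintro ⟨_, ⟨q, hq, rfl⟩ | ⟨c, rfl⟩⟩
    · exact Or.inl ⟨⟨q, hq⟩, rfl⟩
    · exact Or.inr ⟨c, rfl⟩
  · intro c c' h
    refine Ultrafilter.eventually_not.2 fun h' => h (Subtype.ext (hom c c' h'))
  · exact fun c c' h => som c c' (congrArg Subtype.val h)
  · exact fun q c hq c' => ⟨Subtype.ext (r2 q.1 c hq c').1, Subtype.ext (r2 q.1 c hq c').2⟩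
  · intro q hq c
    refine ⟨Subtype.ext ?_, Subtype.ext ?_⟩
    · exact (r1 q.1 hq c).1.trans (congrArg pure hz.symm)
    · exact (r1 q.1 hq c).2.trans (congrArg pure hz.symm)
  · exact fun c c' => Subtype.ext ((r3 c c').trans (congrArg pure hz.symm))

end Germs

end AbsClosed

namespace AbsClosed

open Filter Topology

theorem false_of_germ_neighbourhoods {X : Type u} [Semigroup X] (hX : AbsolutelyTzSClosed X)
    {G : ℕ → Type u} [∀ i, Group (G i)] (φ : ∀ i, X →ₙ* WithZero (G i))
    (R : Submonoid (∀ i, G i))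
    (hφ : ∀ x, {i | φ i x ≠ 0}.Finite ∨ ∃ c ∈ R, ∀ i, φ i x = c i)
    (ζ : ∀ i, G i) (hζ : ∀ i g, ζ i * g = g * ζ i)
    (hs : ∀ i, ∃ x, ∀ j, φ j x = (Pi.single i (ζ i : WithZero (G i)) : ∀ j, WithZero (G j)) j)
    (V : ℕ → ∀ i, Set (G i)) (ha : ∀ k i, V (k + 1) i ⊆ V k i)
    (hb : ∀ k i, ∀ g ∈ V (k + 1) i, ∀ g' ∈ V (k + 1) i, g * g' ∈ V k i)
    (hc : ∀ c ∈ R, ∀ k, ∀ᶠ i in atTop, ∀ g ∈ V (k + 1) i, c i * g ∈ V k i ∧ g * c i ∈ V k i)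
    (hd : ∀ k, ∀ᶠ i in atTop, ∀ g ∈ V (k + 1) i, g * ζ i ∈ V k i)
    (he : ∀ k, ∀ᶠ i in atTop, ζ i * ζ i ∈ V k i)
    (hf : ∀ c ∈ R, ∀ᶠ i in atTop, c i * ζ i ∉ V 0 i) : False := by
  obtain ⟨Y, _, pt, om, hinj, hne, hY, hom, hom', hqo, hfo, hoo⟩ := exists_germ_extension R ζ hζ
  set sg : ∀ i, G i → finOrMem R := fun i g => finOrMem.single R i g with hsg
  set z : finOrMem R := finOrMem.single R 0 0 with hz
  have sg_ne : ∀ i g, sg i g ≠ z := by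
    intro i g h
    rw [hsg, hz, finOrMem.single_zero R 0 i] at h
    exact WithZero.coe_ne_zero (finOrMem.single_injective h)
  have sg_inj : ∀ {i j g g'}, sg i g = sg j g' → i = j := fun h => finOrMem.eq_of_single_eq h
  have sg_inj' : ∀ {i g g'}, sg i g = sg i g' → g = g' :=
    fun h => WithZero.coe_inj.1 (finOrMem.single_injective h)
  have mul_sg : ∀ {q : finOrMem R} {i g c}, q.1 i = (c : G i) → q * sg i g = sg i (c * g) := by
    intro q i g c h
    rw [hsg, finOrMem.mul_single, h]
    rfl
  have sg_mul' : ∀ {q : finOrMem R} {i g c}, q.1 i = (c : G i) → sg i g * q = sg i (g * c) := by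
    intro q i g c h
    rw [hsg, finOrMem.single_mul, h]
    rfl
  have mul_sg0 : ∀ {q : finOrMem R} {i g}, q.1 i = 0 → q * sg i g = z := by
    intro q i g h
    rw [hsg, finOrMem.mul_single, h, zero_mul, hz, finOrMem.single_zero]
  have sg_mul0 : ∀ {q : finOrMem R} {i g}, q.1 i = 0 → sg i g * q = z := by
    intro q i g h
    rw [hsg, finOrMem.single_mul, h, mul_zero, hz, finOrMem.single_zero]
  have sg_mul : ∀ i g g', sg i g * sg i g' = sg i (g * g') :=
    fun i g g' => mul_sg (Pi.single_eq_same (M := fun i => WithZero (G i)) i _)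
  have sg_mul_ne : ∀ {i j g g'}, i ≠ j → sg i g * sg j g' = z :=
    fun h => mul_sg0 (Pi.single_eq_of_ne (M := fun i => WithZero (G i)) h.symm _)
  have z_mul : ∀ q, z * q = z := by
    intro q
    rw [hz, finOrMem.single_mul, zero_mul]
  have mul_z : ∀ q, q * z = z := by
    intro q
    rw [hz, finOrMem.mul_single, mul_zero]
  have sg_fin : ∀ i (g : WithZero (G i)), {j | (finOrMem.single R i g).1 j ≠ 0}.Finite := by
    intro i g
    refine (finite_singleton i).subset fun j hj => ?_
    by_contra h
    exact hj (Pi.single_eq_of_ne (M := fun i => WithZero (G i)) h g)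
  have om_z : ∀ c, pt z * om c = pt z ∧ om c * pt z = pt z := hfo z (sg_fin 0 0)
  have om_sg : ∀ c i g, pt (sg i g) * om c = pt z ∧ om c * pt (sg i g) = pt z :=
    fun c i g => hfo _ (sg_fin i g) c
  have fin_ev : ∀ q : finOrMem R, {i | q.1 i ≠ 0}.Finite → ∀ᶠ i in atTop, q.1 i = 0 := by
    intro q hq
    rw [← Nat.cofinite_eq_atTop]
    filter_upwards [hq.compl_mem_cofinite] with i hi
    exact not_not.1 hi
  let B : ℕ → Set Y := fun k => {y | ∃ i ≥ k, ∃ g ∈ V k i, y = pt (sg i g)}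
  have hVanti : ∀ i, Antitone fun k => V k i := fun i => antitone_nat_of_succ_le fun k => ha k i
  have hB : Antitone B := by
    rintro k l hkl _ ⟨i, hi, g, hg, rfl⟩
    exact ⟨i, hkl.trans hi, g, hVanti i hkl hg, rfl⟩
  let 𝓑 : Filter Y := ⨅ k, 𝓟 (B k)
  have h𝓑 : 𝓑.HasAntitoneBasis B := HasAntitoneBasis.iInf_principal hB
  let sq : R → ℕ → Y := fun c i => pt (sg i (c.1 i * ζ i))
  let 𝓞 : R → Filter Y := fun c => map (sq c) (hyperfilter ℕ : Filter ℕ)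
  let 𝓕 : Y → Filter Y := fun y => (⨆ _ : y = pt z, 𝓑) ⊔ ⨆ c, ⨆ _ : om c = y, 𝓞 c
  have F0 : 𝓕 (pt z) = 𝓑 := by
    simp only [𝓕, iSup_pos]
    rw [sup_eq_left]
    refine iSup₂_le fun c h => absurd h.symm (hne _ _)
  have Fo : ∀ c, 𝓕 (om c) = 𝓞 c := by
    intro c
    refine le_antisymm (sup_le (iSup_le fun h => absurd h.symm (hne _ _))
      (iSup₂_le fun c' h => le_of_eq ?_)) (le_sup_of_le_right (le_iSup₂_of_le c rfl le_rfl))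
    refine map_congr ?_
    filter_upwards [hom' _ _ h] with i hi
    simp only [sq, hi]
  have Fq : ∀ q, q ≠ z → 𝓕 (pt q) = ⊥ := by
    intro q hq
    refine le_bot_iff.1 (sup_le (iSup_le fun h => absurd (hinj h) hq)
      (iSup₂_le fun c' h => absurd h.symm (hne _ _)))
  have cs : ∀ y, y = pt z ∨ (∃ c, y = om c) ∨ ∃ q, y = pt q ∧ q ≠ z := by
    intro y
    rcases hY y with ⟨q, rfl⟩ | ⟨c, rfl⟩
    · by_cases hq : q = z
      · exact Or.inl (by rw [hq])
      · exact Or.inr (Or.inr ⟨q, rfl, hq⟩)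
    · exact Or.inr (Or.inl ⟨c, rfl⟩)
  have hyp_le : (hyperfilter ℕ : Filter ℕ) ≤ atTop := by
    rw [← Nat.cofinite_eq_atTop]
    exact hyperfilter_le_cofinite
  have ev𝓑 : ∀ {p : Y → Prop} (k : ℕ), (∀ i ≥ k, ∀ g ∈ V k i, p (pt (sg i g))) →
      ∀ᶠ y in 𝓑, p y := by
    intro p k h
    refine h𝓑.eventually_iff.2 ⟨k, trivial, ?_⟩
    rintro _ ⟨i, hi, g, hg, rfl⟩
    exact h i hi g hg
  have ev𝓑' : ∀ {p : Y → Prop} (k : ℕ), (∀ᶠ i in atTop, ∀ g ∈ V k i, p (pt (sg i g))) →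
      ∀ᶠ y in 𝓑, p y := by
    intro p k h
    obtain ⟨N, hN⟩ := eventually_atTop.1 h
    refine ev𝓑 (max k N) fun i hi g hg => hN i (le_of_max_le_right hi) g
      (hVanti i (le_max_left _ _) hg)
  have ev𝓞 : ∀ {p : Y → Prop} (c), (∀ᶠ i in atTop, p (pt (sg i (c.1 i * ζ i)))) →
      ∀ᶠ y in 𝓞 c, p y := fun c h => hyp_le h
  have t0 : ∀ {α : Type u} {l : Filter α} {f : α → Y},
      (∀ k, ∀ᶠ a in l, f a = pt z ∨ f a ∈ B k) → Tendsto f l (pure (pt z) ⊔ 𝓕 (pt z)) := by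
    intro α l f h s hs
    rw [F0, mem_sup, mem_pure] at hs
    obtain ⟨k, hk⟩ := h𝓑.mem_iff.1 hs.2
    change ∀ᶠ a in l, f a ∈ s
    filter_upwards [h k] with a ha
    rcases ha with ha | ha
    · rw [ha]
      exact hs.1
    · exact hk ha
  have tz : ∀ {α : Type u} {l : Filter α} {f : α → Y},
      (∀ᶠ a in l, f a = pt z) → Tendsto f l (pure (pt z) ⊔ 𝓕 (pt z)) :=
    fun h => t0 fun k => h.mono fun _ => Or.inl
  refine not_neBot_inf_range hX 𝓕 ?_ ?_ ?_ ?_ ?_ ?_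
    (⟨fun x => pt ⟨fun i => φ i x, hφ x⟩, ?_⟩) (om 1) ?_ ?_
  · intro a
    rcases cs a with rfl | ⟨c, rfl⟩ | ⟨q, rfl, hq⟩
    · rw [F0]
      exact ev𝓑 0 fun i _ g _ => Fq _ (sg_ne i g)
    · rw [Fo]
      exact ev𝓞 c (Eventually.of_forall fun i => Fq _ (sg_ne _ _))
    · rw [Fq q hq]
      exact eventually_bot
  · intro a b
    rcases cs b with rfl | ⟨c, rfl⟩ | ⟨q, rfl, hq⟩
    · rw [F0]
      by_cases h : ∃ i g, a = pt (sg i g)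
      · obtain ⟨i, g, rfl⟩ := h
        refine ev𝓑 (i + 1) fun j hj g' _ h' => ?_
        have := sg_inj (hinj h')
        omega
      · exact ev𝓑 0 fun i _ g _ h' => h ⟨i, g, h'.symm⟩
    · rw [Fo]
      by_cases h : ∃ i g, a = pt (sg i g)
      · obtain ⟨i, g, rfl⟩ := h
        refine ev𝓞 c ?_
        filter_upwards [eventually_gt_atTop i] with j hj h'
        exact hj.ne' (sg_inj (hinj h'))
      · exact ev𝓞 c (Eventually.of_forall fun i h' => h ⟨i, _, h'.symm⟩)
    · rw [Fq q hq]
      exact eventually_bot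
  · intro a
    rcases cs a with rfl | ⟨c, rfl⟩ | ⟨q, rfl, hq⟩
    · refine ⟨B 0, ?_, fun b hb => ?_⟩
      · rw [F0]
        exact h𝓑.mem 0
      · rcases cs b with rfl | ⟨c, rfl⟩ | ⟨q, rfl, hq⟩
        · exact absurd rfl hb
        · rw [Fo]
          refine ev𝓞 c ?_
          filter_upwards [hf c.1 c.2] with i hi
          rintro ⟨j, _, g, hg, h⟩
          obtain rfl := sg_inj (hinj h)
          rw [sg_inj' (hinj h)] at hi
          exact hi hg
        · rw [Fq q hq]
          exact eventually_bot
    · refine ⟨range (sq c), ?_, fun b hb => ?_⟩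
      · rw [Fo]
        exact range_mem_map
      · rcases cs b with rfl | ⟨c', rfl⟩ | ⟨q, rfl, hq⟩
        · rw [F0]
          refine ev𝓑' 0 ?_
          filter_upwards [hf c.1 c.2] with i hi g hg
          rintro ⟨j, h⟩
          obtain rfl := sg_inj (hinj h)
          rw [sg_inj' (hinj h)] at hi
          exact hi hg
        · rw [Fo]
          change ∀ᶠ i in (hyperfilter ℕ : Filter ℕ), sq c' i ∉ range (sq c)
          filter_upwards [hom _ _ hb] with i hi
          rintro ⟨j, h⟩
          obtain rfl := sg_inj (hinj h)
          exact hi (mul_right_cancel (sg_inj' (hinj h))).symm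
        · rw [Fq q hq]
          exact eventually_bot
    · refine ⟨∅, ?_, fun b hb => Eventually.of_forall fun y hy => hy⟩
      rw [Fq q hq]
      exact mem_bot
  · intro a b
    rcases cs b with rfl | ⟨c, rfl⟩ | ⟨q, rfl, hq⟩
    · rw [F0]
      rcases hY a with ⟨q, rfl⟩ | ⟨c, rfl⟩
      · rw [← map_mul, mul_z]
        rcases q.2 with hq | ⟨c, hcR, hq⟩
        · refine tz (ev𝓑' 0 ?_)
          filter_upwards [fin_ev q hq] with i hi g _
          rw [← map_mul, mul_sg0 hi]
        · refine t0 fun k => ev𝓑' (k + 1) ?_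
          filter_upwards [hc c hcR k, eventually_ge_atTop k] with i hi hk g hg
          rw [← map_mul, mul_sg (hq i)]
          exact Or.inr ⟨i, hk, _, (hi g hg).1, rfl⟩
      · rw [(om_z c).2]
        exact tz (ev𝓑 0 fun i _ g _ => (om_sg c i g).2)
    · rw [Fo]
      rcases hY a with ⟨q, rfl⟩ | ⟨c', rfl⟩
      · rcases q.2 with hq | ⟨c', hcR, hq⟩
        · rw [(hfo q hq c).1]
          refine tz (ev𝓞 c ?_)
          filter_upwards [fin_ev q hq] with i hi
          rw [← map_mul, mul_sg0 hi]
        · rw [(hqo q ⟨c', hcR⟩ hq c).1, Fo]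
          refine Tendsto.mono_right ?_ le_sup_right
          rw [tendsto_map'_iff]
          refine tendsto_map.congr fun i => ?_
          change pt _ = pt q * pt _
          rw [← map_mul, mul_sg (hq i), ← mul_assoc]
          rfl
      · rw [hoo]
        exact tz (ev𝓞 c (Eventually.of_forall fun i => (om_sg _ _ _).2))
    · rw [Fq q hq]
      exact tendsto_bot
  · intro a b
    rcases cs a with rfl | ⟨c, rfl⟩ | ⟨q, rfl, hq⟩
    · rw [F0]
      rcases hY b with ⟨q, rfl⟩ | ⟨c, rfl⟩
      · rw [← map_mul, z_mul]
        rcases q.2 with hq | ⟨c, hcR, hq⟩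
        · refine tz (ev𝓑' 0 ?_)
          filter_upwards [fin_ev q hq] with i hi g _
          rw [← map_mul, sg_mul0 hi]
        · refine t0 fun k => ev𝓑' (k + 1) ?_
          filter_upwards [hc c hcR k, eventually_ge_atTop k] with i hi hk g hg
          rw [← map_mul, sg_mul' (hq i)]
          exact Or.inr ⟨i, hk, _, (hi g hg).2, rfl⟩
      · rw [(om_z c).1]
        exact tz (ev𝓑 0 fun i _ g _ => (om_sg c i g).1)
    · rw [Fo]
      rcases hY b with ⟨q, rfl⟩ | ⟨c', rfl⟩
      · rcases q.2 with hq | ⟨c', hcR, hq⟩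
        · rw [(hfo q hq c).2]
          refine tz (ev𝓞 c ?_)
          filter_upwards [fin_ev q hq] with i hi
          rw [← map_mul, sg_mul0 hi]
        · rw [(hqo q ⟨c', hcR⟩ hq c).2, Fo]
          refine Tendsto.mono_right ?_ le_sup_right
          rw [tendsto_map'_iff]
          refine tendsto_map.congr fun i => ?_
          change pt _ = pt _ * pt q
          rw [← map_mul, sg_mul' (hq i), mul_assoc, hζ, ← mul_assoc]
          rfl
      · rw [hoo]
        exact tz (ev𝓞 c (Eventually.of_forall fun i => (om_sg _ _ _).1))
    · rw [Fq q hq]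
      exact tendsto_bot
  · intro a b
    have lim : ∀ (l l' : Filter Y), (∀ k, ∃ S ∈ l, ∃ S' ∈ l', ∀ i, ∀ g, pt (sg i g) ∈ S →
        ∀ g', pt (sg i g') ∈ S' → i ≥ k ∧ g * g' ∈ V k i) →
        (∀ᶠ y in l, ∃ i g, y = pt (sg i g)) → (∀ᶠ y in l', ∃ i g, y = pt (sg i g)) →
        Tendsto (fun p : Y × Y => p.1 * p.2) (l ×ˢ l') (pure (pt z) ⊔ 𝓕 (pt z)) := by
      intro l l' h h1 h2
      refine t0 fun k => ?_
      obtain ⟨S, hS, S', hS', hk⟩ := h k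
      filter_upwards [prod_mem_prod (inter_mem hS h1) (inter_mem hS' h2)]
      rintro ⟨_, _⟩ ⟨⟨h3, i, g, rfl⟩, h4, j, g', rfl⟩
      by_cases hij : i = j
      · subst hij
        obtain ⟨hi, hg⟩ := hk i g h3 g' h4
        exact Or.inr ⟨i, hi, _, hg, by rw [← map_mul, sg_mul]⟩
      · exact Or.inl (by rw [← map_mul, sg_mul_ne hij])
    have e𝓑 : ∀ᶠ y in 𝓑, ∃ i g, y = pt (sg i g) := ev𝓑 0 fun i _ g _ => ⟨i, g, rfl⟩
    have e𝓞 : ∀ c, ∀ᶠ y in 𝓞 c, ∃ i g, y = pt (sg i g) :=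
      fun c => ev𝓞 c (Eventually.of_forall fun i => ⟨i, _, rfl⟩)
    have mB : ∀ {i g k}, pt (sg i g) ∈ B k → i ≥ k ∧ g ∈ V k i := by
      rintro i g k ⟨j, hj, g', hg', h⟩
      obtain rfl := sg_inj (hinj h)
      rw [sg_inj' (hinj h)]
      exact ⟨hj, hg'⟩
    have mO : ∀ (c : R) (p : ℕ → Prop), (∀ᶠ i in atTop, p i) → ∃ S ∈ 𝓞 c, ∀ i g,
        pt (sg i g) ∈ S → p i ∧ g = c.1 i * ζ i := by
      intro c p h
      refine ⟨sq c '' {i | p i}, image_mem_map (hyp_le h), ?_⟩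
      rintro i g ⟨j, hj, h⟩
      obtain rfl := sg_inj (hinj h)
      exact ⟨hj, (sg_inj' (hinj h)).symm⟩
    rcases cs a with rfl | ⟨c, rfl⟩ | ⟨q, rfl, hq⟩
    · rcases cs b with rfl | ⟨c', rfl⟩ | ⟨q, rfl, hq⟩
      · rw [← map_mul, z_mul]
        nth_rewrite 1 [F0]
        nth_rewrite 1 [F0]
        refine lim 𝓑 𝓑 (fun k => ⟨B (k + 1), h𝓑.mem _, B (k + 1), h𝓑.mem _, ?_⟩) e𝓑 e𝓑
        intro i g h1 g' h2
        have := (mB h1).1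
        exact ⟨by omega, hb k i g (mB h1).2 g' (mB h2).2⟩
      · rw [(om_z c').1, Fo]
        nth_rewrite 1 [F0]
        refine lim 𝓑 (𝓞 c') (fun k => ?_) e𝓑 (e𝓞 c')
        obtain ⟨S, hS, h⟩ := mO c' _ ((hd k).and (hc c'.1 c'.2 (k + 1)))
        refine ⟨B (k + 2), h𝓑.mem _, S, hS, fun i g h1 g' h2 => ?_⟩
        have h3 := (mB h1).1
        obtain ⟨⟨h4, h5⟩, rfl⟩ := h i g' h2
        refine ⟨by omega, ?_⟩
        rw [← mul_assoc]
        exact h4 _ (h5 _ (mB h1).2).2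
      · rw [Fq q hq, prod_bot]
        exact tendsto_bot
    · rcases cs b with rfl | ⟨c', rfl⟩ | ⟨q, rfl, hq⟩
      · rw [(om_z c).2, Fo]
        nth_rewrite 1 [F0]
        refine lim (𝓞 c) 𝓑 (fun k => ?_) (e𝓞 c) e𝓑
        obtain ⟨S, hS, h⟩ := mO c _ ((hd k).and (hc c.1 c.2 (k + 1)))
        refine ⟨S, hS, B (k + 2), h𝓑.mem _, fun i g h1 g' h2 => ?_⟩
        have h3 := (mB h2).1
        obtain ⟨⟨h4, h5⟩, rfl⟩ := h i g h1
        refine ⟨by omega, ?_⟩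
        rw [mul_assoc, hζ, ← mul_assoc]
        exact h4 _ (h5 _ (mB h2).2).1
      · rw [hoo, Fo, Fo]
        refine lim (𝓞 c) (𝓞 c') (fun k => ?_) (e𝓞 c) (e𝓞 c')
        obtain ⟨S, hS, h⟩ := mO c _ (((he (k + 1)).and (hc (c * c').1 (c * c').2 k)).and
          (eventually_ge_atTop k))
        obtain ⟨S', hS', h'⟩ := mO c' _ (eventually_ge_atTop k)
        refine ⟨S, hS, S', hS', fun i g h1 g' h2 => ?_⟩
        obtain ⟨⟨⟨h4, h5⟩, h6⟩, rfl⟩ := h i g h1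
        obtain ⟨_, rfl⟩ := h' i g' h2
        refine ⟨h6, ?_⟩
        have : c.1 i * ζ i * (c'.1 i * ζ i) = (c * c').1 i * (ζ i * ζ i) := by
          rw [mul_assoc, ← mul_assoc (ζ i), hζ, mul_assoc, ← mul_assoc]
          rfl
        rw [this]
        exact (h5 _ h4).1
      · rw [Fq q hq, prod_bot]
        exact tendsto_bot
    · rw [Fq q hq, bot_prod]
      exact tendsto_bot
  · intro x y
    rw [← map_mul]
    exact congrArg pt (Subtype.ext (funext fun i => map_mul (φ i) x y))
  · rintro ⟨x, hx⟩
    exact hne _ _ hx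
  · rw [Fo, inf_eq_left.2]
    · infer_instance
    · rw [le_principal_iff, mem_map]
      refine Eventually.of_forall fun i => ?_
      obtain ⟨x, hx⟩ := hs i
      refine ⟨x, ?_⟩
      change pt _ = pt _
      refine congrArg pt (Subtype.ext (funext fun j => (hx j).trans ?_))
      change _ = (Pi.single i ((1 * ζ i : G i) : WithZero (G i)) : ∀ j, WithZero (G j)) j
      rw [one_mul]

end AbsClosed

namespace AbsClosed

open Filter Topology

theorem exists_tendsto_diagonal {P : ℕ → ℕ → Prop} (h : ∀ f, ∀ᶠ i in atTop, P f i) :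
    ∃ F : ℕ → ℕ, Tendsto F atTop atTop ∧ ∀ᶠ i in atTop, P (F i) i := by
  classical
  refine ⟨fun i => Nat.findGreatest (P · i) i, tendsto_atTop.2 fun N => ?_, ?_⟩
  · filter_upwards [h N, eventually_ge_atTop N] with i hi hN
    exact Nat.le_findGreatest hN hi
  · filter_upwards [h 0] with i hi
    exact Nat.findGreatest_spec (P := (P · i)) (Nat.zero_le i) hi

theorem false_of_central_powers {X : Type u} [Semigroup X] (hX : AbsolutelyTzSClosed X)
    {G : ℕ → Type u} [∀ i, Group (G i)] (φ : ∀ i, X →ₙ* WithZero (G i))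
    (R : Submonoid (∀ i, G i))
    (hφ : ∀ x, {i | φ i x ≠ 0}.Finite ∨ ∃ c ∈ R, ∀ i, φ i x = c i)
    (hs : ∀ i (g : G i), ∃ x, ∀ j, φ j x =
      (Pi.single i (g : WithZero (G i)) : ∀ j, WithZero (G j)) j)
    (A : ℕ → Set (∀ i, G i)) (hA : Monotone A) (hA1 : 1 ∈ A 0)
    (hAm : ∀ n, ∀ a ∈ A n, ∀ b ∈ A n, a * b ∈ A (n + 1)) (hAR : ∀ c ∈ R, ∃ n, c ∈ A n)
    (h : ∀ f, ∀ᶠ i in atTop, ∃ ζ : G i, (∀ g, ζ * g = g * ζ) ∧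
      ∀ c ∈ A f, ∀ a ∈ A f, ∀ m, 1 ≤ m → m ≤ 2 ^ f → a i * ζ ^ m ≠ c i) : False := by
  obtain ⟨F, hF, hP⟩ := exists_tendsto_diagonal h
  have : ∀ i, ∃ ζ : G i, (∀ g, ζ * g = g * ζ) ∧ ((∃ ζ : G i, (∀ g, ζ * g = g * ζ) ∧
      ∀ c ∈ A (F i), ∀ a ∈ A (F i), ∀ m, 1 ≤ m → m ≤ 2 ^ F i → a i * ζ ^ m ≠ c i) →
      ∀ c ∈ A (F i), ∀ a ∈ A (F i), ∀ m, 1 ≤ m → m ≤ 2 ^ F i → a i * ζ ^ m ≠ c i) := by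
    intro i
    by_cases hi : ∃ ζ : G i, (∀ g, ζ * g = g * ζ) ∧
      ∀ c ∈ A (F i), ∀ a ∈ A (F i), ∀ m, 1 ≤ m → m ≤ 2 ^ F i → a i * ζ ^ m ≠ c i
    · obtain ⟨ζ, h1, h2⟩ := hi
      exact ⟨ζ, h1, fun _ => h2⟩
    · exact ⟨1, fun g => by rw [one_mul, mul_one], fun h => absurd h hi⟩
  choose ζ hζ hζP using this
  have hcomm : ∀ i (g : G i) m, ζ i ^ m * g = g * ζ i ^ m :=
    fun i g m => ((show Commute (ζ i) g from hζ i g).pow_left m).eq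
  let V : ℕ → ∀ i, Set (G i) := fun k i => {g | ∃ a ∈ A (F i - k), ∃ m, k ≤ F i ∧ 2 ≤ m ∧
    m ≤ 2 ^ (F i - k) ∧ g = a i * ζ i ^ m}
  have pw : ∀ {n k : ℕ}, k + 1 ≤ n → 2 ^ (n - k) = 2 ^ (n - (k + 1)) + 2 ^ (n - (k + 1)) ∧
      n - k = n - (k + 1) + 1 := by
    intro n k hk
    have : n - k = n - (k + 1) + 1 := by omega
    rw [this, pow_succ]
    exact ⟨by ring, rfl⟩
  refine false_of_germ_neighbourhoods hX φ R hφ ζ hζ (fun i => hs i (ζ i)) V ?_ ?_ ?_ ?_ ?_ ?_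
  · rintro k i _ ⟨a, ha, m, hk, h2, hm, rfl⟩
    refine ⟨a, hA (by omega) ha, m, by omega, h2, ?_, rfl⟩
    have := (pw hk).1
    omega
  · rintro k i _ ⟨a, ha, m, hk, h2, hm, rfl⟩ _ ⟨a', ha', m', _, h2', hm', rfl⟩
    obtain ⟨p1, p2⟩ := pw hk
    refine ⟨a * a', p2 ▸ hAm _ a ha a' ha', m + m', by omega, by omega, by omega, ?_⟩
    rw [pow_add, Pi.mul_apply, mul_assoc, mul_assoc, ← mul_assoc (ζ i ^ m), hcomm, mul_assoc]
  · intro c hc k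
    obtain ⟨n, hn⟩ := hAR c hc
    filter_upwards [hF.eventually_ge_atTop (n + k + 1)] with i hi
    rintro _ ⟨a, ha, m, hk, h2, hm, rfl⟩
    obtain ⟨p1, p2⟩ := pw hk
    have hc : c ∈ A (F i - (k + 1)) := hA (by omega) hn
    refine ⟨⟨c * a, p2 ▸ hAm _ c hc a ha, m, by omega, h2, by omega, (mul_assoc _ _ _).symm⟩,
      ⟨a * c, p2 ▸ hAm _ a ha c hc, m, by omega, h2, by omega, ?_⟩⟩
    rw [mul_assoc, hcomm, ← mul_assoc]
    rfl
  · refine fun k => Eventually.of_forall fun i => ?_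
    rintro _ ⟨a, ha, m, hk, h2, hm, rfl⟩
    obtain ⟨p1, p2⟩ := pw hk
    refine ⟨a, hA (by omega) ha, m + 1, by omega, by omega, by omega, ?_⟩
    rw [pow_succ, mul_assoc]
  · intro k
    filter_upwards [hF.eventually_ge_atTop (k + 1)] with i hi
    obtain ⟨p1, p2⟩ := pw hi
    refine ⟨1, hA (Nat.zero_le _) hA1, 2, by omega, le_rfl, ?_, ?_⟩
    · have := Nat.one_le_two_pow (n := F i - (k + 1))
      omega
    · rw [Pi.one_apply, one_mul, pow_two]
  · intro c hc
    obtain ⟨n, hn⟩ := hAR c hc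
    filter_upwards [hF.eventually_ge_atTop n, hP] with i hi hPi
    rintro ⟨a, ha, m, hk, h2, hm, h⟩
    obtain ⟨m, rfl⟩ : ∃ m', m = m' + 1 := ⟨m - 1, by omega⟩
    rw [pow_succ, ← mul_assoc] at h
    exact hζP i hPi c (hA hi hn) a ha m (by omega) (by simp only [Nat.sub_zero] at hm; omega)
      (mul_right_cancel h).symm

end AbsClosed

namespace AbsClosed

open Filter Topology

theorem exists_pow_notMem {G : Type*} [Group G] (z : G) (M : ℕ) (W : Finset G)
    (hz : ∀ q, 1 ≤ q → q ≤ M * (M * W.card + 1) → z ^ q ≠ 1) :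
    ∃ t, ∀ m, 1 ≤ m → m ≤ M → (z ^ t) ^ m ∉ W := by
  by_contra! hcon
  choose m hm1 hmM hmW using hcon
  obtain ⟨t, ht, t', ht', hne, heq⟩ := Finset.exists_ne_map_eq_of_card_lt_of_maps_to
    (s := Finset.range (M * W.card + 1)) (t := Finset.Icc 1 M ×ˢ W)
    (f := fun t => (m t, (z ^ t) ^ m t))
    (by rw [Finset.card_product, Nat.card_Icc, Finset.card_range]; simp)
    (fun t _ => Finset.mem_product.2 ⟨Finset.mem_Icc.2 ⟨hm1 t, hmM t⟩, hmW t⟩)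
  have key : ∀ t t', t < t' → t' ∈ Finset.range (M * W.card + 1) → m t = m t' →
      (z ^ t) ^ m t ≠ (z ^ t') ^ m t' := by
    intro t t' hlt ht' hm h
    rw [Finset.mem_range] at ht'
    obtain ⟨k, rfl⟩ := Nat.exists_eq_add_of_lt hlt
    refine hz ((k + 1) * m t) (Nat.mul_pos (Nat.succ_pos k) (hm1 t)) ?_ ?_
    · rw [mul_comm M]
      exact Nat.mul_le_mul (by omega) (hmM t)
    · rw [← hm, ← pow_mul, ← pow_mul, add_assoc, add_mul, pow_add] at h
      exact (mul_eq_left.1 h.symm)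
  rw [Prod.mk.injEq] at heq
  rcases lt_or_gt_of_ne hne with h | h
  · exact key t t' h ht' heq.1 heq.2
  · exact key t' t h ht heq.1.symm heq.2.symm

section Common

variable {X : Type u} [Semigroup X] {G : ℕ → Type u} [∀ i, Group (G i)]

/-- The sequences of values of a sequence of homomorphisms at the points where all of them
are nonzero. -/
def common (φ : ∀ i, X →ₙ* WithZero (G i)) : Subsemigroup (∀ i, G i) where
  carrier := {c | ∃ x, ∀ i, φ i x = c i}
  mul_mem' := by
    rintro a b ⟨x, hx⟩ ⟨y, hy⟩
    exact ⟨x * y, fun i => by rw [map_mul, hx, hy, Pi.mul_apply, WithZero.coe_mul]⟩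

/-- The submonoid `common φ ∪ {1}`. -/
def commonOne (φ : ∀ i, X →ₙ* WithZero (G i)) : Submonoid (∀ i, G i) where
  carrier := {c | c = 1 ∨ c ∈ common φ}
  one_mem' := Or.inl rfl
  mul_mem' := by
    rintro a b (rfl | ha) (rfl | hb)
    · exact Or.inl (mul_one 1)
    · exact Or.inr (by rwa [one_mul])
    · exact Or.inr (by rwa [mul_one])
    · exact Or.inr (mul_mem ha hb)

theorem exists_mem_common {φ : ∀ i, X →ₙ* WithZero (G i)} {x : X} (h : ∀ i, φ i x ≠ 0) :
    ∃ c ∈ common φ, ∀ i, φ i x = c i := by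
  choose c hc using fun i => WithZero.ne_zero_iff_exists.1 (h i)
  exact ⟨c, ⟨x, fun i => (hc i).symm⟩, fun i => (hc i).symm⟩

open Classical in
/-- The homomorphism to `commonOne φ` induced by a sequence of homomorphisms `φ`. -/
noncomputable def commonHom (φ : ∀ i, X →ₙ* WithZero (G i)) :
    X →ₙ* WithZero (commonOne φ) where
  toFun x := if h : ∀ i, φ i x ≠ 0 then
    ((⟨_, Or.inr (exists_mem_common h).choose_spec.1⟩ : commonOne φ) : WithZero (commonOne φ))
    else 0
  map_mul' x y := by
    by_cases hx : ∀ i, φ i x ≠ 0 <;> by_cases hy : ∀ i, φ i y ≠ 0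
    · have hxy : ∀ i, φ i (x * y) ≠ 0 := fun i => by
        rw [map_mul]
        exact mul_ne_zero (hx i) (hy i)
      rw [dif_pos hxy, dif_pos hx, dif_pos hy, ← WithZero.coe_mul, WithZero.coe_inj]
      refine Subtype.ext (funext fun i => WithZero.coe_inj.1 ?_)
      change _ = ((_ * _ : G i) : WithZero (G i))
      rw [WithZero.coe_mul]
      refine ((exists_mem_common hxy).choose_spec.2 i).symm.trans ?_
      rw [map_mul, (exists_mem_common hx).choose_spec.2 i, (exists_mem_common hy).choose_spec.2 i]
    · rw [dif_neg hy, mul_zero, dif_neg]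
      intro h
      exact hy fun i => right_ne_zero_of_mul (by rw [← map_mul]; exact h i)
    · rw [dif_neg hx, zero_mul, dif_neg]
      intro h
      exact hx fun i => left_ne_zero_of_mul (by rw [← map_mul]; exact h i)
    · rw [dif_neg hx, zero_mul, dif_neg]
      intro h
      exact hx fun i => left_ne_zero_of_mul (by rw [← map_mul]; exact h i)

theorem coe_mem_range_commonHom {φ : ∀ i, X →ₙ* WithZero (G i)} {c : commonOne φ}
    (hc : c.1 ∈ common φ) : (c : WithZero (commonOne φ)) ∈ range (commonHom φ) := by
  obtain ⟨x, hx⟩ := hc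
  have h : ∀ i, φ i x ≠ 0 := fun i => by
    rw [hx]
    exact WithZero.coe_ne_zero
  refine ⟨x, (dif_pos h).trans (congrArg _ (Subtype.ext (funext fun i => ?_)))⟩
  rw [← WithZero.coe_inj, ← hx]
  exact ((exists_mem_common h).choose_spec.2 i).symm

theorem false_of_exponents (hX : AbsolutelyTzSClosed X) (φ : ∀ i, X →ₙ* WithZero (G i))
    (hφ : ∀ x, {i | φ i x ≠ 0}.Finite ∨ ∀ i, φ i x ≠ 0)
    (hs : ∀ i (g : G i), ∃ x, ∀ j, φ j x =
      (Pi.single i (g : WithZero (G i)) : ∀ j, WithZero (G j)) j)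
    (z : ∀ i, G i) (hz : ∀ i g, z i * g = g * z i)
    (ho : ∀ i q, 1 ≤ q → q ≤ i → z i ^ q ≠ 1)
    (A : ℕ → Set (∀ i, G i)) (hA : Monotone A) (hA1 : 1 ∈ A 0)
    (hAm : ∀ n, ∀ a ∈ A n, ∀ b ∈ A n, a * b ∈ A (n + 1))
    (hAR : ∀ c ∈ commonOne φ, ∃ n, c ∈ A n)
    (h : ∀ f, ∃ D N, ∀ i, ∃ W : Finset (G i), W.card ≤ N ∧ ∀ ζ : G i, (∀ g, ζ * g = g * ζ) →
      ∀ c ∈ A f, ∀ a ∈ A f, ∀ m, 1 ≤ m → m ≤ 2 ^ f → a i * ζ ^ m = c i →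
        ∃ q, 1 ≤ q ∧ q ≤ D ∧ ζ ^ q ∈ W) : False := by
  refine false_of_central_powers hX φ (commonOne φ) (fun x => (hφ x).imp_right fun h => ?_) hs A
    hA hA1 hAm hAR fun f => ?_
  · obtain ⟨c, hc, h⟩ := exists_mem_common h
    exact ⟨c, Or.inr hc, h⟩
  · obtain ⟨D, N, hDN⟩ := h f
    filter_upwards [eventually_ge_atTop (D * (D * N + 1))] with i hi
    obtain ⟨W, hWN, hW⟩ := hDN i
    obtain ⟨t, ht⟩ := exists_pow_notMem (z i) D W fun q h1 h2 => ho i q h1 (h2.trans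
      (le_trans (Nat.mul_le_mul_left _ (Nat.succ_le_succ (Nat.mul_le_mul_left _ hWN))) hi))
    have hc : ∀ g, z i ^ t * g = g * z i ^ t :=
      fun g => ((show Commute (z i) g from hz i g).pow_left t).eq
    refine ⟨z i ^ t, hc, fun c hcA a haA m h1 h2 h3 => ?_⟩
    obtain ⟨q, hq1, hqD, hq⟩ := hW _ hc c hcA a haA m h1 h2 h3
    exact ht q hq1 hqD hq

open Pointwise in
theorem false_of_countable (hX : AbsolutelyTzSClosed X) (φ : ∀ i, X →ₙ* WithZero (G i))
    (hφ : ∀ x, {i | φ i x ≠ 0}.Finite ∨ ∀ i, φ i x ≠ 0)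
    (hs : ∀ i (g : G i), ∃ x, ∀ j, φ j x =
      (Pi.single i (g : WithZero (G i)) : ∀ j, WithZero (G j)) j)
    (z : ∀ i, G i) (hz : ∀ i g, z i * g = g * z i)
    (ho : ∀ i q, 1 ≤ q → q ≤ i → z i ^ q ≠ 1)
    (hc : (common φ : Set (∀ i, G i)).Countable) : False := by
  classical
  have h1 : {c | c ∈ commonOne φ}.Countable := by
    refine ((countable_singleton 1).union hc).mono ?_
    exact fun c hc => hc
  obtain ⟨r, hr⟩ := h1.exists_eq_range ⟨1, Or.inl rfl⟩
  let A : ℕ → Set (∀ i, G i) := fun n => Nat.rec {1} (fun n S => S ∪ S * S ∪ {r n}) n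
  have hA0 : A 0 = {1} := rfl
  have hAs : ∀ n, A (n + 1) = A n ∪ A n * A n ∪ {r n} := fun n => rfl
  have hfin : ∀ n, (A n).Finite := by
    intro n
    induction n with
    | zero => exact finite_singleton _
    | succ n ih => exact (ih.union (ih.mul ih)).union (finite_singleton _)
  refine false_of_exponents hX φ hφ hs z hz ho A (monotone_nat_of_le_succ fun n => ?_) rfl
    (fun n a ha b hb => ?_) (fun c hc => ?_) fun f => ?_
  · rw [hAs]
    exact subset_union_left.trans subset_union_left
  · exact Or.inl (Or.inr (mul_mem_mul ha hb))
  · have : c ∈ range r := hr ▸ hc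
    obtain ⟨n, rfl⟩ := this
    exact ⟨n + 1, Or.inr rfl⟩
  · refine ⟨2 ^ f, ((hfin f).toFinset ×ˢ (hfin f).toFinset).card, fun i =>
      ⟨((hfin f).toFinset ×ˢ (hfin f).toFinset).image fun p => (p.1 i)⁻¹ * p.2 i,
        Finset.card_image_le, fun ζ hζ c hc a ha m h1 h2 h3 => ⟨m, h1, h2, ?_⟩⟩⟩
    refine Finset.mem_image.2 ⟨(a, c), Finset.mem_product.2
      ⟨(hfin f).mem_toFinset.2 ha, (hfin f).mem_toFinset.2 hc⟩, ?_⟩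
    exact (congrArg ((a i)⁻¹ * ·) h3).symm.trans (inv_mul_cancel_left _ _)

theorem false_of_commute (hX : AbsolutelyTzSClosed X) (φ : ∀ i, X →ₙ* WithZero (G i))
    (hφ : ∀ x, {i | φ i x ≠ 0}.Finite ∨ ∀ i, φ i x ≠ 0)
    (hs : ∀ i (g : G i), ∃ x, ∀ j, φ j x =
      (Pi.single i (g : WithZero (G i)) : ∀ j, WithZero (G j)) j)
    (z : ∀ i, G i) (hz : ∀ i g, z i * g = g * z i)
    (ho : ∀ i q, 1 ≤ q → q ≤ i → z i ^ q ≠ 1)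
    (hc : ∀ a ∈ common φ, ∀ b ∈ common φ, a * b = b * a) : False := by
  by_cases hfin : (common φ : Set (∀ i, G i)).Finite
  · exact false_of_countable hX φ hφ hs z hz ho hfin.countable
  let K := Subgroup.closure (commonOne φ : Set (∀ i, G i))
  have hsub : ∀ c ∈ commonOne φ, c ∈ K := fun c hc => Subgroup.subset_closure hc
  have hcomm : ∀ a ∈ commonOne φ, ∀ b ∈ commonOne φ, a * b = b * a := by
    rintro a (rfl | ha) b (rfl | hb)
    · rfl
    · rw [one_mul, mul_one]
    · rw [one_mul, mul_one]
    · exact hc a ha b hb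
  have hK : IsMulCommutative K := Subgroup.isMulCommutative_closure hcomm
  let ι : commonOne φ →* K := Submonoid.inclusion (T := K.toSubmonoid) hsub
  refine not_infinite_central hX (G := K) (((WithZero.map' ι : WithZero (commonOne φ) →*₀
    WithZero K) : WithZero (commonOne φ) →ₙ* WithZero K).comp (commonHom φ))
    (R := {k : K | k.1 ∈ common φ}) ?_ (fun r _ g => hK.is_comm.comm r g)
    (fun r hr r' hr' => (common φ).mul_mem hr hr') ?_
  · intro h
    refine hfin ((h.image Subtype.val).subset fun c hc => ?_)
    exact ⟨⟨c, hsub c (Or.inr hc)⟩, hc, rfl⟩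
  · intro r hr
    obtain ⟨x, hx⟩ := coe_mem_range_commonHom (c := ⟨r.1, Or.inr hr⟩) hr
    refine ⟨x, ?_⟩
    change WithZero.map' ι (commonHom φ x) = _
    rw [hx, WithZero.map'_coe]
    rfl

end Common

end AbsClosed

namespace AbsClosed

open Filter Topology

theorem lift_polyEval {S K : Type*} [Semigroup S] [Group K] (ψ : S →ₙ* K) {x y : S} {ζ : K}
    (hζ : ∀ g, ζ * g = g * ζ) (h : ψ y = ψ x * ζ) (l : List (WithOne S)) (a b : WithOne S)
    (n : ℕ) (hab : WithOne.lift ψ b = WithOne.lift ψ a * ζ ^ n) :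
    WithOne.lift ψ (polyEval b l y) = WithOne.lift ψ (polyEval a l x) * ζ ^ (n + l.length) := by
  have hζn : ∀ n g, ζ ^ n * g = g * ζ ^ n :=
    fun n g => ((show Commute ζ g from hζ g).pow_left n).eq
  induction l generalizing a b n with
  | nil => exact hab
  | cons w l ih =>
    have := ih (a * x * w) (b * y * w) (n + 1) (by
      rw [map_mul, map_mul, map_mul, map_mul, hab, WithOne.lift_coe, WithOne.lift_coe, h]
      rw [← hζ, ← mul_assoc _ ζ, mul_assoc _ _ ζ, ← pow_succ,
        mul_assoc _ (ψ x), mul_assoc _ (ζ ^ _),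
        hζn, ← mul_assoc, ← mul_assoc])
    rw [List.length_cons, add_comm l.length, ← add_assoc]
    exact this

theorem exists_pow_of_polyfinite {S : Type*} [Semigroup S] (hS : Polyfinite S) :
    ∃ (d : ℕ) (F : Set S), F.Finite ∧ ∀ (x y : S) {K : Type u} [Group K] (ψ : S →ₙ* K) (ζ : K),
      (∀ g, ζ * g = g * ζ) → ψ y = ψ x * ζ →
        ∃ n, 1 ≤ n ∧ n ≤ d ∧ ∃ u ∈ F, ∃ v ∈ F, ζ ^ n = (ψ u)⁻¹ * ψ v := by
  obtain ⟨d, F, hF, h⟩ := hS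
  refine ⟨d, F, hF, fun x y K _ ψ ζ hζ hxy => ?_⟩
  obtain ⟨f, m, hmd, ⟨hm, a, l, rfl, hf⟩, ⟨u, hu, hfu⟩, v, hv, hfv⟩ := h x y
  refine ⟨l.length, hm, hmd, u, hu, v, hv, ?_⟩
  have := lift_polyEval ψ hζ hxy l a a 0 (by rw [pow_zero, mul_one])
  rw [← hf, ← hf, hfu, hfv, zero_add, WithOne.lift_coe, WithOne.lift_coe] at this
  rw [this, inv_mul_cancel_left]

theorem false_of_polyfinite {X : Type u} [Semigroup X] {G : ℕ → Type u} [∀ i, Group (G i)]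
    (hX : AbsolutelyTzSClosed X) (φ : ∀ i, X →ₙ* WithZero (G i))
    (hφ : ∀ x, {i | φ i x ≠ 0}.Finite ∨ ∀ i, φ i x ≠ 0)
    (hs : ∀ i (g : G i), ∃ x, ∀ j, φ j x =
      (Pi.single i (g : WithZero (G i)) : ∀ j, WithZero (G j)) j)
    (z : ∀ i, G i) (hz : ∀ i g, z i * g = g * z i)
    (ho : ∀ i q, 1 ≤ q → q ≤ i → z i ^ q ≠ 1)
    {S : Type*} [Semigroup S] (hS : Polyfinite S) (ψ : ∀ i, S →ₙ* G i)
    (hψ : ∀ c ∈ common φ, ∃ s, ∀ i, ψ i s = c i) : False := by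
  classical
  rcases (common φ : Set (∀ i, G i)).eq_empty_or_nonempty with he | ⟨s, hsc⟩
  · exact false_of_countable hX φ hφ hs z hz ho (he ▸ countable_empty)
  obtain ⟨d, F, hF, h⟩ := exists_pow_of_polyfinite hS
  refine false_of_exponents hX φ hφ hs z hz ho (fun _ => commonOne φ) monotone_const (one_mem _)
    (fun n a ha b hb => mul_mem ha hb) (fun c hc => ⟨0, hc⟩) fun f =>
    ⟨2 ^ f * d, (hF.toFinset ×ˢ hF.toFinset).card, fun i =>
      ⟨(hF.toFinset ×ˢ hF.toFinset).image fun p => (ψ i p.1)⁻¹ * ψ i p.2,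
        Finset.card_image_le, fun ζ hζ c hc a ha m h1 h2 h3 => ?_⟩⟩
  have hmul : ∀ c ∈ commonOne φ, s * c ∈ common φ := by
    rintro c (rfl | hc)
    · rwa [mul_one]
    · exact mul_mem hsc hc
  obtain ⟨x, hx⟩ := hψ _ (hmul a ha)
  obtain ⟨y, hy⟩ := hψ _ (hmul c hc)
  obtain ⟨n, hn1, hnd, u, hu, v, hv, huv⟩ := h x y (ψ i) (ζ ^ m)
    (fun g => ((show Commute ζ g from hζ g).pow_left m).eq)
    (by rw [hx, hy, Pi.mul_apply, Pi.mul_apply, mul_assoc, h3])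
  refine ⟨m * n, Nat.mul_pos h1 hn1, Nat.mul_le_mul h2 hnd, Finset.mem_image.2 ⟨(u, v),
    Finset.mem_product.2 ⟨hF.mem_toFinset.2 hu, hF.mem_toFinset.2 hv⟩, ?_⟩⟩
  rw [pow_mul, huv]

end AbsClosed

namespace AbsClosed

open Filter Topology Cardinal

theorem false_of_absorbing_antitone {X : Type u} [Semigroup X] (hX : AbsolutelyTzSClosed X)
    {M : Type u} [Monoid M] (φ : X →ₙ* WithZero M) {J : Type*} [LinearOrder J] [Nonempty J]
    (U : J → Set M) (hU : Antitone U) (hUm : ∀ γ, ∀ a ∈ U γ, ∀ b ∈ U γ, a * b ∈ U γ)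
    (hUb : ∀ b, ∃ γ₀, b ∉ U γ₀ ∧ ∀ γ ≥ γ₀, ∀ a ∈ U γ, b * a ∈ U γ ∧ a * b ∈ U γ)
    (hφ : ∀ γ, ∃ x, ∃ b ∈ U γ, φ x = b) : False := by
  classical
  let κ : M → WithZero (WithZero M) := fun b => WithZero.coe (WithZero.coe b)
  have κmul : ∀ a b, κ a * κ b = κ (a * b) := fun a b => rfl
  let o : WithZero (WithZero M) := WithZero.coe (0 : WithZero M)
  have hκo : ∀ b, κ b ≠ o := fun b h => WithZero.coe_ne_zero (WithZero.coe_inj.1 h)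
  have hκ0 : ∀ b, κ b ≠ 0 := fun b => WithZero.coe_ne_zero
  have ho0 : o ≠ 0 := WithZero.coe_ne_zero
  have hκinj : Function.Injective κ := fun a b h => WithZero.coe_inj.1 (WithZero.coe_inj.1 h)
  have hoκ : ∀ b, o * κ b = o := fun b => rfl
  have hκo' : ∀ b, κ b * o = o := fun b => rfl
  have hoo : o * o = o := rfl
  let 𝓖 : Filter M := ⨅ γ, 𝓟 (U γ)
  have h𝓖 : 𝓖.HasBasis (fun _ => True) U :=
    hasBasis_iInf_principal (directed_of_isDirected_le fun a b h => hU h)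
  let 𝓕 : WithZero (WithZero M) → Filter (WithZero (WithZero M)) :=
    fun a => if a = o then map κ 𝓖 else ⊥
  have h𝓕o : 𝓕 o = map κ 𝓖 := if_pos rfl
  have h𝓕 : ∀ a, a ≠ o → 𝓕 a = ⊥ := fun a ha => if_neg ha
  have cases : ∀ a, a = 0 ∨ a = o ∨ ∃ b, a = κ b := by
    intro a
    induction a with
    | zero => exact Or.inl rfl
    | coe a =>
      induction a with
      | zero => exact Or.inr (Or.inl rfl)
      | coe a => exact Or.inr (Or.inr ⟨a, rfl⟩)
  let h : X →ₙ* WithZero (WithZero M) :=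
    ((WithZero.map' (WithZero.coeMonoidHom (α := M)) : WithZero M →*₀ WithZero (WithZero M)) :
      WithZero M →ₙ* WithZero (WithZero M)).comp φ
  have hh : ∀ x (b : M), φ x = (b : WithZero M) → h x = κ b := by
    intro x b hx
    change WithZero.map' (WithZero.coeMonoidHom (α := M)) (φ x) = _
    rw [hx, WithZero.map'_coe]
    rfl
  have hh0 : ∀ x, φ x = 0 → h x = 0 := by
    intro x hx
    change WithZero.map' (WithZero.coeMonoidHom (α := M)) (φ x) = _
    rw [hx, map_zero]
  have hl : ∀ b, Tendsto (b * ·) 𝓖 𝓖 := by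
    intro b
    obtain ⟨γ₀, _, hb⟩ := hUb b
    refine (h𝓖.tendsto_iff h𝓖).2 fun γ _ => ⟨max γ₀ γ, trivial, fun a ha => ?_⟩
    exact hU (le_max_right γ₀ γ) (hb _ (le_max_left _ _) a ha).1
  have hr : ∀ b, Tendsto (· * b) 𝓖 𝓖 := by
    intro b
    obtain ⟨γ₀, _, hb⟩ := hUb b
    refine (h𝓖.tendsto_iff h𝓖).2 fun γ _ => ⟨max γ₀ γ, trivial, fun a ha => ?_⟩
    exact hU (le_max_right γ₀ γ) (hb _ (le_max_left _ _) a ha).2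
  have hm : Tendsto (fun p : M × M => p.1 * p.2) (𝓖 ×ˢ 𝓖) 𝓖 :=
    (h𝓖.prod_self.tendsto_iff h𝓖).2 fun γ _ =>
      ⟨γ, trivial, fun p hp => hUm γ p.1 hp.1 p.2 hp.2⟩
  have hpure : ∀ a, Tendsto (fun _ : M => a) 𝓖 (pure a ⊔ 𝓕 a) :=
    fun a => tendsto_const_pure.mono_right le_sup_left
  refine not_neBot_inf_range hX 𝓕 (fun a => ?_) (fun a b => ?_) (fun a => ?_) (fun a b => ?_)
    (fun a b => ?_) (fun a b => ?_) h o ?_ ?_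
  · by_cases ha : a = o
    · rw [ha, h𝓕o, eventually_map]
      exact Eventually.of_forall fun b => h𝓕 _ (hκo b)
    · rw [h𝓕 a ha]
      exact eventually_bot
  · by_cases hb : b = o
    · rw [hb, h𝓕o, eventually_map]
      rcases cases a with rfl | rfl | ⟨a, rfl⟩
      · exact Eventually.of_forall hκ0
      · exact Eventually.of_forall hκo
      · obtain ⟨γ, hγ, _⟩ := hUb a
        filter_upwards [h𝓖.mem_of_mem (i := γ) trivial] with q hq hqa
        exact hγ (hκinj hqa ▸ hq)
    · rw [h𝓕 b hb]
      exact eventually_bot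
  · by_cases ha : a = o
    · refine ⟨univ, univ_mem, fun b hb => ?_⟩
      rw [h𝓕 b (ha ▸ hb)]
      exact eventually_bot
    · refine ⟨∅, ?_, fun b _ => Eventually.of_forall fun q => notMem_empty q⟩
      rw [h𝓕 a ha]
      exact mem_bot
  · by_cases hb : b = o
    · subst hb
      rw [h𝓕o, tendsto_map'_iff]
      rcases cases a with rfl | rfl | ⟨a, rfl⟩
      · simpa only [Function.comp_def, zero_mul] using hpure 0
      · exact hpure o
      · rw [hκo', h𝓕o]
        exact (tendsto_map.comp (hl a)).mono_right le_sup_right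
    · rw [h𝓕 b hb]
      exact tendsto_bot
  · by_cases ha : a = o
    · subst ha
      rw [h𝓕o, tendsto_map'_iff]
      rcases cases b with rfl | rfl | ⟨b, rfl⟩
      · simpa only [Function.comp_def, mul_zero] using hpure 0
      · exact hpure o
      · rw [hoκ, h𝓕o]
        exact (tendsto_map.comp (hr b)).mono_right le_sup_right
    · rw [h𝓕 a ha]
      exact tendsto_bot
  · by_cases ha : a = o
    · by_cases hb : b = o
      · rw [ha, hb, hoo, h𝓕o, prod_map_map_eq, tendsto_map'_iff]
        exact (tendsto_map.comp hm).mono_right le_sup_right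
      · rw [h𝓕 b hb, prod_bot]
        exact tendsto_bot
    · rw [h𝓕 a ha, bot_prod]
      exact tendsto_bot
  · rintro ⟨x, hx⟩
    by_cases h0 : φ x = 0
    · exact ho0 (hx.symm.trans (hh0 x h0))
    · obtain ⟨b, hb⟩ := WithZero.ne_zero_iff_exists.1 h0
      exact hκo b ((hh x b hb.symm).symm.trans hx)
  · rw [h𝓕o, inf_principal_neBot_iff]
    intro s hs
    obtain ⟨γ, _, hγ⟩ := h𝓖.mem_iff.1 (mem_map.1 hs)
    obtain ⟨x, b, hb, hx⟩ := hφ γ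
    exact ⟨κ b, hγ hb, x, hh x b hx⟩

end AbsClosed

namespace AbsClosed

open Cardinal

/-- The product of a word over `M ∪ {x}` with `u` substituted for the variable `x = none`. -/
def substProd {M : Type*} [Monoid M] (u : M) (w : List (Option M)) : M :=
  (w.map (·.getD u)).prod

theorem substProd_cons {M : Type*} [Monoid M] (u : M) (a : Option M) (w : List (Option M)) :
    substProd u (a :: w) = a.getD u * substProd u w := by
  rw [substProd, List.map_cons, List.prod_cons, substProd]

theorem substProd_singleton {M : Type*} [Monoid M] (u : M) (a : Option M) :
    substProd u [a] = a.getD u := by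
  rw [substProd, List.map_singleton, List.prod_singleton]

theorem substProd_append {M : Type*} [Monoid M] (u : M) (w w' : List (Option M)) :
    substProd u (w ++ w') = substProd u w * substProd u w' := by
  rw [substProd, List.map_append, List.prod_append, substProd, substProd]

theorem mk_submonoid_closure_le {M : Type u} [Monoid M] (s : Set M) :
    #(Submonoid.closure s) ≤ max ℵ₀ #s := by
  change #(Submonoid.closure s : Set M) ≤ _
  rw [Submonoid.closure_eq_mrange, MonoidHom.coe_mrange]
  exact mk_range_le.trans (mk_list_le_max s)

theorem exists_substProd_notMem {M E : Type u} [Monoid M] (hE : ℵ₀ < #E) (π : E → M)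
    (hπ : ∀ w b, none ∈ w → {e | substProd (π e) w = b}.Finite) (S : Set M) (hS : #S < #E) :
    ∃ e, ∀ w : List (Option M), none ∈ w → (∀ a, some a ∈ w → a ∈ S) →
      substProd (π e) w ∉ S := by
  by_contra! hcon
  let ι := List (Option S) × S
  have hι : #ι < #E := by
    rw [mk_prod, lift_id, lift_id]
    refine mul_lt_of_lt hE.le ((mk_list_le_max _).trans_lt (max_lt hE ?_)) hS
    rw [mk_option]
    exact add_lt_of_lt hE.le hS (one_lt_aleph0.trans hE)
  let V : ι → Set E := fun p => {e | none ∈ p.1 ∧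
    substProd (π e) (p.1.map (Option.map Subtype.val)) = p.2}
  have hV : ∀ p, #(V p) ≤ ℵ₀ := by
    intro p
    rw [le_aleph0_iff_set_countable]
    by_cases hp : none ∈ p.1
    · refine ((hπ (p.1.map (Option.map Subtype.val)) p.2 ?_).subset fun e he => he.2).countable
      exact List.mem_map.2 ⟨none, hp, rfl⟩
    · exact Set.countable_empty.mono fun e he => (hp he.1).elim
  have hcover : (⋃ p, V p) = Set.univ := by
    refine eq_univ_of_forall fun e => mem_iUnion.2 ?_
    obtain ⟨w, hw, hwS, hwe⟩ := hcon e
    have : ∃ w' : List (Option S), w'.map (Option.map Subtype.val) = w := by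
      rw [← mem_range, Set.range_list_map]
      rintro (_ | a) ha
      exacts [⟨none, rfl⟩, ⟨some ⟨a, hwS a ha⟩, rfl⟩]
    obtain ⟨w', rfl⟩ := this
    refine ⟨(w', ⟨_, hwe⟩), ?_, rfl⟩
    obtain ⟨a, ha, hn⟩ := List.mem_map.1 hw
    rwa [Option.map_eq_none_iff.1 hn] at ha
  refine lt_irrefl #E ?_
  calc #E = #(Set.univ : Set E) := mk_univ.symm
    _ = #(⋃ p, V p) := by rw [hcover]
    _ ≤ #ι * ⨆ p, #(V p) := mk_iUnion_le V
    _ ≤ #ι * ℵ₀ := mul_le_mul_right (ciSup_le' hV) _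
    _ < #E := mul_lt_of_lt hE.le hι hE

theorem false_of_finite_substProd {X : Type u} [Semigroup X] (hX : AbsolutelyTzSClosed X)
    {M E : Type u} [Monoid M] (φ : X →ₙ* WithZero M) (hE : ℵ₀ < #E) (hM : #M ≤ #E) (π : E → M)
    (hπ : ∀ w b, none ∈ w → {e | substProd (π e) w = b}.Finite)
    (hφ : ∀ e, ∃ x, φ x = π e) : False := by
  classical
  let J := (#E).ord.ToType
  have hJ : #J = #E := mk_ord_toType _
  have hmax : NoMaxOrder J := noMaxOrder hE.le
  have hne : Nonempty J := mk_ne_zero_iff.1 (by rw [hJ]; exact (aleph0_pos.trans hE).ne')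
  obtain ⟨r, hr⟩ : ∃ r : J → M, Function.Surjective r := by
    obtain ⟨f⟩ : Nonempty (M ↪ J) := by rwa [← le_def, hJ]
    exact ⟨_, Function.invFun_surjective f.injective⟩
  let S : ∀ α : J, (∀ β < α, E) → Submonoid M := fun α f =>
    Submonoid.closure (range (fun β : Iio α => r β) ∪ range (fun β : Iio α => π (f β β.2)))
  have hS : ∀ α f, #(S α f) < #E := by
    intro α f
    have hα : #(Iio α) < #E := mk_Iio_lt α (by rw [hJ, Ordinal.type_toType]) |>.trans_eq hJ
    refine (mk_submonoid_closure_le _).trans_lt (max_lt hE ((mk_union_le _ _).trans_lt ?_))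
    exact add_lt_of_lt hE.le (mk_range_le.trans_lt hα) (mk_range_le.trans_lt hα)
  have hwf : WellFounded (α := J) (· < ·) := wellFounded_lt
  choose g hg using fun α f => exists_substProd_notMem hE π hπ (S α f) (hS α f)
  obtain ⟨ε, hεg⟩ : ∃ ε : J → E, ∀ α, ε α = g α fun β _ => ε β := ⟨hwf.fix g, hwf.fix_eq g⟩
  let T : J → Submonoid M := fun α => S α fun β _ => ε β
  have hε : ∀ α w, none ∈ w → (∀ a, some a ∈ w → a ∈ T α) → substProd (π (ε α)) w ∉ T α := by
    intro α w hw hwT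
    have := hg α (fun β _ => ε β) w hw hwT
    rwa [← hεg] at this
  have hTr : ∀ β α, β < α → r β ∈ T α :=
    fun β α h => Submonoid.subset_closure (Or.inl ⟨⟨β, h⟩, rfl⟩)
  have hTu : ∀ β α, β < α → π (ε β) ∈ T α :=
    fun β α h => Submonoid.subset_closure (Or.inr ⟨⟨β, h⟩, rfl⟩)
  have hT : Monotone T := by
    intro β α h
    refine Submonoid.closure_le.2 (union_subset ?_ ?_)
    · rintro _ ⟨γ, rfl⟩
      exact hTr _ _ (lt_of_lt_of_le γ.2 h)
    · rintro _ ⟨γ, rfl⟩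
      exact hTu _ _ (lt_of_lt_of_le γ.2 h)
  have hTs : ∀ β α, β < α → ∀ w, (∀ a, some a ∈ w → a ∈ T β) → substProd (π (ε β)) w ∈ T α := by
    intro β α h w hw
    refine Submonoid.list_prod_mem _ fun b hb => ?_
    obtain ⟨a, ha, rfl⟩ := List.mem_map.1 hb
    cases a with
    | none => exact hTu β α h
    | some a => exact hT h.le (hw a ha)
  let U : J → Set M := fun γ => {b | ∃ α ≥ γ, ∃ w, none ∈ w ∧ (∀ a, some a ∈ w → a ∈ T α) ∧
    b = substProd (π (ε α)) w}
  have happ : ∀ γ, ∀ α ≥ γ, ∀ w w', none ∈ w ∨ none ∈ w' → (∀ a, some a ∈ w → a ∈ T α) →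
      (∀ a, some a ∈ w' → a ∈ T α) →
      substProd (π (ε α)) w * substProd (π (ε α)) w' ∈ U γ := by
    intro γ α hα w w' hw h h'
    refine ⟨α, hα, w ++ w', List.mem_append.2 hw, fun a ha => ?_, (substProd_append _ _ _).symm⟩
    exact (List.mem_append.1 ha).elim (h a) (h' a)
  have hsing : ∀ α, ∀ c ∈ T α, ∀ a, some a ∈ [some c] → a ∈ T α := by
    intro α c hc a ha
    rwa [Option.some_inj.1 (List.mem_singleton.1 ha)]
  have hUl : ∀ γ, ∀ α ≥ γ, ∀ c ∈ T α, ∀ w, none ∈ w → (∀ a, some a ∈ w → a ∈ T α) →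
      c * substProd (π (ε α)) w ∈ U γ := by
    intro γ α hα c hc w hw hwT
    have := happ γ α hα [some c] w (Or.inr hw) (hsing α c hc) hwT
    rwa [substProd_singleton, Option.getD_some] at this
  have hUr : ∀ γ, ∀ α ≥ γ, ∀ c ∈ T α, ∀ w, none ∈ w → (∀ a, some a ∈ w → a ∈ T α) →
      substProd (π (ε α)) w * c ∈ U γ := by
    intro γ α hα c hc w hw hwT
    have := happ γ α hα w [some c] (Or.inl hw) hwT (hsing α c hc)
    rwa [substProd_singleton, Option.getD_some] at this
  refine false_of_absorbing_antitone hX φ U ?_ ?_ (fun b => ?_) fun γ => ?_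
  · rintro γ γ' h _ ⟨α, hα, hw⟩
    exact ⟨α, h.trans hα, hw⟩
  · rintro γ _ ⟨α, hα, w, hw, hwT, rfl⟩ _ ⟨β, hβ, w', hw', hwT', rfl⟩
    rcases lt_trichotomy α β with h | rfl | h
    · exact hUl γ β hβ _ (hTs α β h w hwT) w' hw' hwT'
    · exact happ γ α hα w w' (Or.inl hw) hwT hwT'
    · exact hUr γ α hα _ (hTs β α h w' hwT') w hw hwT
  · obtain ⟨β, rfl⟩ := hr b
    obtain ⟨γ, hγ⟩ := exists_gt β
    refine ⟨γ, ?_, fun γ' hγ' => ?_⟩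
    · rintro ⟨α, hα, w, hw, hwT, h⟩
      exact hε α w hw hwT (h ▸ hTr β α (hγ.trans_le hα))
    · rintro _ ⟨α, hα, w, hw, hwT, rfl⟩
      have := hTr β α (hγ.trans_le (hγ'.trans hα))
      exact ⟨hUl γ' α hα _ this w hw hwT, hUr γ' α hα _ this w hw hwT⟩
  · obtain ⟨x, hx⟩ := hφ (ε γ)
    refine ⟨x, _, ⟨γ, le_rfl, [none], List.mem_singleton_self _, fun a ha => ?_, rfl⟩, ?_⟩
    · exact absurd (List.mem_singleton.1 ha) (Option.some_ne_none a)
    · rw [substProd_singleton, Option.getD_none, hx]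

end AbsClosed

namespace AbsClosed

open Cardinal

theorem map_substProd {M K : Type*} [Monoid M] [Monoid K] (f : M →* K) {u v : M} {ζ : K}
    (hζ : ∀ g, ζ * g = g * ζ) (h : f u = f v * ζ) (w : List (Option M)) :
    f (substProd u w) = f (substProd v w) * ζ ^ w.countP Option.isNone := by
  induction w with
  | nil => rw [List.countP_nil, pow_zero, mul_one]; rfl
  | cons a w ih =>
    rw [substProd_cons, substProd_cons, map_mul, map_mul, ih, List.countP_cons]
    cases a with
    | none =>
      rw [Option.getD_none, Option.getD_none, Option.isNone_none, if_pos rfl, h, pow_succ',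
        mul_assoc, ← mul_assoc ζ, hζ, mul_assoc _ ζ, ← mul_assoc]
    | some a => rw [Option.getD_some, Option.getD_some, mul_assoc]; rfl

section Triangular

variable {X : Type u} [Semigroup X] {G : ℕ → Type u} [∀ i, Group (G i)]

/-- The partial products `c * d 0 ^ ε 0 * ⋯ * d (k - 1) ^ ε (k - 1)`. -/
def partialProd (c : ∀ i, G i) (d : ℕ → ∀ i, G i) (ε : ℕ → Bool) : ℕ → ∀ i, G i
  | 0 => c
  | k + 1 => partialProd c d ε k * if ε k then d k else 1

theorem partialProd_congr (c : ∀ i, G i) (d : ℕ → ∀ i, G i) {ε ε' : ℕ → Bool} {k : ℕ}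
    (h : ∀ l < k, ε l = ε' l) : partialProd c d ε k = partialProd c d ε' k := by
  induction k with
  | zero => rfl
  | succ k ih =>
    rw [partialProd, partialProd, ih fun l hl => h l (hl.trans k.lt_succ_self), h k k.lt_succ_self]

theorem partialProd_apply (c : ∀ i, G i) (d : ℕ → ∀ i, G i) (ε : ℕ → Bool) {i k m : ℕ}
    (h : ∀ l, k ≤ l → d l i = 1) (hkm : k ≤ m) :
    partialProd c d ε m i = partialProd c d ε k i := by
  induction m, hkm using Nat.le_induction with
  | base => rfl
  | succ m hkm ih =>
    rw [partialProd, Pi.mul_apply, ih]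
    split_ifs
    · rw [h m hkm, mul_one]
    · rw [Pi.one_apply, mul_one]

theorem false_of_triangular (hX : AbsolutelyTzSClosed X) (φ : ∀ i, X →ₙ* WithZero (G i))
    {c : ∀ i, G i} (hc : c ∈ common φ) (d : ℕ → ∀ i, G i) (hd : ∀ k, d k ∈ commonOne φ)
    (t : ℕ → ℕ) (hdt : ∀ k i, i < k → d k i = 1) (hdt' : ∀ k l, k < l → d l (t k) = 1)
    (hz : ∀ k g, d k (t k) * g = g * d k (t k))
    (ho : ∀ k q, 1 ≤ q → q ≤ k → d k (t k) ^ q ≠ 1)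
    (hcard : #(commonOne φ) ≤ continuum) : False := by
  have hp : ∀ ε k, partialProd c d ε k ∈ common φ := by
    intro ε k
    induction k with
    | zero => exact hc
    | succ k ih =>
      rw [partialProd]
      split_ifs
      · rcases hd k with h | h
        · rwa [h, mul_one]
        · exact mul_mem ih h
      · rwa [mul_one]
  have hlim : ∀ ε, (fun i => partialProd c d ε (i + 1) i) ∈ common φ := by
    intro ε
    obtain ⟨x, hx⟩ := exists_forall_eq_of_forall_finset hX (ι := ULift.{u} ℕ)
      (fun i => φ i.down) (fun i => ((partialProd c d ε (i.down + 1) i.down : G i.down) :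
        WithZero (G i.down))) fun F => by
      obtain ⟨N, hN⟩ := (F.image ULift.down).exists_nat_subset_range
      obtain ⟨x, hx⟩ := hp ε N
      refine ⟨x, fun i hi => ?_⟩
      rw [hx, WithZero.coe_inj]
      exact partialProd_apply c d ε (fun l hl => hdt l _ hl)
        (Finset.mem_range.1 (hN (Finset.mem_image_of_mem _ hi)))
    exact ⟨x, fun i => hx ⟨i⟩⟩
  let π : ULift.{u} (ℕ → Bool) → commonOne φ := fun ε => ⟨_, Or.inr (hlim ε.down)⟩
  have key : ∀ (ε ε' : ULift.{u} (ℕ → Bool)) j, (∀ l < j, ε.down l = ε'.down l) →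
      ε.down j = true → ε'.down j = false → ∀ w : List (Option (commonOne φ)), none ∈ w →
      w.countP Option.isNone ≤ j → substProd (π ε) w ≠ substProd (π ε') w := by
    intro ε ε' j hl h1 h0 w hw hwj heq
    have hpos : 1 ≤ w.countP Option.isNone := List.countP_pos_iff.2 ⟨none, hw, rfl⟩
    have htj : j ≤ t j := by
      by_contra! hlt
      exact ho j 1 le_rfl (hpos.trans hwj) (by rw [hdt j _ hlt, one_pow])
    have hπ : ∀ ε : ULift.{u} (ℕ → Bool), (π ε).1 (t j) = partialProd c d ε.down (j + 1) (t j) :=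
      fun ε => partialProd_apply c d ε.down (fun l hl => hdt' j l hl) (Nat.succ_le_succ htj)
    have := map_substProd ((Pi.evalMonoidHom G (t j)).comp (commonOne φ).subtype) (u := π ε)
      (v := π ε') (hz j) (by
        change (π ε).1 (t j) = (π ε').1 (t j) * _
        rw [hπ, hπ, partialProd, partialProd, h1, h0, if_pos rfl, if_neg Bool.false_ne_true,
          mul_one, partialProd_congr c d hl, Pi.mul_apply]) w
    rw [heq] at this
    exact ho j _ hpos hwj (mul_eq_left.1 this.symm)
  have hE : #(ULift.{u} (ℕ → Bool)) = continuum := by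
    rw [mk_uLift, mk_arrow]
    simp
  refine false_of_finite_substProd hX (commonHom φ) (hE ▸ aleph0_lt_continuum) (hE ▸ hcard) π
    (fun w b hw => ?_) fun ε => coe_mem_range_commonHom (c := π ε) (hlim ε.down)
  refine Set.Finite.of_injOn (f := fun ε (l : Fin (w.countP Option.isNone)) => ε.down l)
    (t := Set.univ) (fun _ _ => mem_univ _) ?_ finite_univ
  intro ε hε ε' hε' h
  by_contra hne
  have hex : ∃ j, ε.down j ≠ ε'.down j := by
    by_contra! h
    exact hne (ULift.ext _ _ (funext h))
  classical
  let j := Nat.find hex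
  have hj : ε.down j ≠ ε'.down j := Nat.find_spec hex
  have hl : ∀ l < j, ε.down l = ε'.down l := fun l hl => not_not.1 (Nat.find_min hex hl)
  have hwj : w.countP Option.isNone ≤ j := by
    by_contra! hlt
    exact hj (congrFun h ⟨j, hlt⟩)
  have heq : substProd (π ε) w = substProd (π ε') w := hε.trans hε'.symm
  cases h1 : ε.down j
  · rw [h1] at hj
    exact key ε' ε j (fun l h => (hl l h).symm) (Bool.not_eq_false _ ▸ hj.symm) h1 w hw hwj heq.symm
  · rw [h1] at hj
    exact key ε ε' j hl h1 (Bool.eq_false_of_not_eq_true hj.symm) w hw hwj heq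

end Triangular

end AbsClosed

namespace AbsClosed

open Filter Topology Cardinal

theorem false_of_bounded_of_mk_le_continuum {X : Type u} [Semigroup X] {G : ℕ → Type u}
    [∀ i, Group (G i)] (hX : AbsolutelyTzSClosed X) (φ : ∀ i, X →ₙ* WithZero (G i))
    (hφ : ∀ x, {i | φ i x ≠ 0}.Finite ∨ ∀ i, φ i x ≠ 0)
    (hs : ∀ i (g : G i), ∃ x, ∀ j, φ j x =
      (Pi.single i (g : WithZero (G i)) : ∀ j, WithZero (G j)) j)
    (z : ∀ i, G i) (hz : ∀ i g, z i * g = g * z i)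
    (ho : ∀ i q, 1 ≤ q → q ≤ i → z i ^ q ≠ 1)
    (hb : ∀ i, ∃ b, ∀ c ∈ common φ, c i ^ (b + 1) = 1)
    (hcard : #(common φ) ≤ continuum) : False := by
  rcases (common φ : Set (∀ i, G i)).eq_empty_or_nonempty with he | ⟨s, hs'⟩
  · exact false_of_countable hX φ hφ hs z hz ho (he ▸ countable_empty)
  choose b hb using hb
  have hb1 : ∀ i, ∀ c ∈ commonOne φ, c i ^ (b i + 1) = 1 := by
    rintro i c (rfl | hc)
    · exact one_pow _
    · exact hb i c hc
  by_cases H : ∀ f, ∀ᶠ i in atTop, ∀ m, 1 ≤ m → m ≤ 2 ^ f → ∀ c ∈ commonOne φ, z i ^ m ≠ c i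
  · refine false_of_central_powers hX φ (commonOne φ) (fun x => (hφ x).imp_right fun h => ?_) hs
      (fun _ => commonOne φ) monotone_const (one_mem _) (fun n a ha b hb => mul_mem ha hb)
      (fun c hc => ⟨0, hc⟩) fun f => (H f).mono fun i hi => ⟨z i, hz i, fun c hc a ha m h1 h2 h3 =>
        hi m h1 h2 (a ^ b i * c) (mul_mem (pow_mem ha _) hc) ?_⟩
    · obtain ⟨c, hc, h⟩ := exists_mem_common h
      exact ⟨c, Or.inr hc, h⟩
    · rw [Pi.mul_apply, ← h3, ← mul_assoc, Pi.pow_apply, ← pow_succ, hb1 i a ha, one_mul]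
  have H' : ∃ f, ∃ᶠ i in atTop, ∃ m, 1 ≤ m ∧ m ≤ 2 ^ f ∧ ∃ c ∈ commonOne φ, z i ^ m = c i := by
    push Not at H
    exact H
  obtain ⟨f, hf⟩ := H'
  have step : ∀ n L, ∃ i ≥ n, ∃ d ∈ commonOne φ, (∀ l < n, d l = 1) ∧ (∀ g, d i * g = g * d i) ∧
      ∀ q, 1 ≤ q → q ≤ L → d i ^ q ≠ 1 := by
    intro n L
    let N := ∏ l ∈ Finset.range n, (b l + 1)
    have hN : 0 < N := Finset.prod_pos fun l _ => Nat.succ_pos _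
    obtain ⟨i, hi, m, h1, h2, c, hc, h⟩ := frequently_atTop.1 hf (max n (2 ^ f * N * L))
    have hdi : (c ^ N) i = z i ^ (m * N) := by rw [Pi.pow_apply, ← h, ← pow_mul]
    refine ⟨i, (le_max_left _ _).trans hi, c ^ N, pow_mem hc N, fun l hl => ?_, fun g => ?_,
      fun q hq1 hqL => ?_⟩
    · obtain ⟨k, hk⟩ := Finset.dvd_prod_of_mem (fun l => b l + 1) (Finset.mem_range.2 hl)
      change c l ^ N = 1
      rw [show N = (b l + 1) * k from hk, pow_mul, hb1 l c hc, one_pow]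
    · rw [hdi]
      exact ((show Commute (z i) g from hz i g).pow_left _).eq
    · rw [hdi, ← pow_mul]
      refine ho i _ (Nat.mul_pos (Nat.mul_pos h1 hN) hq1) ?_
      exact (Nat.mul_le_mul (Nat.mul_le_mul_right N h2) hqL).trans ((le_max_right _ _).trans hi)
  choose I hI D hD hD1 hDz hDo using step
  let ν : ℕ → ℕ := fun k => Nat.rec 0 (fun k n => I n k + 1) k
  have hν : ∀ k, ν (k + 1) = I (ν k) k + 1 := fun k => rfl
  have hmono : StrictMono ν := strictMono_nat_of_lt_succ fun k => by
    rw [hν]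
    exact Nat.lt_succ_of_le (hI _ _)
  refine false_of_triangular hX φ hs' (fun k => D (ν k) k) (fun k => hD _ _) (fun k => I (ν k) k)
    (fun k i hik => hD1 _ _ _ (hik.trans_le hmono.le_apply)) (fun k l hkl => hD1 _ _ _ ?_)
    (fun k => hDz _ _) (fun k => hDo _ _) ?_
  · have := hmono.monotone (Nat.succ_le_of_lt hkl)
    rw [Nat.succ_eq_add_one, hν] at this
    exact this
  · have : (commonOne φ : Set (∀ i, G i)) ⊆ insert 1 (common φ : Set (∀ i, G i)) := fun c hc => hc
    refine (mk_le_mk_of_subset this).trans ((mk_insert_le).trans ?_)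
    exact add_le_of_le aleph0_le_continuum hcard (one_lt_aleph0.le.trans aleph0_le_continuum)

end AbsClosed

namespace AbsClosed

theorem exists_subseq_finite_or_forall {X : Type u} [Semigroup X] (hX : AbsolutelyTzSClosed X)
    {K : ℕ → Set X} (hK : ∀ n, IsPrimeSet (K n)) :
    ∃ g : ℕ ↪o ℕ, ∀ x, {n | x ∈ K (g n)}.Finite ∨ ∀ n, x ∈ K (g n) := by
  classical
  have hex : ∃ I : Set ℕ, I.Infinite ∧ ∀ x, (I ∩ {n | x ∈ K n}).Finite ∨ ∀ n ∈ I, x ∈ K n := by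
    by_contra! hcon
    choose s hs t ht hts using fun I : {I : Set ℕ // I.Infinite} => hcon I.1 I.2
    let I : ℕ → {I : Set ℕ // I.Infinite} :=
      fun n => Nat.rec ⟨univ, infinite_univ⟩ (fun _ I => ⟨I.1 ∩ {n | s I ∈ K n}, hs I⟩) n
    refine IsPrimeSet.not_strictMono hX (K := fun n => ⋂ i ∈ (I n).1, K i) (fun n x y => ?_)
      (strictMono_nat_of_lt_succ fun n => ⟨?_, fun h => ?_⟩)
    · simp only [mem_iInter, ← forall_and]
      exact forall₂_congr fun i _ => hK i x y
    · exact biInter_subset_biInter_left inter_subset_left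
    · have hmem : s (I n) ∈ ⋂ i ∈ (I (n + 1)).1, K i := mem_iInter₂.2 fun i hi => hi.2
      exact hts (I n) (mem_iInter₂.1 (h hmem) _ (ht (I n)))
  obtain ⟨I, hI, h⟩ := hex
  have := hI.to_subtype
  have hmem : ∀ n, Nat.orderEmbeddingOfSet I n ∈ I :=
    fun n => (Nat.orderEmbeddingOfSet_range I).subset (mem_range_self n)
  refine ⟨Nat.orderEmbeddingOfSet I, fun x => (h x).imp (fun h => ?_) fun h n => ?_⟩
  · refine Set.Finite.of_finite_image (f := Nat.orderEmbeddingOfSet I) (h.subset ?_)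
      (Nat.orderEmbeddingOfSet I).injective.injOn
    rintro _ ⟨n, hn, rfl⟩
    exact ⟨hmem n, hn⟩
  · exact h _ (hmem n)

theorem spow_eq_of_dvd {X : Type*} [Semigroup X] {x e : X} {m n : ℕ} (he : e * e = e)
    (hm : spow x m = e) (h : m + 1 ∣ n + 1) : spow x n = e := by
  obtain ⟨_ | b, hb⟩ := h
  · omega
  · rw [← spow_idem he b, ← hm, spow_spow]
    congr 1
    have : (m + 1) * (b + 1) = m * b + m + b + 1 := by ring
    omega

theorem CIdem.incl_pow {X : Type u} [Semigroup X] (e : CIdem X) (z : HG e) (n : ℕ) :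
    e.incl (z ^ (n + 1)) = spow (e.incl z) n := by
  induction n with
  | zero => rw [zero_add, pow_one]; rfl
  | succ n ih => rw [pow_succ, map_mul, ih]; rfl

theorem exists_of_not_boundedSet {X : Type u} [Semigroup X] (hX : AbsolutelyTzSClosed X)
    {A : Set X} (hA : A ⊆ viableIdems X) (hb : ¬ BoundedSet X (centerSet X ∩ sqrtSet X A)) (n : ℕ) :
    ∃ (e : CIdem X) (x : X), e.val ∈ A ∧ x ∈ centerSet X ∧ x ∈ maxSubgroup X e.val ∧
      (∃ k, spow x k = e.val) ∧ ∀ q < n, spow x q ≠ e.val := by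
  classical
  let F := (finite_non_clifford hX).toFinset
  have hF : ∀ x, ∃ k, ∀ e : CIdem X, ∀ m, spow x m = e.val → spow x k = e.val := by
    intro x
    by_cases h : ∃ (e : CIdem X) (k : ℕ), spow x k = e.val
    · obtain ⟨e, k, h⟩ := h
      refine ⟨k, fun f m hf => spow_eq_of_idem f.mul_self hf ?_⟩
      rw [h, e.mul_self]
    · exact ⟨0, fun e m hm => (h ⟨e, m, hm⟩).elim⟩
  choose κ hκ using hF
  let N := (∏ x ∈ F, (κ x + 1)) * n.factorial
  have hN : N - 1 + 1 = N := Nat.succ_pred_eq_of_pos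
    (Nat.mul_pos (Finset.prod_pos fun x _ => Nat.succ_pos _) n.factorial_pos)
  rw [BoundedSet] at hb
  push Not at hb
  obtain ⟨x, hx, hxN⟩ := hb (N - 1)
  obtain ⟨e, heA, k, hk⟩ := exists_cidem hA hx
  have hne : ∀ m, spow x m = e.val → ¬ m + 1 ∣ N := by
    intro m hm hdvd
    refine hxN ?_
    rw [spow_eq_of_dvd e.mul_self hm (hN.symm ▸ hdvd)]
    exact e.mul_self
  have hxe : x * e.val = x := by
    by_contra h
    refine hne (κ x) (hκ x e k hk) (Dvd.dvd.mul_right (Finset.dvd_prod_of_mem _ ?_) _)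
    exact (finite_non_clifford hX).mem_toFinset.2 ⟨hx.1, e, ⟨k, hk⟩, h⟩
  refine ⟨e, x, heA, hx.1, e.mem_maxSubgroup_of_spow hk hxe, ⟨k, hk⟩, fun q hq h => ?_⟩
  exact hne q h (Dvd.dvd.mul_left (Nat.dvd_factorial (Nat.succ_pos q) hq) _)

theorem boundedSet_of_forall_antichain {X : Type u} [Semigroup X] (hX : AbsolutelyTzSClosed X)
    {A : Set X} (hA : A ⊆ viableIdems X)
    (h : ∀ e : ℕ → CIdem X, (∀ i, (e i).val ∈ A) → (∀ i j, i ≠ j → ¬ e i ≤ e j) →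
      (∀ x, {i | (e i).proj x ≠ 0}.Finite ∨ ∀ i, (e i).proj x ≠ 0) →
      ∀ z : ∀ i, CIdem.HG (e i), (∀ i g, z i * g = g * z i) →
      (∀ i q, 1 ≤ q → q ≤ i → z i ^ q ≠ 1) → False) :
    BoundedSet X (centerSet X ∩ sqrtSet X A) := by
  by_contra hb
  choose e x heA hxZ hxe hxk hxn using exists_of_not_boundedSet hX hA hb
  obtain ⟨g, hg | hg⟩ := CIdem.exists_subseq hX e
  · choose! κ hκ using fun x (h : ∃ k, spow x k = (e (g 0)).val) => h
    obtain ⟨K, hK⟩ := (((e (g 0)).finite_center hX).image κ).bddAbove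
    have hmem : x (g (K + 1)) ∈ centerSet X ∩ maxSubgroup X (e (g 0)).val :=
      ⟨hxZ _, hg (K + 1) ▸ hxe _⟩
    have hlt : κ (x (g (K + 1))) < g (K + 1) := by
      have h1 := hK (mem_image_of_mem κ hmem)
      have h2 : K + 1 ≤ g (K + 1) := g.strictMono.le_apply
      omega
    refine hxn _ _ hlt ?_
    rw [hg]
    exact hκ _ (hg (K + 1) ▸ hxk _)
  · obtain ⟨f, hf⟩ := exists_subseq_finite_or_forall hX fun n => (e (g n)).isPrimeSet_co
    have hco : ∀ i y, (e (g (f i))).proj y ≠ 0 ↔ y ∈ (e (g (f i))).co :=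
      fun i y => (not_congr (CIdem.proj_eq_zero _ y)).trans not_not
    have hxr : ∀ i, ∃ z, (e (g (f i))).incl z = x (g (f i)) := fun i => by
      have := hxe (g (f i))
      rwa [← CIdem.range_incl] at this
    choose z hz using hxr
    refine h (fun i => e (g (f i))) (fun i => heA _)
      (fun i j hij => hg _ _ (f.injective.ne hij)) (fun y => ?_) z
      (fun i y => ?_) fun i q hq hqi hzq => ?_
    · simp only [hco]
      exact hf y
    · refine (e (g (f i))).incl_injective ?_
      rw [map_mul, map_mul, hz]
      exact hxZ _ _
    · obtain ⟨q, rfl⟩ := Nat.exists_eq_add_of_le' hq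
      have hi : i ≤ g (f i) := f.strictMono.le_apply.trans g.strictMono.le_apply
      refine hxn _ q (hqi.trans hi) ?_
      rw [← CIdem.incl_one, ← hzq, CIdem.incl_pow, hz]

end AbsClosed

namespace AbsClosed

theorem CIdem.le_of_val_mem_co {X : Type u} [Semigroup X] {e f : CIdem X} (h : e.val ∈ f.co) :
    f ≤ e := by
  rw [mem_co, ← range_incl] at h
  obtain ⟨g, hg⟩ := h
  have hgg : g * g = g := f.incl_injective (by rw [map_mul, hg, ← f.mul_mul, e.mul_self])
  rw [mul_eq_left.1 hgg, incl_one] at hg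
  rw [le_def, ← e.comm, ← hg]

theorem CIdem.incl_notMem_co {X : Type u} [Semigroup X] {e f : CIdem X} (h : ¬ f ≤ e) (g : HG e) :
    e.incl g ∉ f.co := by
  intro hg
  rw [← mul_one g, map_mul, incl_one] at hg
  exact h (le_of_val_mem_co ((f.isPrimeSet_co _ _).1 hg).2)

end AbsClosed

open AbsClosed in
theorem statement19 (X : Type u) [Semigroup X] (hX : AbsolutelyTzSClosed X)
    (A : Set X) (hA : A ⊆ viableIdems X)
    (hyp : ∀ B ⊆ A, B.Countable → B.Infinite → IsIdemAntichain B →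
        ∀ (C : Subsemigroup X), (C : Set X) = ⋂ e ∈ B, HeCoideal X e →
          ∀ (h : ↥C →ₙ* (↥B → X)), (∀ (x : ↥C) (e : ↥B), h x e = (x : X) * (e : X)) →
            ((∀ e ∈ B, ∀ x ∈ (C : Set X), ∀ y ∈ (C : Set X),
                (x * e) * (y * e) = (y * e) * (x * e)) ∨
             Polyfinite ↥h.srange ∨
             (Set.range ⇑h).Countable ∨
             (Cardinal.mk ↥(Set.range ⇑h) ≤ Cardinal.continuum ∧
               ∀ e ∈ A, ∃ n : ℕ, ∀ x ∈ (C : Set X), spow (x * e) n ∈ idemSet X))) :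
    BoundedSet X (centerSet X ∩ sqrtSet X A) ∧
      ∀ S : Subsemigroup X, (S : Set X) ⊆ centerSet X ∩ sqrtSet X A →
        AbsolutelyT2SClosed ↥S := by
  classical
  refine (and_iff_left_of_imp fun hb S hS => absolutelyT2SClosed_of_bounded hX hA hb hS).2 ?_
  refine boundedSet_of_forall_antichain hX hA fun e heA hanti hφ z hz ho => ?_
  have hs : ∀ i (g : CIdem.HG (e i)), ∃ x, ∀ j, (e j).proj x =
      (Pi.single i (g : WithZero (CIdem.HG (e i))) : ∀ j, WithZero (CIdem.HG (e j))) j := by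
    refine fun i g => ⟨(e i).incl g, fun j => ?_⟩
    by_cases hij : j = i
    · subst hij
      rw [Pi.single_eq_same, CIdem.proj_incl]
    · rw [Pi.single_eq_of_ne (M := fun j => WithZero (CIdem.HG (e j))) hij, CIdem.proj_eq_zero]
      exact CIdem.incl_notMem_co (hanti j i hij) g
  let B : Set X := range fun i => (e i).val
  have hinj : Function.Injective fun i => (e i).val := fun i j h => by
    by_contra hij
    exact hanti i j hij (CIdem.ext h).le
  have hB : IsIdemAntichain B := by
    rintro _ ⟨i, rfl⟩ _ ⟨j, rfl⟩ hij
    have hij' : i ≠ j := fun h => hij (h ▸ rfl)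
    exact ⟨fun h => hanti i j hij' h.1, fun h => hanti j i hij'.symm h.2⟩
  let ev : ∀ i, B := fun i => ⟨(e i).val, i, rfl⟩
  let C : Subsemigroup X :=
    { carrier := ⋂ b ∈ B, HeCoideal X b
      mul_mem' := fun {x y} hx hy => by
        refine mem_iInter₂.2 ?_
        rintro _ ⟨i, rfl⟩
        exact ((e i).isPrimeSet_co x y).2
          ⟨mem_iInter₂.1 hx _ ⟨i, rfl⟩, mem_iInter₂.1 hy _ ⟨i, rfl⟩⟩ }
  have hC : ∀ x ∈ C, ∀ i, x ∈ (e i).co := fun x hx i => mem_iInter₂.1 hx _ ⟨i, rfl⟩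
  let h : C →ₙ* (B → X) :=
    { toFun := fun x b => x.1 * b.1
      map_mul' := fun x y => by
        funext b
        obtain ⟨_, i, rfl⟩ := b
        exact (e i).mul_mul x.1 y.1 }
  have hcommon : ∀ c ∈ common fun i => (e i).proj,
      ∃ x : C, ∀ i, x.1 * (e i).val = (e i).incl (c i) := by
    rintro c ⟨x, hx⟩
    refine ⟨⟨x, mem_iInter₂.2 ?_⟩, fun i => ((e i).proj_eq_coe x _).1 (hx i)⟩
    rintro _ ⟨i, rfl⟩
    refine not_not.1 (mt ((e i).proj_eq_zero x).2 ?_)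
    rw [hx]
    exact WithZero.coe_ne_zero
  have hf : ∃ f : (common fun i => (e i).proj) → range h, Function.Injective f := by
    choose f hf using hcommon
    refine ⟨fun c => ⟨h (f c.1 c.2), mem_range_self _⟩, fun c c' hcc => ?_⟩
    refine Subtype.ext (funext fun i => (e i).incl_injective ?_)
    rw [← hf c.1 c.2, ← hf c'.1 c'.2]
    exact congrFun (congrArg Subtype.val hcc) (ev i)
  obtain ⟨f, hf⟩ := hf
  rcases hyp B (range_subset_iff.2 heA) (countable_range _) (infinite_range_of_injective hinj)
    hB C rfl h (fun _ _ => rfl) with h1 | h2 | h3 | ⟨h4, h4'⟩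
  · refine false_of_commute hX _ hφ hs z hz ho fun a ha b hb => funext fun i => ?_
    obtain ⟨x, hx⟩ := hcommon a ha
    obtain ⟨y, hy⟩ := hcommon b hb
    refine (e i).incl_injective ?_
    rw [Pi.mul_apply, Pi.mul_apply, map_mul, map_mul, ← hx, ← hy]
    exact h1 _ ⟨i, rfl⟩ x.1 x.2 y.1 y.2
  · let ψ : ∀ i, h.srange →ₙ* CIdem.HG (e i) := fun i =>
      { toFun := fun s => ⟨s.1 (ev i), by
          obtain ⟨_, x, rfl⟩ := s
          exact (e i).mem_co.1 (hC x.1 x.2 i)⟩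
        map_mul' := fun _ _ => rfl }
    refine false_of_polyfinite hX _ hφ hs z hz ho h2 ψ fun c hc => ?_
    obtain ⟨x, hx⟩ := hcommon c hc
    exact ⟨⟨h x, x, rfl⟩, fun i => (e i).incl_injective (hx i)⟩
  · have := h3.to_subtype
    exact false_of_countable hX _ hφ hs z hz ho (countable_coe_iff.1 hf.countable)
  · refine false_of_bounded_of_mk_le_continuum hX _ hφ hs z hz ho (fun i => ?_)
      ((Cardinal.mk_le_of_injective hf).trans h4)
    obtain ⟨n, hn⟩ := h4' _ (heA i)
    refine ⟨n, fun c hc => ?_⟩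
    obtain ⟨x, hx⟩ := hcommon c hc
    have := hn x.1 x.2
    rw [hx, ← CIdem.incl_pow] at this
    refine mul_eq_left.1 ((e i).incl_injective ?_ : c i ^ (n + 1) * c i ^ (n + 1) = c i ^ (n + 1))
    rw [map_mul]
    exact this
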